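/- Let D be the division algebra part of a simple component of the group algebra FG of a finite group G over an abelian number field F. Then the local index of D at any prime lying over 2 is at most 2, and for any odd rational prime p, the local index at any prime over p divides p - 1. -/

import Mathlib

open scoped TensorProduct

/-- `A` is the cyclic algebra `(L/K, σ, a)`. -/
def IsCyclicAlgebra (K : Type*) [Field K] (L : Type*) [Field L] [Algebra K L]
    (σ : L ≃ₐ[K] L) (a : L) (A : Type*) [Ring A] [Algebra K A] : Prop :=
  ∃ (ι : L →ₐ[K] A) (u : Aˣ),
    (u : A) ^ Module.finrank K L = ι a ∧
    (∀ x : L, (u : A) * ι x = ι (σ x) * (u : A)) ∧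
    Function.Bijective fun f : Fin (Module.finrank K L) → L =>
      ∑ i, ι (f i) * (u : A) ^ (i : ℕ)

/-- The Schur index of a central simple `K`-algebra. -/
noncomputable def schurIndex (K A : Type*) [Field K] [Ring A] [Algebra K A] : ℕ :=
  sInf {m | ∃ (D : Type) (_ : DivisionRing D) (_ : Algebra K D) (r : ℕ),
      Nonempty (A ≃ₐ[K] Matrix (Fin r) (Fin r) D) ∧ m * m = Module.finrank K D}

/-- Local index at a real embedding. -/
noncomputable def realLocalIndex (K A : Type*) [Field K] [Ring A] [Algebra K A]
    (φ : K →+* ℝ) : ℕ :=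
  letI := φ.toAlgebra
  schurIndex ℝ (ℝ ⊗[K] A)

def IsBrauerEquiv (K A B : Type*) [Field K] [Ring A] [Algebra K A] [Ring B] [Algebra K B] :
    Prop :=
  ∃ r s : ℕ, 0 < r ∧ 0 < s ∧
    Nonempty (Matrix (Fin r) (Fin r) A ≃ₐ[K] Matrix (Fin s) (Fin s) B)

/-- The simple component `Re` of `R`, realized as `R/(1-e)`. -/
abbrev simpleComponent (R : Type*) [Ring R] (e : R) : Type _ :=
  (TwoSidedIdeal.span {1 - e}).ringCon.Quotient

noncomputable instance (F R : Type*) [CommSemiring F] [Ring R] [Algebra F R] (e : R) :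
    Algebra F (simpleComponent R e) :=
  RingHom.toAlgebra' ((TwoSidedIdeal.span {1 - e}).ringCon.mk'.comp (algebraMap F R)) <| by
    intro c x
    induction x using Quotient.inductionOn' with
    | h x =>
        show ((algebraMap F R c : R) : simpleComponent R e) * (x : simpleComponent R e)
          = (x : simpleComponent R e) * ((algebraMap F R c : R) : simpleComponent R e)
        rw [← RingCon.coe_mul, ← RingCon.coe_mul, Algebra.commutes]

/-- `e` is a centrally primitive idempotent. -/
def IsCentrallyPrimitiveIdempotent (R : Type*) [Ring R] (e : R) : Prop :=
  e ∈ Subring.center R ∧ e * e = e ∧ e ≠ 0 ∧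
    ∀ a b : R, a ∈ Subring.center R → b ∈ Subring.center R → a * a = a → b * b = b →
      a * b = 0 → e = a + b → a = 0 ∨ b = 0




noncomputable instance (priority := 1000) adicSMulCommClass {R : Type*} [CommRing R]
    [IsDedekindDomain R] {K : Type*} [Field K] [Algebra R K] [IsFractionRing R K]
    (v : IsDedekindDomain.HeightOneSpectrum R) :
    SMulCommClass K (v.adicCompletion K) (v.adicCompletion K) :=
  Algebra.to_smulCommClass

section RootsOfUnityReduction

open Polynomial IsLocalRing

variable {M : Type*} [Field M] (O : ValuationSubring M)

theorem isPrimitiveRoot_residue {m : ℕ} {z : O} (hz : IsPrimitiveRoot z m)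
    (hm : (m : ResidueField O) ≠ 0) : IsPrimitiveRoot (residue O z) m := by
  have hm0 : m ≠ 0 := by rintro rfl; simp at hm
  obtain ⟨n, rfl⟩ := Nat.exists_eq_succ_of_ne_zero hm0
  have h := congrArg (residue O) hz.prod_one_sub_pow_eq_order
  rw [map_prod] at h
  have h2 : ∏ k ∈ Finset.range n, residue O (1 - z ^ (k + 1)) ≠ 0 := by
    rw [h]; simpa using hm
  rw [Finset.prod_ne_zero_iff] at h2
  refine IsPrimitiveRoot.mk_of_lt _ (Nat.succ_pos _) ?_ ?_
  · rw [← map_pow, hz.pow_eq_one, map_one]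
  · intro l hl0 hl h1
    apply h2 (l - 1) (by simp; omega)
    rw [Nat.sub_add_cancel hl0, map_sub, map_pow, h1, map_one, sub_self]

theorem eq_of_residue_eq {m : ℕ} {z : O} (hz : IsPrimitiveRoot z m)
    (hm : (m : ResidueField O) ≠ 0) {x y : O} (hx : x ^ m = 1) (hy : y ^ m = 1)
    (h : residue O x = residue O y) : x = y := by
  have hm0 : m ≠ 0 := by rintro rfl; simp at hm
  have : NeZero m := ⟨hm0⟩
  obtain ⟨i, hi, rfl⟩ := hz.eq_pow_of_pow_eq_one hx
  obtain ⟨j, hj, rfl⟩ := hz.eq_pow_of_pow_eq_one hy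
  rw [map_pow, map_pow] at h
  rw [(isPrimitiveRoot_residue O hz hm).pow_inj hi hj h]

theorem exists_frobenius_pow_of_ringEquiv {k : Type*} [Field k] (p : ℕ) [Fact p.Prime] [CharP k p]
    (τ : k ≃+* k) {m : ℕ} (hm : m ≠ 0) {z : k} (hz : z ^ m = 1) : ∃ j : ℕ, τ z = z ^ p ^ j := by
  let : Algebra (ZMod p) k := ZMod.algebra k p
  let τ' : k ≃ₐ[ZMod p] k := AlgEquiv.ofRingEquiv (f := τ) (fun x => by
    have : ((τ : k →+* k).comp (algebraMap (ZMod p) k)) = algebraMap (ZMod p) k :=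
      Subsingleton.elim _ _
    exact congrArg (fun f => f x) this)
  have hintegral : IsIntegral (ZMod p) z :=
    ⟨X ^ m - 1, monic_X_pow_sub_C 1 hm, by simp [hz]⟩
  let E := IntermediateField.adjoin (ZMod p) {z}
  have : FiniteDimensional (ZMod p) E := IntermediateField.adjoin.finiteDimensional hintegral
  have : Finite E := Module.finite_of_finite (ZMod p)
  have : Fintype E := Fintype.ofFinite E
  have : Normal (ZMod p) E := inferInstance
  obtain ⟨j, hj⟩ := (FiniteField.bijective_frobeniusAlgEquivOfAlgebraic_pow (ZMod p) E).2
    (τ'.restrictNormal E)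
  have hzE : z ∈ E := IntermediateField.mem_adjoin_simple_self _ z
  refine ⟨j, ?_⟩
  have h1 := AlgEquiv.restrictNormal_commutes τ' E ⟨z, hzE⟩
  rw [← hj] at h1
  have h2 := congrArg (fun (f : E → E) => f ⟨z, hzE⟩)
    (FiniteField.coe_frobeniusAlgEquivOfAlgebraic_iterate (ZMod p) E j)
  rw [AlgEquiv.coe_pow] at h1
  simp only [ZMod.card] at h2
  rw [h2] at h1
  exact h1.symm

theorem exists_apply_eq_pow_prime_pow (p : ℕ) [Fact p.Prime] [CharP (ResidueField O) p]
    (σ : O ≃+* O) {m : ℕ} (hmp : m.Coprime p) {z : O} (hz : IsPrimitiveRoot z m) :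
    ∃ j : ℕ, σ z = z ^ p ^ j := by
  have hp := (Fact.out : p.Prime)
  have hm0 : m ≠ 0 := by rintro rfl; simp at hmp; exact hp.one_lt.ne' hmp
  have hm : (m : ResidueField O) ≠ 0 := by
    rw [Ne, CharP.cast_eq_zero_iff (ResidueField O) p]
    exact (Nat.Prime.coprime_iff_not_dvd hp).1 hmp.symm
  obtain ⟨j, hj⟩ := exists_frobenius_pow_of_ringEquiv p (ResidueField.mapEquiv σ) hm0
    (isPrimitiveRoot_residue O hz hm).pow_eq_one
  refine ⟨j, eq_of_residue_eq O hz hm ?_ ?_ ?_⟩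
  · rw [← map_pow, hz.pow_eq_one, map_one]
  · rw [← pow_mul, mul_comm, pow_mul, hz.pow_eq_one, one_pow]
  · rw [map_pow, ← hj]; rfl

theorem exists_algEquiv_apply_eq_pow {K : Type*} [Field K] [Algebra K M] [FiniteDimensional K M]
    [IsGalois K M] (p : ℕ) [Fact p.Prime] [CharP (ResidueField O) p]
    (hO : ∀ (σ : M ≃ₐ[K] M) (x : M), x ∈ O → σ x ∈ O) (s : ℕ)
    (hq : ∀ x : O, (x : M) ∈ Set.range (algebraMap K M) → residue O x ^ p ^ s = residue O x)
    {m : ℕ} (hmp : m.Coprime p) {z : O} (hz : IsPrimitiveRoot z m) :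
    ∃ σ : M ≃ₐ[K] M, σ z = (z : M) ^ p ^ s := by
  classical
  have hp := (Fact.out : p.Prime)
  have hm : (m : ResidueField O) ≠ 0 := by
    rw [Ne, CharP.cast_eq_zero_iff (ResidueField O) p]
    exact (Nat.Prime.coprime_iff_not_dvd hp).1 hmp.symm
  let P : O[X] := ∏ σ : M ≃ₐ[K] M, (X - C (⟨σ z, hO σ z z.2⟩ : O))
  have hP : P.map O.subtype = MulSemiringAction.charpoly (M ≃ₐ[K] M) (z : M) := by
    simp [P, Polynomial.map_prod, MulSemiringAction.charpoly_eq]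
  have hc : ∀ i, residue O (P.coeff i) ^ p ^ s = residue O (P.coeff i) := by
    intro i
    apply hq
    rw [IsGalois.mem_range_algebraMap_iff_fixed]
    intro σ
    have : ((P.coeff i : O) : M) = (MulSemiringAction.charpoly (M ≃ₐ[K] M) (z : M)).coeff i := by
      rw [← hP, coeff_map]; rfl
    rw [this]
    exact MulSemiringAction.smul_coeff_charpoly (z : M) i σ
  let P' := P.map (residue O)
  have hP' : P'.map (iterateFrobenius (ResidueField O) p s) = P' := by
    ext i
    simp [P', iterateFrobenius_def, hc]
  have h0 : P'.eval (residue O z) = 0 := by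
    simp only [P', P, Polynomial.map_prod, eval_prod]
    exact Finset.prod_eq_zero (Finset.mem_univ 1) (by simp)
  have h1 : P'.eval (residue O z ^ p ^ s) = 0 := by
    have := congrArg (iterateFrobenius (ResidueField O) p s) h0
    rw [map_zero, ← Polynomial.eval_map_apply, hP', iterateFrobenius_def] at this
    exact this
  simp only [P', P, Polynomial.map_prod, eval_prod, Finset.prod_eq_zero_iff] at h1
  obtain ⟨σ, -, hσ⟩ := h1
  refine ⟨σ, ?_⟩
  have hσ' : residue O (z ^ p ^ s) = residue O ⟨σ z, hO σ z z.2⟩ := by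
    simpa [sub_eq_zero] using hσ
  have := eq_of_residue_eq O hz hm ?_ ?_ hσ'
  · simpa using (congrArg Subtype.val this).symm
  · rw [← pow_mul, mul_comm, pow_mul, hz.pow_eq_one, one_pow]
  · apply Subtype.ext
    have : ((z ^ m : O) : M) = 1 := by rw [hz.pow_eq_one]; rfl
    simp only [SubmonoidClass.mk_pow]
    rw [← map_pow, ← SubmonoidClass.coe_pow, this, map_one]; rfl

end RootsOfUnityReduction

/-- The properties of a `p`-adic field `K` which force Schur algebras over `K` to split. -/
structure IsSchurSplittingField (p : ℕ) (K : Type) [Field K] : Prop where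
  charZero : CharZero K
  exists_root : ∃ ζ : K, IsPrimitiveRoot ζ (if p = 2 then 4 else p)
  isCyclic : ∀ m : ℕ, m.Coprime p → ∀ (M : Type) [Field M] [Algebra K M]
    [IsCyclotomicExtension {m} K M], IsCyclic (M ≃ₐ[K] M)
  exists_dvd_finrank : ∀ d : ℕ, 0 < d → ∃ m : ℕ, 0 < m ∧ m.Coprime p ∧
    ∀ (M : Type) [Field M] [Algebra K M] [IsCyclotomicExtension {m} K M], d ∣ Module.finrank K M

section LocalFields

open IsLocalRing

theorem exists_valuationSubring_of_complete (K : Type*) [NontriviallyNormedField K]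
    [IsUltrametricDist K] [CompleteSpace K] (M : Type*) [Field M] [Algebra K M]
    [FiniteDimensional K M] :
    ∃ O : ValuationSubring M, (∀ (σ : M ≃ₐ[K] M) (x : M), x ∈ O → σ x ∈ O) ∧
      (∀ x : K, algebraMap K M x ∈ O ↔ ‖x‖ ≤ 1) ∧
      ∀ (x : K) (y : O), ‖x‖ < 1 → algebraMap K M x = y → residue O y = 0 := by
  have hmul : ∀ x y : M, spectralNorm K M (x * y) = spectralNorm K M x * spectralNorm K M y :=
    fun x y => map_mul (spectralMulAlgNorm K M) x y
  have hna : IsNonarchimedean (spectralNorm K M) := isNonarchimedean_spectralNorm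
  have h1 : spectralNorm K M 1 = 1 := spectralNorm_one
  have h0 : spectralNorm K M 0 = 0 := map_zero (spectralMulAlgNorm K M)
  have hnn : ∀ x, 0 ≤ spectralNorm K M x := fun x => apply_nonneg (spectralMulAlgNorm K M) x
  let O : ValuationSubring M :=
    { carrier := {x | spectralNorm K M x ≤ 1}
      mul_mem' := fun {x y} hx hy => by
        simp only [Set.mem_ofPred_eq] at *
        rw [hmul]; exact mul_le_one₀ hx (hnn y) hy
      one_mem' := h1.le
      add_mem' := fun {x y} hx hy => (hna x y).trans (max_le hx hy)
      zero_mem' := by simp [h0]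
      neg_mem' := fun {x} hx => by
        simp only [Set.mem_ofPred_eq] at *
        rwa [spectralNorm_neg (Algebra.IsAlgebraic.isAlgebraic x)]
      mem_or_inv_mem' := fun x => by
        by_cases hx : x = 0
        · left; simp [hx, h0]
        · have h := hmul x x⁻¹
          rw [mul_inv_cancel₀ hx, h1] at h
          by_contra! hc
          have hc1 : 1 < spectralNorm K M x := not_le.1 hc.1
          have hc2 : 1 < spectralNorm K M x⁻¹ := not_le.1 hc.2
          nlinarith }
  refine ⟨O, ?_, ?_, ?_⟩
  · intro σ x hx
    change spectralNorm K M (σ x) ≤ 1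
    rwa [← spectralNorm_eq_of_equiv σ x]
  · intro x
    change spectralNorm K M (algebraMap K M x) ≤ 1 ↔ _
    rw [spectralNorm_extends]
  · intro x y hx hxy
    rw [residue_eq_zero_iff, mem_maximalIdeal, mem_nonunits_iff]
    rintro ⟨u, hu⟩
    have h2 : (y : M) * ((u⁻¹ : Oˣ) : O) = 1 := by
      rw [← hu]; exact congrArg Subtype.val (u.mul_inv)
    have h3 : spectralNorm K M (((u⁻¹ : Oˣ) : O) : M) ≤ 1 := ((u⁻¹ : Oˣ) : O).2
    have h4 := congrArg (spectralNorm K M) h2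
    rw [hmul, h1, ← hxy, spectralNorm_extends] at h4
    nlinarith [hnn (((u⁻¹ : Oˣ) : O) : M), norm_nonneg x]

theorem IsPrimitiveRoot.pow_eq_pow_iff {R : Type*} [CommRing R] {z : R} {m : ℕ} (hm : 0 < m)
    (hz : IsPrimitiveRoot z m) {a b : ℕ} : z ^ a = z ^ b ↔ a ≡ b [MOD m] := by
  have h : IsOfFinOrder z := isOfFinOrder_iff_pow_eq_one.2 ⟨m, hm, hz.pow_eq_one⟩
  rw [h.pow_eq_pow_iff_modEq, ← hz.eq_orderOf]

theorem isCyclic_of_forall_exists_pow {K M : Type*} [Field K] [Field M] [Algebra K M] (p m : ℕ)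
    [NeZero m] (hmp : m.Coprime p) {z : M} (hz : IsPrimitiveRoot z m) [IsCyclotomicExtension {m} K M]
    (h : ∀ σ : M ≃ₐ[K] M, ∃ j : ℕ, σ z = z ^ p ^ j) : IsCyclic (M ≃ₐ[K] M) := by
  let u : (ZMod m)ˣ := ZMod.unitOfCoprime p hmp.symm
  have hmem : ∀ σ, hz.autToPow K σ ∈ Subgroup.zpowers u := by
    intro σ
    obtain ⟨j, hj⟩ := h σ
    refine ⟨j, ?_⟩
    apply Units.ext
    have h1 := hz.autToPow_spec K σ
    rw [hj, hz.pow_eq_pow_iff (NeZero.pos m), ← ZMod.natCast_eq_natCast_iff,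
      ZMod.natCast_val, ZMod.cast_id] at h1
    rw [h1]
    simp [u]
  have hinj : Function.Injective (hz.autToPow K) :=
    hz.autToPow_injective K
  let f : (M ≃ₐ[K] M) →* Subgroup.zpowers u := (hz.autToPow K).codRestrict _ hmem
  exact isCyclic_of_injective f fun a b hab => hinj (congrArg Subtype.val hab)

theorem dvd_of_forall_pow {K M : Type*} [Field K] [Field M] [Algebra K M] [FiniteDimensional K M]
    [IsGalois K M] {q d : ℕ} (hq : 1 < q) (hd : 0 < d) {z : M} (hz : IsPrimitiveRoot z (q ^ d - 1))
    (σ : M ≃ₐ[K] M) (h : σ z = z ^ q) : d ∣ Module.finrank K M := by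
  have hpow : ∀ i : ℕ, (σ ^ i) z = z ^ q ^ i := by
    intro i
    induction i with
    | zero => simp
    | succ i ih => rw [pow_succ', AlgEquiv.mul_apply, ih, map_pow, h, ← pow_mul, pow_succ']
  have h1 := hpow (orderOf σ)
  rw [pow_orderOf_eq_one, AlgEquiv.one_apply] at h1
  nth_rw 1 [← pow_one z] at h1
  have hm : 0 < q ^ d - 1 := by have := Nat.one_lt_pow hd.ne' hq; omega
  rw [hz.pow_eq_pow_iff hm,
    Nat.modEq_iff_dvd' (Nat.one_le_pow _ _ (by omega))] at h1
  have h2 := Nat.gcd_eq_left h1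
  rw [Nat.pow_sub_one_gcd_pow_sub_one] at h2
  have h3 : 1 ≤ q ^ d := Nat.one_le_pow _ _ (by omega)
  have h4 : 1 ≤ q ^ d.gcd (orderOf σ) := Nat.one_le_pow _ _ (by omega)
  have h5 : d.gcd (orderOf σ) = d := Nat.pow_right_injective hq (by
    change q ^ _ = q ^ _
    omega)
  rw [← IsGalois.card_aut_eq_finrank]
  exact (h5 ▸ Nat.gcd_dvd_right d (orderOf σ)).trans (orderOf_dvd_natCard σ)

theorem isSchurSplittingField_aux (p : ℕ) [Fact p.Prime] (K : Type) [NontriviallyNormedField K]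
    [IsUltrametricDist K] [CompleteSpace K] [CharZero K] (hp : ‖(p : K)‖ < 1) (s : ℕ) (hs : 0 < s)
    (hq : ∀ x : K, ‖x‖ ≤ 1 → ‖x ^ p ^ s - x‖ < 1) :
    (∀ m : ℕ, m.Coprime p → ∀ (M : Type) [Field M] [Algebra K M]
    [IsCyclotomicExtension {m} K M], IsCyclic (M ≃ₐ[K] M)) ∧
    ∀ d : ℕ, 0 < d → ∃ m : ℕ, 0 < m ∧ m.Coprime p ∧
    ∀ (M : Type) [Field M] [Algebra K M] [IsCyclotomicExtension {m} K M],
      d ∣ Module.finrank K M := by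
  have hpp := (Fact.out : p.Prime)
  have hchar : ∀ (M : Type) [Field M] [Algebra K M] (O : ValuationSubring M),
      (∀ (x : K) (y : O), ‖x‖ < 1 → algebraMap K M x = y → residue O y = 0) →
      CharP (ResidueField O) p := by
    intro M _ _ O hO
    rw [CharP.charP_iff_prime_eq_zero hpp]
    have := hO p (p : O) hp (by simp)
    simpa using this
  have hintegral : ∀ (M : Type) [Field M] (O : ValuationSubring M) (z : M) (m : ℕ), m ≠ 0 →
      IsPrimitiveRoot z m → ∃ z' : O, (z' : M) = z ∧ IsPrimitiveRoot z' m := by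
    intro M _ O z m hm hz
    have hzO : z ∈ O := by
      rcases O.mem_or_inv_mem z with h | h
      · exact h
      · have : z = z⁻¹ ^ (m - 1) := by
          have h0 : z ≠ 0 := hz.ne_zero hm
          rw [inv_pow]
          apply eq_inv_of_mul_eq_one_right
          rw [← pow_succ, Nat.sub_add_cancel (by omega), hz.pow_eq_one]
        rw [this]; exact pow_mem h _
    exact ⟨⟨z, hzO⟩, rfl, IsPrimitiveRoot.of_map_of_injective (f := O.subtype) hz
      Subtype.val_injective⟩
  refine ⟨?_, ?_⟩
  · intro m hm M _ _ _
    have hm0 : m ≠ 0 := by rintro rfl; simp at hm; exact hpp.one_lt.ne' hm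
    have : NeZero m := ⟨hm0⟩
    have := IsCyclotomicExtension.finiteDimensional {m} K M
    obtain ⟨O, hO1, hO2, hO3⟩ := exists_valuationSubring_of_complete K M
    have := hchar M O hO3
    have hz := IsCyclotomicExtension.zeta_spec m K M
    refine isCyclic_of_forall_exists_pow p m hm hz fun σ => ?_
    obtain ⟨z', hz', hz'2⟩ := hintegral M O _ m hm0 hz
    let σ' : O ≃+* O :=
      { toFun := fun x => ⟨σ x, hO1 σ x x.2⟩
        invFun := fun x => ⟨σ.symm x, hO1 σ.symm x x.2⟩
        left_inv := fun x => by simp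
        right_inv := fun x => by simp
        map_mul' := fun x y => by ext; simp
        map_add' := fun x y => by ext; simp }
    obtain ⟨j, hj⟩ := exists_apply_eq_pow_prime_pow O p σ' hm hz'2
    refine ⟨j, ?_⟩
    rw [← hz']
    exact congrArg Subtype.val hj
  · intro d hd
    have h1 : 1 < p ^ s := Nat.one_lt_pow hs.ne' hpp.one_lt
    have h2 : 1 < (p ^ s) ^ d := Nat.one_lt_pow hd.ne' h1
    have hcop : Nat.Coprime ((p ^ s) ^ d - 1) p := by
      rw [Nat.coprime_comm, Nat.Prime.coprime_iff_not_dvd hpp]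
      intro h
      have h3 : p ∣ (p ^ s) ^ d := by
        rw [← pow_mul]; exact dvd_pow_self _ (Nat.mul_pos hs hd).ne'
      have h4 : p ∣ 1 := by
        have := Nat.dvd_sub h3 h
        rwa [Nat.sub_sub_self h2.le] at this
      exact hpp.one_lt.ne' (Nat.dvd_one.1 h4)
    refine ⟨(p ^ s) ^ d - 1, by omega, hcop, ?_⟩
    intro M _ _ _
    have hm0 : (p ^ s) ^ d - 1 ≠ 0 := by omega
    have : NeZero ((p ^ s) ^ d - 1) := ⟨hm0⟩
    have := IsCyclotomicExtension.finiteDimensional {(p ^ s) ^ d - 1} K M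
    have := IsCyclotomicExtension.isGalois {(p ^ s) ^ d - 1} K M
    obtain ⟨O, hO1, hO2, hO3⟩ := exists_valuationSubring_of_complete K M
    have := hchar M O hO3
    have hz := IsCyclotomicExtension.zeta_spec ((p ^ s) ^ d - 1) K M
    obtain ⟨z', hz', hz'2⟩ := hintegral M O _ _ hm0 hz
    obtain ⟨σ, hσ⟩ := exists_algEquiv_apply_eq_pow (K := K) O p hO1 s (by
      rintro x ⟨y, hy⟩
      have hy1 : ‖y‖ ≤ 1 := (hO2 y).1 (hy ▸ x.2)
      have := hO3 _ (x ^ p ^ s - x) (hq y hy1) (by simp [hy])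
      simpa [sub_eq_zero] using this) hcop hz'2
    rw [hz'] at hσ
    exact dvd_of_forall_pow h1 hd hz σ hσ

end LocalFields

section AdicCompletion

open IsDedekindDomain NumberField

theorem exists_int_valued_sub_lt {Z : Type} [Field Z] [NumberField Z]
    (v : HeightOneSpectrum (𝓞 Z)) (x : v.adicCompletion Z) (hx : Valued.v x ≤ 1) :
    ∃ a : 𝓞 Z, Valued.v (x - algebraMap Z (v.adicCompletion Z) (algebraMap (𝓞 Z) Z a)) < 1 := by
  have hd := HeightOneSpectrum.denseRange_algebraMap (R := 𝓞 Z) (K := Z) v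
  have hopen : IsOpen {y : v.adicCompletion Z | Valued.v (y - x) < 1} := by
    have h := (Valued.isOpen_ball (v.adicCompletion Z) 1).preimage
      (by fun_prop : Continuous fun y : v.adicCompletion Z => y - x)
    convert h using 1
    ext y
    simp [Valuation.restrict_lt_one_iff]
  obtain ⟨y, hy⟩ := hd.exists_mem_open hopen ⟨x, by simp⟩
  have hy' : Valued.v (algebraMap Z (v.adicCompletion Z) y - x) < 1 := hy
  have hv : ∀ y : Z, Valued.v (algebraMap Z (v.adicCompletion Z) y) = v.valuation Z y := fun y =>
    HeightOneSpectrum.valuedAdicCompletion_eq_valuation' v y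
  have hy1 : v.valuation Z y ≤ 1 := by
    rw [← hv, ← sub_add_cancel (algebraMap Z (v.adicCompletion Z) y) x]
    exact (Valued.v.map_add _ _).trans (max_le hy'.le hx)
  obtain ⟨a, ha⟩ := HeightOneSpectrum.exists_valuation_sub_lt_of_integer v hy1 1
  refine ⟨a, ?_⟩
  rw [← hv, map_sub] at ha
  have : x - algebraMap Z (v.adicCompletion Z) (algebraMap (𝓞 Z) Z a) =
    -((algebraMap Z (v.adicCompletion Z) y - x) +
      (algebraMap Z (v.adicCompletion Z) (algebraMap (𝓞 Z) Z a) -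
        algebraMap Z (v.adicCompletion Z) y)) := by ring
  rw [this, Valuation.map_neg]
  exact (Valued.v.map_add _ _).trans_lt (max_lt hy' (by simpa using ha))

theorem exists_valued_pow_sub_lt {Z : Type} [Field Z] [NumberField Z]
    (v : HeightOneSpectrum (𝓞 Z)) (p : ℕ) [Fact p.Prime] (hp : (p : 𝓞 Z) ∈ v.asIdeal) :
    ∃ s : ℕ, 0 < s ∧ ∀ x : v.adicCompletion Z, Valued.v x ≤ 1 → Valued.v (x ^ p ^ s - x) < 1 := by
  have hmax : v.asIdeal.IsMaximal := v.isMaximal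
  let _ : Field (𝓞 Z ⧸ v.asIdeal) := Ideal.Quotient.field v.asIdeal
  have : Finite (𝓞 Z ⧸ v.asIdeal) := v.asIdeal.finiteQuotientOfFreeOfNeBot v.ne_bot
  let _ : Fintype (𝓞 Z ⧸ v.asIdeal) := Fintype.ofFinite _
  have : CharP (𝓞 Z ⧸ v.asIdeal) p := by
    rw [CharP.charP_iff_prime_eq_zero Fact.out]
    exact Ideal.Quotient.eq_zero_iff_mem.2 hp
  obtain ⟨n, -, hn⟩ := FiniteField.card (𝓞 Z ⧸ v.asIdeal) p
  refine ⟨n, n.pos, fun x hx => ?_⟩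
  obtain ⟨a, ha⟩ := exists_int_valued_sub_lt v x hx
  have hv : ∀ y : Z, Valued.v (algebraMap Z (v.adicCompletion Z) y) = v.valuation Z y := fun y =>
    HeightOneSpectrum.valuedAdicCompletion_eq_valuation' v y
  set b := algebraMap Z (v.adicCompletion Z) (algebraMap (𝓞 Z) Z a) with hb
  have hab : Valued.v (b ^ p ^ (n : ℕ) - b) < 1 := by
    have h1 : a ^ p ^ (n : ℕ) - a ∈ v.asIdeal := by
      rw [← Ideal.Quotient.eq_zero_iff_mem, map_sub, map_pow, ← hn, FiniteField.pow_card, sub_self]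
    rw [← v.valuation_lt_one_iff_mem (K := Z), ← hv] at h1
    simpa [hb] using h1
  have hb1 : Valued.v b ≤ 1 := by rw [hb, hv]; exact v.valuation_le_one a
  let X : v.adicCompletionIntegers Z := ⟨x, hx⟩
  let B : v.adicCompletionIntegers Z := ⟨b, hb1⟩
  obtain ⟨c, hc⟩ := sub_dvd_pow_sub_pow X B (p ^ (n : ℕ))
  have hc' : x ^ p ^ (n : ℕ) - b ^ p ^ (n : ℕ) = (x - b) * c := congrArg Subtype.val hc
  have : x ^ p ^ (n : ℕ) - x = ((x - b) * c + (b ^ p ^ (n : ℕ) - b)) - (x - b) := by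
    rw [← hc']; ring
  rw [this]
  refine (Valued.v.map_sub _ _).trans_lt (max_lt ((Valued.v.map_add _ _).trans_lt
    (max_lt ?_ hab)) ha)
  rw [map_mul]
  exact mul_lt_one_of_lt_of_le ha c.2

theorem adicCompletion_aux {Z : Type} [Field Z] [NumberField Z]
    (v : HeightOneSpectrum (𝓞 Z)) (p : ℕ) [Fact p.Prime] (hp : (p : 𝓞 Z) ∈ v.asIdeal) :
    (∀ m : ℕ, m.Coprime p → ∀ (M : Type) [Field M] [Algebra (v.adicCompletion Z) M]
    [IsCyclotomicExtension {m} (v.adicCompletion Z) M], IsCyclic (M ≃ₐ[v.adicCompletion Z] M)) ∧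
    ∀ d : ℕ, 0 < d → ∃ m : ℕ, 0 < m ∧ m.Coprime p ∧
    ∀ (M : Type) [Field M] [Algebra (v.adicCompletion Z) M]
      [IsCyclotomicExtension {m} (v.adicCompletion Z) M],
      d ∣ Module.finrank (v.adicCompletion Z) M := by
  have hval : ∀ x : v.adicCompletion Z, Valued.v x < 1 ↔ ‖x‖ < 1 := by
    intro x; rw [Valued.toNormedField.norm_lt_one_iff]
  have hval' : ∀ x : v.adicCompletion Z, Valued.v x ≤ 1 ↔ ‖x‖ ≤ 1 := by
    intro x; rw [Valued.toNormedField.norm_le_one_iff]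
  have hp' : ‖(p : v.adicCompletion Z)‖ < 1 := by
    have h := (v.valuation_lt_one_iff_mem (K := Z) (p : 𝓞 Z)).2 hp
    rw [← hval]
    rw [← HeightOneSpectrum.valuedAdicCompletion_eq_valuation] at h
    simpa using h
  have hch : CharZero (v.adicCompletion Z) :=
    charZero_of_injective_algebraMap (algebraMap Z (v.adicCompletion Z)).injective
  have hp0 : (p : v.adicCompletion Z) ≠ 0 := Nat.cast_ne_zero.2 (Fact.out : p.Prime).ne_zero
  let _ : NontriviallyNormedField (v.adicCompletion Z) :=
    { (inferInstance : NormedField (v.adicCompletion Z)) with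
      non_trivial := ⟨(p : v.adicCompletion Z)⁻¹, by
        rw [norm_inv]; exact (one_lt_inv₀ (norm_pos_iff.2 hp0)).2 hp'⟩ }
  obtain ⟨s, hs, hq⟩ := exists_valued_pow_sub_lt v p hp
  exact isSchurSplittingField_aux p (v.adicCompletion Z) hp' s hs
    fun x hx => (hval _).1 (hq x ((hval' x).2 hx))

end AdicCompletion

section Inheritance

theorem isCyclotomicExtension_adjoin {K M : Type*} [Field K] [Field M] [Algebra K M]
    [FiniteDimensional K M] {m : ℕ}
    [NeZero m] {z : M} (hz : IsPrimitiveRoot z m) :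
    IsCyclotomicExtension {m} K (IntermediateField.adjoin K {z}) :=
  hz.intermediateField_adjoin_isCyclotomicExtension K

theorem isCyclic_and_dvd_of_finiteDimensional {p : ℕ} (hp : p.Prime) {K K' : Type} [Field K]
    [Field K'] [Algebra K K'] [FiniteDimensional K K']
    (h1 : ∀ m : ℕ, m.Coprime p → ∀ (M : Type) [Field M] [Algebra K M]
      [IsCyclotomicExtension {m} K M], IsCyclic (M ≃ₐ[K] M))
    (h2 : ∀ d : ℕ, 0 < d → ∃ m : ℕ, 0 < m ∧ m.Coprime p ∧
      ∀ (M : Type) [Field M] [Algebra K M] [IsCyclotomicExtension {m} K M],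
        d ∣ Module.finrank K M) :
    (∀ m : ℕ, m.Coprime p → ∀ (M : Type) [Field M] [Algebra K' M]
      [IsCyclotomicExtension {m} K' M], IsCyclic (M ≃ₐ[K'] M)) ∧
    ∀ d : ℕ, 0 < d → ∃ m : ℕ, 0 < m ∧ m.Coprime p ∧
      ∀ (M : Type) [Field M] [Algebra K' M] [IsCyclotomicExtension {m} K' M],
        d ∣ Module.finrank K' M := by
  constructor
  · intro m hm M _ _ _
    let _ : Algebra K M := Algebra.compHom M (algebraMap K K')
    have : IsScalarTower K K' M := .of_algebraMap_eq fun _ => rfl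
    have hm0 : m ≠ 0 := by rintro rfl; simp at hm; exact hp.one_lt.ne' hm
    have : NeZero m := ⟨hm0⟩
    have hz := IsCyclotomicExtension.zeta_spec m K' M
    set z := IsCyclotomicExtension.zeta m K' M
    have := IsCyclotomicExtension.finiteDimensional {m} K' M
    have : FiniteDimensional K M := Module.Finite.trans K' M
    have hL := isCyclotomicExtension_adjoin (K := K) hz
    have := IsCyclotomicExtension.isGalois {m} K (IntermediateField.adjoin K {z})
    have := h1 m hm (IntermediateField.adjoin K {z})
    let f : (M ≃ₐ[K'] M) →* (IntermediateField.adjoin K {z} ≃ₐ[K] IntermediateField.adjoin K {z}) :=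
      (AlgEquiv.restrictNormalHom _).comp (AlgEquiv.restrictScalarsHom K)
    refine isCyclic_of_injective f ((injective_iff_map_eq_one f).2 fun σ hσ => ?_)
    apply hz.autToPow_injective K'
    rw [map_one]
    have h3 : σ z = z := by
      have := AlgEquiv.restrictNormal_commutes (AlgEquiv.restrictScalars K σ)
        (IntermediateField.adjoin K {z})
        ⟨z, IntermediateField.mem_adjoin_simple_self K z⟩
      have h4 : (AlgEquiv.restrictScalars K σ).restrictNormal
        (IntermediateField.adjoin K {z}) = 1 := hσ
      rw [h4] at this
      exact this.symm
    have h5 := hz.autToPow_spec K' σ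
    rw [h3] at h5
    nth_rw 3 [← pow_one z] at h5
    rw [hz.pow_eq_pow_iff (NeZero.pos m), ← ZMod.natCast_eq_natCast_iff,
      ZMod.natCast_val, ZMod.cast_id] at h5
    apply Units.ext
    simpa using h5
  · intro d hd
    obtain ⟨m, hm, hmp, h⟩ := h2 (d * Module.finrank K K') (Nat.mul_pos hd Module.finrank_pos)
    refine ⟨m, hm, hmp, ?_⟩
    intro M _ _ _
    let _ : Algebra K M := Algebra.compHom M (algebraMap K K')
    have : IsScalarTower K K' M := .of_algebraMap_eq fun _ => rfl
    have : NeZero m := ⟨hm.ne'⟩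
    have hz := IsCyclotomicExtension.zeta_spec m K' M
    set z := IsCyclotomicExtension.zeta m K' M
    have := IsCyclotomicExtension.finiteDimensional {m} K' M
    have : FiniteDimensional K M := Module.Finite.trans K' M
    have hL := isCyclotomicExtension_adjoin (K := K) hz
    have h3 := h (IntermediateField.adjoin K {z})
    have h4 : Module.finrank K (IntermediateField.adjoin K {z}) ∣ Module.finrank K M :=
      ⟨_, (Module.finrank_mul_finrank K (IntermediateField.adjoin K {z}) M).symm⟩
    rw [← Module.finrank_mul_finrank K K' M, mul_comm] at h4
    exact Nat.dvd_of_mul_dvd_mul_right Module.finrank_pos (h3.trans h4)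

theorem IsSchurSplittingField.of_finiteDimensional {p : ℕ} (hp : p.Prime) {K K' : Type} [Field K]
    [Field K'] [Algebra K K'] [FiniteDimensional K K'] (h : IsSchurSplittingField p K) :
    IsSchurSplittingField p K' := by
  obtain ⟨h1, h2⟩ := isCyclic_and_dvd_of_finiteDimensional (K' := K') hp h.isCyclic
    h.exists_dvd_finrank
  refine ⟨?_, ?_, h1, h2⟩
  · have := h.charZero
    exact charZero_of_injective_algebraMap (algebraMap K K').injective
  · obtain ⟨ζ, hζ⟩ := h.exists_root
    exact ⟨algebraMap K K' ζ, hζ.map_of_injective (algebraMap K K').injective⟩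

open IsDedekindDomain NumberField in
theorem exists_isSchurSplittingField {Z : Type} [Field Z] [NumberField Z]
    (v : HeightOneSpectrum (𝓞 Z)) (p : ℕ) (hpp : p.Prime) (hp : (p : 𝓞 Z) ∈ v.asIdeal) :
    ∃ (K : Type) (_ : Field K) (_ : Algebra (v.adicCompletion Z) K),
      FiniteDimensional (v.adicCompletion Z) K ∧ IsSchurSplittingField p K ∧
      Module.finrank (v.adicCompletion Z) K ∣ (if p = 2 then 2 else p - 1) := by
  have : Fact p.Prime := ⟨hpp⟩
  set K₀ := v.adicCompletion Z
  have hch : CharZero K₀ := charZero_of_injective_algebraMap (algebraMap Z K₀).injective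
  set w := if p = 2 then 4 else p with hw
  have hw0 : w ≠ 0 := by rw [hw]; split_ifs; exacts [by norm_num, hpp.ne_zero]
  have : NeZero w := ⟨hw0⟩
  have hfin := IsCyclotomicExtension.finiteDimensional {w} K₀ (CyclotomicField w K₀)
  refine ⟨CyclotomicField w K₀, inferInstance, inferInstance, hfin, ?_, ?_⟩
  · obtain ⟨h1, h2⟩ := adicCompletion_aux v p hp
    obtain ⟨h1', h2'⟩ := isCyclic_and_dvd_of_finiteDimensional (K' := CyclotomicField w K₀) hpp h1 h2
    exact ⟨charZero_of_injective_algebraMap (algebraMap K₀ (CyclotomicField w K₀)).injective,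
      ⟨_, IsCyclotomicExtension.zeta_spec w K₀ (CyclotomicField w K₀)⟩, h1', h2'⟩
  · have hg := IsCyclotomicExtension.isGalois {w} K₀ (CyclotomicField w K₀)
    rw [← IsGalois.card_aut_eq_finrank]
    have hz := IsCyclotomicExtension.zeta_spec w K₀ (CyclotomicField w K₀)
    have h3 := Subgroup.card_dvd_of_injective _ (hz.autToPow_injective K₀)
    rw [Nat.card_eq_fintype_card (α := (ZMod w)ˣ), ZMod.card_units_eq_totient] at h3
    convert h3 using 1
    rw [hw]
    split_ifs
    · decide
    · exact (Nat.totient_prime hpp).symm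

end Inheritance

section CyclicNorm

theorem exists_eigenvector_of_orderOf {K M : Type*} [Field K] [Field M] [Algebra K M]
    (τ : M ≃ₐ[K] M) {a : K} (ha0 : a ≠ 0) (hc : 0 < orderOf τ) (ha : a ^ orderOf τ = 1) :
    ∃ x : M, x ≠ 0 ∧ τ x = algebraMap K M a * x := by
  set c := orderOf τ with hcdef
  let χ : Fin c → (M →* M) := fun i => ((τ ^ (i : ℕ) : M ≃ₐ[K] M) : M →* M)
  have hχ : Function.Injective χ := by
    intro i j hij
    have h1 : τ ^ (i : ℕ) = τ ^ (j : ℕ) := by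
      ext x; exact DFunLike.congr_fun hij x
    exact Fin.ext (pow_injOn_Iio_orderOf (x := τ) (by simp [← hcdef]) (by simp [← hcdef]) h1)
  have hli := (linearIndependent_monoidHom M M).comp χ hχ
  rw [Fintype.linearIndependent_iff] at hli
  have h2 : ∃ w : M, ∑ i : Fin c, algebraMap K M a⁻¹ ^ (i : ℕ) * (τ ^ (i : ℕ)) w ≠ 0 := by
    by_contra! hcon
    have := hli (fun i => algebraMap K M a⁻¹ ^ (i : ℕ)) (by
      ext w
      simpa [χ] using hcon w) ⟨0, hc⟩
    simp at this
  obtain ⟨w, hw⟩ := h2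
  rw [Fin.sum_univ_eq_sum_range (fun i => algebraMap K M a⁻¹ ^ i * (τ ^ i) w)] at hw
  refine ⟨_, hw, ?_⟩
  have h3 := Finset.sum_range_succ (fun i => algebraMap K M a⁻¹ ^ i * (τ ^ i) w) c
  rw [Finset.sum_range_succ', pow_orderOf_eq_one, ← map_pow _ _ c, inv_pow, ha] at h3
  simp only [pow_zero, inv_one, map_one, AlgEquiv.one_apply, add_left_inj] at h3
  conv_rhs => rw [← h3]
  rw [map_sum, Finset.mul_sum]
  refine Finset.sum_congr rfl fun i _ => ?_
  rw [map_mul, map_pow, AlgEquiv.commutes, pow_succ', pow_succ', AlgEquiv.mul_apply, ← mul_assoc,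
    ← mul_assoc, ← map_mul, mul_inv_cancel₀ ha0, map_one, one_mul]

theorem exists_prod_eq_of_cyclic {K L M : Type*} [Field K] [Field L] [Field M] [Algebra K L]
    [Algebra K M] [Algebra L M] [IsScalarTower K L M] [FiniteDimensional K L]
    [FiniteDimensional K M] [IsGalois K L] [IsGalois K M] (r : ℕ)
    (φ : M ≃ₐ[K] M) (hφ : ∀ τ, τ ∈ Subgroup.zpowers φ)
    (hdvd : Module.finrank K L * r ∣ Module.finrank K M) :
    (∀ τ, τ ∈ Subgroup.zpowers (φ.restrictNormal L)) ∧ ∀ a : K, a ^ r = 1 → ∃ y : L,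
      ∏ i ∈ Finset.range (Module.finrank K L), ((φ.restrictNormal L) ^ i) y = algebraMap K L a := by
  set n := Module.finrank K L with hn
  have hgen : ∀ τ, τ ∈ Subgroup.zpowers (φ.restrictNormal L) := by
    intro τ
    obtain ⟨τ', rfl⟩ := AlgEquiv.restrictNormalHom_surjective (F := K) (K₁ := L) M τ
    obtain ⟨k, rfl⟩ := hφ τ'
    refine ⟨k, ?_⟩
    simp only [map_zpow]
    rfl
  refine ⟨hgen, fun a ha => ?_⟩
  have hoσ : orderOf (φ.restrictNormal L) = n := by
    rw [orderOf_eq_card_of_forall_mem_zpowers hgen, IsGalois.card_aut_eq_finrank]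
  have hoφ : orderOf φ = Module.finrank K M := by
    rw [orderOf_eq_card_of_forall_mem_zpowers hφ, IsGalois.card_aut_eq_finrank]
  have hn0 : 0 < n := Module.finrank_pos
  have hM0 : 0 < Module.finrank K M := Module.finrank_pos
  have hcomm : ∀ (i : ℕ) (z : L), algebraMap L M (((φ.restrictNormal L) ^ i) z) =
      (φ ^ i) (algebraMap L M z) := by
    intro i
    induction i with
    | zero => intro z; simp
    | succ i ih =>
      intro z
      rw [pow_succ', pow_succ', AlgEquiv.mul_apply, AlgEquiv.mul_apply,
        AlgEquiv.restrictNormal_commutes, ih]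
  obtain ⟨k, hk⟩ := hdvd
  have hr : r ≠ 0 := by rintro rfl; simp at hk; omega
  have ha0 : a ≠ 0 := by rintro rfl; simp [hr] at ha
  have hord : orderOf (φ ^ n) = r * k := by
    rw [orderOf_pow_of_dvd hn0.ne' ⟨r * k, by rw [hoφ, hk, mul_assoc]⟩, hoφ, hk, mul_assoc,
      Nat.mul_div_cancel_left _ hn0]
  obtain ⟨x, hx0, hx⟩ := exists_eigenvector_of_orderOf (φ ^ n) ha0
    (by rw [hord]; apply Nat.pos_of_ne_zero; intro h; rw [mul_assoc, h] at hk; omega)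
    (by rw [hord, pow_mul, ha, one_pow])
  have haM : algebraMap K M a ≠ 0 := by simpa using ha0
  have hfix : (φ ^ n) (φ x / x) = φ x / x := by
    rw [map_div₀, ← AlgEquiv.mul_apply, (Commute.self_pow φ n).symm.eq, AlgEquiv.mul_apply, hx,
      map_mul, AlgEquiv.commutes, mul_div_mul_left _ _ haM]
  have hfix' : ∀ k : ℕ, ((φ ^ n) ^ k) (φ x / x) = φ x / x := by
    intro k
    induction k with
    | zero => simp
    | succ k ih => rw [pow_succ', AlgEquiv.mul_apply, ih, hfix]
  have hGalLM : IsGalois L M := IsGalois.tower_top_of_isGalois K L M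
  have : FiniteDimensional L M := Module.Finite.of_restrictScalars_finite K L M
  have hy : φ x / x ∈ Set.range (algebraMap L M) := by
    rw [IsGalois.mem_range_algebraMap_iff_fixed]
    intro τ
    have h1 : IsOfFinOrder φ := isOfFinOrder_of_finite φ
    obtain ⟨j, hj⟩ := h1.mem_powers_iff_mem_zpowers.2 (hφ (τ.restrictScalars K))
    have h2 : (φ.restrictNormal L) ^ j = 1 := by
      ext z
      apply (algebraMap L M).injective
      have hj' : φ ^ j = τ.restrictScalars K := hj
      rw [hcomm, hj']
      simp
    obtain ⟨k, rfl⟩ := hoσ ▸ orderOf_dvd_of_pow_eq_one h2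
    have h3 := hfix' k
    rw [← pow_mul] at h3
    have hj' : φ ^ (n * k) = τ.restrictScalars K := hj
    rw [hj'] at h3
    exact h3
  obtain ⟨y, hy⟩ := hy
  refine ⟨y, (algebraMap L M).injective ?_⟩
  rw [map_prod, ← IsScalarTower.algebraMap_apply]
  simp_rw [hcomm, hy, map_div₀, ← AlgEquiv.mul_apply, ← pow_succ]
  rw [Finset.prod_div_distrib, div_eq_iff
    (Finset.prod_ne_zero_iff.2 fun i _ => (map_ne_zero_iff _ (φ ^ i).injective).2 hx0)]
  have h4 := Finset.prod_range_succ (fun i => (φ ^ i) x) n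
  rw [Finset.prod_range_succ', hx, pow_zero, AlgEquiv.one_apply, mul_left_comm, mul_comm _ x,
    mul_comm _ x] at h4
  exact mul_left_cancel₀ hx0 (h4.trans (mul_left_comm _ _ _))

theorem IsSchurSplittingField.exists_prod_eq {p : ℕ} (hp : p.Prime) {K L : Type} [Field K] [Field L]
    [Algebra K L] (hK : IsSchurSplittingField p K) {N : ℕ} (hN : N.Coprime p)
    [IsCyclotomicExtension {N} K L] [FiniteDimensional K L] [IsGalois K L] {r : ℕ} (hr : 0 < r) :
    ∃ σ : L ≃ₐ[K] L, (∀ τ, τ ∈ Subgroup.zpowers σ) ∧ ∀ a : K, a ^ r = 1 → ∃ y : L,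
      ∏ i ∈ Finset.range (Module.finrank K L), (σ ^ i) y = algebraMap K L a := by
  obtain ⟨m, hm0, hmp, hm⟩ := hK.exists_dvd_finrank (Module.finrank K L * r)
    (Nat.mul_pos Module.finrank_pos hr)
  have hch := hK.charZero
  have hN0 : N ≠ 0 := by rintro rfl; simp at hN; exact hp.one_lt.ne' hN
  have : NeZero N := ⟨hN0⟩
  have : NeZero m := ⟨hm0.ne'⟩
  let M := CyclotomicField (m * N) K
  have := IsCyclotomicExtension.finiteDimensional {m * N} K M
  have := IsCyclotomicExtension.isGalois {m * N} K M
  have hzM := IsCyclotomicExtension.zeta_spec (m * N) K M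
  have hzm := hzM.pow (Nat.mul_pos hm0 (Nat.pos_of_ne_zero hN0)) (mul_comm m N)
  have hcyc := hK.isCyclic (m * N) (Nat.Coprime.mul_left hmp hN) M
  obtain ⟨φ, hφ⟩ := hcyc.exists_generator
  have h1 := isCyclotomicExtension_adjoin (K := K) hzm
  have h2 := (hm (IntermediateField.adjoin K {IsCyclotomicExtension.zeta (m * N) K M ^ N})).trans
    ⟨_, (Module.finrank_mul_finrank K
      (IntermediateField.adjoin K {IsCyclotomicExtension.zeta (m * N) K M ^ N}) M).symm⟩
  have hs := IsCyclotomicExtension.isSplittingField_X_pow_sub_one N K L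
  have hzN := hzM.pow (Nat.mul_pos hm0 (Nat.pos_of_ne_zero hN0)) rfl
  let ι : L →ₐ[K] M := Polynomial.IsSplittingField.lift L (Polynomial.X ^ N - 1) (by
    have := Polynomial.X_pow_sub_one_splits hzN
    simpa using this)
  let _ : Algebra L M := ι.toRingHom.toAlgebra
  have : IsScalarTower K L M := .of_algebraMap_eq fun x => (ι.commutes x).symm
  exact ⟨_, exists_prod_eq_of_cyclic r φ hφ h2⟩

end CyclicNorm

section CyclicIdempotent

theorem exists_ne_zero_forall_mul_mul_eq_smul {K L E : Type*} [Field K] [Field L] [Ring E]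
    [Nontrivial E] [Algebra K L] [Algebra K E] [FiniteDimensional K L] [IsGalois K L]
    (ι : L →ₐ[K] E) (σ : L ≃ₐ[K] L) (hσ : ∀ τ, τ ∈ Subgroup.zpowers σ) (u : E)
    (hu : u ^ Module.finrank K L = 1) (hcomm : ∀ z, u * ι z = ι (σ z) * u)
    (hspan : Submodule.span K {x : E | ∃ z i, x = ι z * u ^ i} = ⊤) :
    ∃ s : E, s ≠ 0 ∧ ∀ x : E, ∃ k : K, s * x * s = k • s := by
  set n := Module.finrank K L with hn
  have hoσ : orderOf σ = n := by
    rw [orderOf_eq_card_of_forall_mem_zpowers hσ, IsGalois.card_aut_eq_finrank]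
  have hn0 : 0 < n := Module.finrank_pos
  have hcomm' : ∀ (i : ℕ) z, u ^ i * ι z = ι ((σ ^ i) z) * u ^ i := by
    intro i
    induction i with
    | zero => intro z; simp
    | succ i ih =>
      intro z
      rw [pow_succ', mul_assoc, ih, ← mul_assoc, hcomm, mul_assoc, pow_succ' σ, AlgEquiv.mul_apply]
  have hsu : (∑ i ∈ Finset.range n, u ^ i) * u = ∑ i ∈ Finset.range n, u ^ i := by
    have h := Finset.sum_range_succ (fun i => u ^ i) n
    rw [Finset.sum_range_succ', hu, pow_zero, add_left_inj] at h
    rw [Finset.sum_mul]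
    simpa only [pow_succ] using h
  have hus : u * (∑ i ∈ Finset.range n, u ^ i) = ∑ i ∈ Finset.range n, u ^ i := by
    have h := Finset.sum_range_succ (fun i => u ^ i) n
    rw [Finset.sum_range_succ', hu, pow_zero, add_left_inj] at h
    rw [Finset.mul_sum]
    simpa only [pow_succ'] using h
  have hus' : ∀ j : ℕ, u ^ j * (∑ i ∈ Finset.range n, u ^ i) = ∑ i ∈ Finset.range n, u ^ i := by
    intro j
    induction j with
    | zero => simp
    | succ j ih => rw [pow_succ, mul_assoc, hus, ih]
  refine ⟨∑ i ∈ Finset.range n, u ^ i, fun h0 => ?_, fun x => ?_⟩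
  · let _ : Module L E := Module.compHom E ι.toRingHom
    have hsm : ∀ (z : L) (x : E), z • x = ι z * x := fun _ _ => rfl
    obtain ⟨φ, hφ⟩ : ∃ φ : Module.Dual L E, φ 1 ≠ 0 := by
      by_contra! h
      exact one_ne_zero ((Module.forall_dual_apply_eq_zero_iff L (1 : E)).1 h)
    let χ : Fin n → (L →* L) := fun i => ((σ ^ (i : ℕ) : L ≃ₐ[K] L) : L →* L)
    have hχ : Function.Injective χ := by
      intro i j hij
      have h1 : σ ^ (i : ℕ) = σ ^ (j : ℕ) := by
        ext x; exact DFunLike.congr_fun hij x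
      exact Fin.ext (pow_injOn_Iio_orderOf (x := σ) (by simp [hoσ]) (by simp [hoσ]) h1)
    have hli := (linearIndependent_monoidHom L L).comp χ hχ
    rw [Fintype.linearIndependent_iff] at hli
    have := hli (fun i => φ (u ^ (i : ℕ))) (by
      ext z
      have h1 : (∑ i ∈ Finset.range n, u ^ i) * ι z = 0 := by rw [h0, zero_mul]
      rw [Finset.sum_mul] at h1
      simp_rw [hcomm', ← hsm] at h1
      have h2 := congrArg φ h1
      simp_rw [map_sum, map_smul, map_zero] at h2
      rw [← Fin.sum_univ_eq_sum_range (fun i => (σ ^ i) z • φ (u ^ i))] at h2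
      simpa [χ, mul_comm] using h2) ⟨0, hn0⟩
    exact hφ (by simpa using this)
  · have hx : x ∈ Submodule.span K {x : E | ∃ z i, x = ι z * u ^ i} := hspan ▸ Submodule.mem_top
    induction hx using Submodule.span_induction with
    | mem x hx =>
      obtain ⟨z, j, rfl⟩ := hx
      refine ⟨Algebra.trace K L z, ?_⟩
      rw [mul_assoc, mul_assoc, hus', ← mul_assoc, Finset.sum_mul]
      simp_rw [hcomm']
      rw [Finset.sum_mul]
      simp_rw [mul_assoc, hus']
      rw [← Finset.sum_mul, ← map_sum, Algebra.smul_def]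
      congr 1
      rw [← ι.commutes, trace_eq_sum_automorphisms]
      congr 1
      have hbij : Function.Bijective (fun i : Fin n => σ ^ (i : ℕ)) := by
        rw [Fintype.bijective_iff_injective_and_card]
        refine ⟨fun i j hij => Fin.ext (pow_injOn_Iio_orderOf (x := σ) (by simp [hoσ])
          (by simp [hoσ]) hij), ?_⟩
        rw [Fintype.card_fin, ← Nat.card_eq_fintype_card, IsGalois.card_aut_eq_finrank]
      rw [← Fin.sum_univ_eq_sum_range (fun i => (σ ^ i) z)]
      exact hbij.sum_comp (fun τ => τ z)
    | zero => exact ⟨0, by simp⟩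
    | add x y _ _ hx hy =>
      obtain ⟨a, ha⟩ := hx
      obtain ⟨b, hb⟩ := hy
      exact ⟨a + b, by rw [mul_add, add_mul, ha, hb, add_smul]⟩
    | smul c x _ hx =>
      obtain ⟨a, ha⟩ := hx
      exact ⟨c * a, by rw [mul_smul_comm, smul_mul_assoc, ha, mul_smul]⟩

theorem mem_range_algebraMap_of_forall_mul_mul_eq_smul {K Δ V : Type*} [Field K] [DivisionRing Δ]
    [Algebra K Δ] [AddCommGroup V] [Module K V] [Module Δ V] [IsScalarTower K Δ V]
    {s : Module.End Δ V} (hs : s ≠ 0) (h : ∀ x : Module.End Δ V, ∃ k : K, s * x * s = k • s)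
    (d : Δ) : d ∈ Set.range (algebraMap K Δ) := by
  obtain ⟨v, hv⟩ : ∃ v, s v ≠ 0 := by
    by_contra! h0
    exact hs (LinearMap.ext h0)
  obtain ⟨φ, hφ⟩ := LinearMap.exists_leftInverse_of_injective (LinearMap.toSpanSingleton Δ V (s v))
    (LinearMap.ker_toSpanSingleton Δ hv)
  have hφ1 : φ (s v) = 1 := by simpa using LinearMap.congr_fun hφ 1
  obtain ⟨k, hk⟩ := h ((LinearMap.toSpanSingleton Δ V (d • v)).comp φ)
  refine ⟨k, ?_⟩
  have h1 := LinearMap.congr_fun hk v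
  simp only [Module.End.mul_apply, LinearMap.comp_apply, hφ1, LinearMap.toSpanSingleton_apply,
    one_smul, map_smul, LinearMap.smul_apply] at h1
  rw [← algebraMap_smul Δ k (s v)] at h1
  exact (smul_left_injective Δ hv h1).symm

end CyclicIdempotent

section CyclicNormal

theorem Int.exists_geom_sum_eq_prime_mul {p : ℕ} (hp : p.Prime) {a N : ℕ} {s : ℤ}
    (hN : N.Coprime p) (hNs : (N : ℤ) ∣ s - 1)
    (hw : ((Nat.gcd (p ^ a * N) (if p = 2 then 4 else p) : ℕ) : ℤ) ∣ s - 1)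
    (hs : ¬ ((p ^ a * N : ℕ) : ℤ) ∣ s - 1) :
    ∃ b : ℤ, ∑ i ∈ Finset.range p, s ^ i = p * b ∧ IsCoprime b ((p ^ a * N : ℕ) : ℤ) := by
  have hcop : IsCoprime ((p ^ a : ℕ) : ℤ) (N : ℤ) :=
    Nat.isCoprime_iff_coprime.2 (hN.symm.pow_left a)
  have ha : ¬ ((p ^ a : ℕ) : ℤ) ∣ s - 1 := fun h => hs (by
    rw [Nat.cast_mul]; exact hcop.mul_dvd h hNs)
  have hws : (((if p = 2 then 4 else p) : ℕ) : ℤ) ∣ s - 1 := by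
    obtain ⟨l, hl⟩ : ∃ l : ℕ, (if p = 2 then 4 else p) = p ^ l := by
      split_ifs with h
      · exact ⟨2, by rw [h]; norm_num⟩
      · exact ⟨1, by simp⟩
    rw [hl] at hw ⊢
    rcases le_total l a with h | h
    · rwa [Nat.gcd_eq_right (Dvd.dvd.mul_right (pow_dvd_pow p h) N)] at hw
    · refine absurd (dvd_trans ?_ hw) ha
      exact_mod_cast Nat.dvd_gcd (dvd_mul_right _ _) (pow_dvd_pow p h)
  have hsq : (p : ℤ) ^ 2 ∣ ∑ i ∈ Finset.range p, s ^ i - p := by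
    split_ifs at hws with h
    · subst h
      simp only [Finset.sum_range_succ, Finset.sum_range_zero, pow_zero, pow_one]
      push_cast at hws ⊢
      omega
    · obtain ⟨m, hm⟩ := hws
      have h1 := odd_sq_dvd_geom_sum₂_sub (R := ℤ) (a := 1) (b := m) (p := p) (hp.odd_of_ne_two h)
      obtain rfl : s = 1 + p * m := by linarith
      simpa using h1
  obtain ⟨c, hc⟩ := hsq
  refine ⟨1 + p * c, by linarith, ?_⟩
  rw [Nat.cast_mul]
  refine IsCoprime.mul_right ?_ ?_
  · rw [Nat.cast_pow]
    exact IsCoprime.pow_right ⟨1, -c, by ring⟩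
  · obtain ⟨k, hk⟩ := hNs
    have h1 : (N : ℤ) ∣ ∑ i ∈ Finset.range p, s ^ i - p := by
      have : ∑ i ∈ Finset.range p, s ^ i - p = ∑ i ∈ Finset.range p, (s ^ i - 1) := by simp
      rw [this]
      refine Finset.dvd_sum fun i _ => dvd_trans ⟨k, hk⟩ ?_
      simpa using sub_dvd_pow_sub_pow s 1 i
    rw [hc] at h1
    have h2 : IsCoprime (N : ℤ) ((p : ℤ) ^ 2) :=
      IsCoprime.pow_right (Nat.isCoprime_iff_coprime.2 hN)
    obtain ⟨e, he⟩ := h2.dvd_of_dvd_mul_left h1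
    exact ⟨1, -(p * e), by rw [he]; ring⟩

theorem mul_pow_eq_zpow_geom_sum_mul {H : Type*} [Group H] {x t : H} {s : ℤ}
    (h : t * x * t⁻¹ = x ^ s) (n : ℕ) :
    (x * t) ^ n = x ^ (∑ i ∈ Finset.range n, s ^ i) * t ^ n := by
  induction n with
  | zero => simp
  | succ n ih =>
    have h1 : ∀ k : ℤ, t * x ^ k = x ^ (s * k) * t := by
      intro k
      rw [zpow_mul, ← h, conj_zpow]
      group
    rw [pow_succ', ih, geom_sum_succ, zpow_add_one, mul_assoc, ← mul_assoc t, h1, pow_succ',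
      ← (Commute.self_zpow x _).eq]
    group

theorem orderOf_div_dvd_of_commute_pow {H : Type*} [Group H] {ζ t : H} {s : ℤ}
    (hζ0 : 0 < orderOf ζ) (hs : t * ζ * t⁻¹ = ζ ^ s) {k : ℕ} (hk : t * ζ ^ k = ζ ^ k * t)
    (hkd : k ∣ orderOf ζ) : ((orderOf ζ / k : ℕ) : ℤ) ∣ s - 1 := by
  obtain ⟨m, hm⟩ := hkd
  have hk0 : 0 < k := Nat.pos_of_ne_zero (by rintro rfl; omega)
  have h1 : t * ζ ^ k * t⁻¹ = ζ ^ (k * s) := by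
    rw [← conj_pow, hs, ← zpow_natCast, ← zpow_mul, mul_comm]
  rw [hk, mul_inv_cancel_right, ← zpow_natCast, zpow_eq_zpow_iff_modEq] at h1
  have h2 := h1.dvd
  rw [hm, Nat.mul_div_cancel_left _ hk0]
  rw [hm, show (k : ℤ) * s - k = k * (s - 1) by ring, Nat.cast_mul] at h2
  exact Int.dvd_of_mul_dvd_mul_left (by exact_mod_cast hk0.ne') h2

variable {H : Type*} [Group H] [Finite H] {p : ℕ}

theorem mem_zpowers_of_pow_prime_mem (hp : p.Prime)
    (hF : ∀ B : Subgroup H, B.Normal → (∀ x ∈ B, ∀ y ∈ B, x * y = y * x) →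
      ∀ x ∈ B, x ^ (if p = 2 then 4 else p) = 1 → x ∈ Subgroup.center H)
    (ζ : H) [hA : (Subgroup.zpowers ζ).Normal]
    (hcent : ∀ t, t * ζ = ζ * t → t ∈ Subgroup.zpowers ζ) {t : H}
    (ht : ∀ x ∈ Subgroup.zpowers ζ, (orderOf x).Coprime p → t * x = x * t)
    (htp : t ^ p ∈ Subgroup.zpowers ζ) : t ∈ Subgroup.zpowers ζ := by
  by_contra htA
  have hcomm : ∀ x ∈ Subgroup.zpowers ζ, ∀ y ∈ Subgroup.zpowers ζ, x * y = y * x := by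
    rintro _ ⟨i, rfl⟩ _ ⟨j, rfl⟩
    exact (Commute.refl ζ).zpow_zpow i j
  have hF1 : ∀ B : Subgroup H, B.Normal → (∀ x ∈ B, ∀ y ∈ B, x * y = y * x) →
      ∀ x ∈ B, x ^ p = 1 → x ∈ Subgroup.center H := by
    intro B hB hB' x hx hxp
    refine hF B hB hB' x hx ?_
    split_ifs with h
    · subst h
      rw [show 4 = 2 * 2 from rfl, pow_mul, hxp, one_pow]
    · exact hxp
  have hζ0 : 0 < orderOf ζ := orderOf_pos ζ
  have hconj : ∀ h : H, ∃ s : ℤ, h * ζ * h⁻¹ = ζ ^ s := fun h => by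
    obtain ⟨s, hs⟩ := hA.conj_mem ζ (Subgroup.mem_zpowers ζ) h
    exact ⟨s, hs.symm⟩
  obtain ⟨s, hs⟩ := hconj t
  have hsx : ∀ x ∈ Subgroup.zpowers ζ, t * x * t⁻¹ = x ^ s := by
    rintro _ ⟨i, rfl⟩
    simp only
    rw [← conj_zpow, hs, ← zpow_mul, ← zpow_mul, mul_comm]
  obtain ⟨a, N, hNp, hN⟩ := Nat.exists_eq_pow_mul_and_not_dvd hζ0.ne' p hp.ne_one
  have hNcop : N.Coprime p := ((Nat.Prime.coprime_iff_not_dvd hp).2 hNp).symm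
  have hfix : ∀ k : ℕ, t * ζ ^ k = ζ ^ k * t → k ∣ orderOf ζ →
      ((orderOf ζ / k : ℕ) : ℤ) ∣ s - 1 := fun k hk hkd =>
    orderOf_div_dvd_of_commute_pow hζ0 hs hk hkd
  have hNs : (N : ℤ) ∣ s - 1 := by
    have h1 := hfix (p ^ a) (ht _ (Subgroup.npow_mem_zpowers ζ _) (by
      rw [orderOf_pow_of_dvd (pow_pos hp.pos a).ne' ⟨N, hN⟩, hN,
        Nat.mul_div_cancel_left _ (pow_pos hp.pos a)]
      exact hNcop)) ⟨N, hN⟩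
    rwa [hN, Nat.mul_div_cancel_left _ (pow_pos hp.pos a)] at h1
  have hw : ((Nat.gcd (p ^ a * N) (if p = 2 then 4 else p) : ℕ) : ℤ) ∣ s - 1 := by
    rw [← hN]
    set g := Nat.gcd (orderOf ζ) (if p = 2 then 4 else p) with hg
    have hgd : g ∣ orderOf ζ := Nat.gcd_dvd_left _ _
    have h1 := hfix (orderOf ζ / g) (by
      refine (Subgroup.mem_center_iff.1 (hF _ hA hcomm _ (Subgroup.npow_mem_zpowers ζ _) ?_) t)
      obtain ⟨m, hm⟩ : g ∣ (if p = 2 then 4 else p) := Nat.gcd_dvd_right _ _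
      rw [hm, ← pow_mul, ← mul_assoc, Nat.div_mul_cancel hgd, pow_mul, pow_orderOf_eq_one,
        one_pow]) (Nat.div_dvd_of_dvd hgd)
    rwa [Nat.div_div_self hgd hζ0.ne'] at h1
  have hnot : ¬ ((p ^ a * N : ℕ) : ℤ) ∣ s - 1 := by
    intro h
    apply htA
    apply hcent
    have : ζ ^ s = ζ ^ (1 : ℤ) := by
      rw [zpow_eq_zpow_iff_modEq, hN]
      exact (Int.modEq_iff_dvd.2 h).symm
    rw [this, zpow_one, mul_inv_eq_iff_eq_mul] at hs
    exact hs
  obtain ⟨b, hb, hbcop⟩ := Int.exists_geom_sum_eq_prime_mul hp hNcop hNs hw hnot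
  obtain ⟨j, hj⟩ := htp
  simp only at hj
  have hjp : (p : ℤ) ∣ j := by
    by_contra hpj
    have h1 := hsx (ζ ^ j) ⟨j, rfl⟩
    rw [hj, (Commute.self_pow t p).eq, mul_inv_cancel_right, ← hj, ← zpow_mul,
      zpow_eq_zpow_iff_modEq, hN] at h1
    have h2 := h1.dvd
    rw [show j * s - j = j * (s - 1) by ring] at h2
    apply hnot
    rw [Nat.cast_mul]
    refine IsCoprime.mul_dvd (Nat.isCoprime_iff_coprime.2 (hNcop.symm.pow_left a)) ?_ hNs
    have h3 : IsCoprime ((p ^ a : ℕ) : ℤ) j := by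
      rw [Nat.cast_pow]
      exact IsCoprime.pow_left
        ((Prime.coprime_iff_not_dvd (Nat.prime_iff_prime_int.1 hp)).2 hpj)
    refine h3.dvd_of_dvd_mul_left (dvd_trans ?_ h2)
    rw [Nat.cast_mul]
    exact dvd_mul_right _ _
  obtain ⟨i, rfl⟩ := hjp
  obtain ⟨x, y, hxy⟩ := hbcop
  set s0 := ζ ^ (-(i * x)) * t with hs0
  have hs0p : s0 ^ p = 1 := by
    rw [hs0, mul_pow_eq_zpow_geom_sum_mul (hsx _ ⟨_, rfl⟩), hb, ← hj, ← zpow_mul, ← zpow_add]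
    have : -(i * x) * (p * b) + p * i = orderOf ζ * (p * i * y) := by
      rw [hN]
      linear_combination (p * i : ℤ) * (-hxy)
    rw [this, zpow_mul, zpow_natCast, pow_orderOf_eq_one, one_zpow]
  have hs0A : s0 ∉ Subgroup.zpowers ζ := fun h =>
    htA ((Subgroup.mul_mem_cancel_left _
      (Subgroup.zpow_mem _ (Subgroup.mem_zpowers ζ) _)).1 h)
  have hs0x : ∀ x ∈ Subgroup.zpowers ζ, s0 * x * s0⁻¹ = x ^ s := by
    intro w hw
    rw [← hsx w hw, hs0, mul_inv_rev]
    calc ζ ^ (-(i * x)) * t * w * (t⁻¹ * (ζ ^ (-(i * x)))⁻¹)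
        = ζ ^ (-(i * x)) * (t * w * t⁻¹) * (ζ ^ (-(i * x)))⁻¹ := by group
      _ = _ := by
        rw [hcomm _ ⟨-(i * x), rfl⟩ _ (hA.conj_mem w hw t), mul_inv_cancel_right]
  have hδ : ∀ h : H, h * s0 * h⁻¹ * s0⁻¹ ∈ Subgroup.center H := by
    intro h
    obtain ⟨k, hk⟩ := hconj h
    have hkx : ∀ x ∈ Subgroup.zpowers ζ, h * x * h⁻¹ = x ^ k := by
      rintro _ ⟨i, rfl⟩
      simp only
      rw [← conj_zpow, hk, ← zpow_mul, ← zpow_mul, mul_comm]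
    have hδA : h * s0 * h⁻¹ * s0⁻¹ ∈ Subgroup.zpowers ζ := by
      apply hcent
      have h1 : h * s0 * ζ * (h * s0)⁻¹ = s0 * h * ζ * (s0 * h)⁻¹ := by
        calc h * s0 * ζ * (h * s0)⁻¹ = h * (s0 * ζ * s0⁻¹) * h⁻¹ := by group
          _ = s0 * (h * ζ * h⁻¹) * s0⁻¹ := by
            rw [hs0x ζ (Subgroup.mem_zpowers ζ), hk, hs0x _ ⟨k, rfl⟩, hkx _ ⟨s, rfl⟩,
              ← zpow_mul, ← zpow_mul, mul_comm]
          _ = _ := by group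
      have h2 : (s0 * h)⁻¹ * (h * s0) * ζ = ζ * ((s0 * h)⁻¹ * (h * s0)) := by
        calc (s0 * h)⁻¹ * (h * s0) * ζ
            = (s0 * h)⁻¹ * (h * s0 * ζ * (h * s0)⁻¹) * (h * s0) := by group
          _ = _ := by rw [h1]; group
      obtain ⟨m, hm⟩ := hcent _ h2
      simp only at hm
      have h3 : h * s0 * h⁻¹ * s0⁻¹ = s0 * h * ζ ^ m * (s0 * h)⁻¹ := by
        rw [hm]; group
      rw [h3, ← conj_zpow]
      obtain ⟨q, hq⟩ := hconj (s0 * h)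
      rw [hq, ← zpow_mul]
      exact (((Commute.refl ζ).zpow_left (q * m))).eq
    refine hF1 _ hA hcomm _ hδA ?_
    have h4 := mul_pow_eq_zpow_geom_sum_mul (hs0x _ hδA) p
    rw [inv_mul_cancel_right, conj_pow, hs0p, mul_one, mul_inv_cancel, mul_one, hb, zpow_mul,
      zpow_natCast] at h4
    obtain ⟨m, hm⟩ := hδA
    simp only at hm
    have h5 : (h * s0 * h⁻¹ * s0⁻¹) ^ (orderOf ζ : ℤ) = 1 := by
      rw [← hm, zpow_natCast, ← zpow_natCast, ← zpow_mul, mul_comm, zpow_mul, zpow_natCast,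
        pow_orderOf_eq_one, one_zpow]
    rw [hN] at h5
    generalize h * s0 * h⁻¹ * s0⁻¹ = δ at *
    calc δ ^ p = (δ ^ p) ^ (x * b + y * ((p ^ a * N : ℕ) : ℤ)) := by rw [hxy, zpow_one]
      _ = ((δ ^ p) ^ b) ^ x * ((δ ^ ((p ^ a * N : ℕ) : ℤ)) ^ (p : ℤ)) ^ y := by
        rw [zpow_add, ← zpow_natCast δ p]
        simp only [← zpow_mul]
        congr 2 <;> ring
      _ = 1 := by rw [← h4, h5]; simp
  have hs0c : s0 ∈ Subgroup.center H := by
    refine hF1 (Subgroup.normalClosure {s0}) inferInstance ?_ s0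
      (Subgroup.subset_normalClosure rfl) hs0p
    have h1 : ∀ x ∈ Group.conjugatesOfSet {s0}, ∀ y ∈ Group.conjugatesOfSet {s0},
        x * y = y * x := by
      have h2 : ∀ x ∈ Group.conjugatesOfSet {s0}, ∃ z ∈ Subgroup.center H, x = z * s0 := by
        intro x hx
        rw [Group.mem_conjugatesOfSet_iff] at hx
        obtain ⟨_, rfl, hc⟩ := hx
        obtain ⟨c, rfl⟩ := isConj_iff.1 hc
        exact ⟨_, hδ c, by group⟩
      intro x hx y hy
      obtain ⟨z, hz, rfl⟩ := h2 x hx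
      obtain ⟨z', hz', rfl⟩ := h2 y hy
      rw [Subgroup.mem_center_iff] at hz hz'
      calc z * s0 * (z' * s0) = z * (s0 * z') * s0 := by group
        _ = z * z' * (s0 * s0) := by rw [hz']; group
        _ = z' * s0 * z * s0 := by rw [hz (z' * s0)]; group
        _ = z' * s0 * (z * s0) := by group
    intro x hx y hy
    have h3 : IsMulCommutative (Subgroup.closure (Group.conjugatesOfSet {s0})) :=
      Subgroup.isMulCommutative_closure h1
    exact congrArg Subtype.val (h3.is_comm.comm ⟨x, hx⟩ ⟨y, hy⟩)
  exact hs0A (hcent s0 ((Subgroup.mem_center_iff.1 hs0c ζ).symm))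

theorem mem_zpowers_of_commute_primeCompl (hp : p.Prime)
    (hF : ∀ B : Subgroup H, B.Normal → (∀ x ∈ B, ∀ y ∈ B, x * y = y * x) →
      ∀ x ∈ B, x ^ (if p = 2 then 4 else p) = 1 → x ∈ Subgroup.center H)
    (ζ : H) [hA : (Subgroup.zpowers ζ).Normal]
    (hcent : ∀ t, t * ζ = ζ * t → t ∈ Subgroup.zpowers ζ) {t : H}
    (ht : ∀ x ∈ Subgroup.zpowers ζ, (orderOf x).Coprime p → t * x = x * t) :
    t ∈ Subgroup.zpowers ζ := by
  have hζ0 : 0 < orderOf ζ := orderOf_pos ζ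
  obtain ⟨s, hs⟩ : ∃ s : ℤ, t * ζ * t⁻¹ = ζ ^ s := by
    obtain ⟨s, hs⟩ := hA.conj_mem ζ (Subgroup.mem_zpowers ζ) t
    exact ⟨s, hs.symm⟩
  have hspow : ∀ n : ℕ, t ^ n * ζ * (t ^ n)⁻¹ = ζ ^ (s ^ n) := by
    intro n
    induction n with
    | zero => simp
    | succ n ih =>
      calc t ^ (n + 1) * ζ * (t ^ (n + 1))⁻¹ = t * (t ^ n * ζ * (t ^ n)⁻¹) * t⁻¹ := by
            rw [pow_succ']; group
        _ = ζ ^ (s ^ (n + 1)) := by rw [ih, ← conj_zpow, hs, ← zpow_mul, pow_succ']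
  obtain ⟨a, N, hNp, hN⟩ := Nat.exists_eq_pow_mul_and_not_dvd hζ0.ne' p hp.ne_one
  have hNcop : N.Coprime p := ((Nat.Prime.coprime_iff_not_dvd hp).2 hNp).symm
  have hNs : (N : ℤ) ∣ s - 1 := by
    have h1 := orderOf_div_dvd_of_commute_pow hζ0 hs (k := p ^ a)
      (ht _ (Subgroup.npow_mem_zpowers ζ _) (by
      rw [orderOf_pow_of_dvd (pow_pos hp.pos a).ne' ⟨N, hN⟩, hN,
        Nat.mul_div_cancel_left _ (pow_pos hp.pos a)]
      exact hNcop)) ⟨N, hN⟩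
    rwa [hN, Nat.mul_div_cancel_left _ (pow_pos hp.pos a)] at h1
  have hpa : ((p ^ a : ℕ) : ℤ) ∣ s ^ p ^ a - 1 := by
    rcases Nat.eq_zero_or_pos a with rfl | ha
    · simp
    have hpd : p ∣ orderOf ζ := hN ▸ Dvd.dvd.mul_right (dvd_pow_self p ha.ne') N
    have h1 := orderOf_div_dvd_of_commute_pow hζ0 hs (k := orderOf ζ / p) (by
      refine Subgroup.mem_center_iff.1 (hF _ hA ?_ _ (Subgroup.npow_mem_zpowers ζ _) ?_) t
      · rintro _ ⟨i, rfl⟩ _ ⟨j, rfl⟩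
        exact (Commute.refl ζ).zpow_zpow i j
      · obtain ⟨m, hm⟩ : p ∣ (if p = 2 then 4 else p) := by
          split_ifs with h
          · exact ⟨2, by rw [h]⟩
          · rfl
        rw [hm, ← pow_mul, ← mul_assoc, Nat.div_mul_cancel hpd, pow_mul, pow_orderOf_eq_one,
          one_pow]) (Nat.div_dvd_of_dvd hpd)
    rw [Nat.div_div_self hpd hζ0.ne'] at h1
    have h2 := dvd_sub_pow_of_dvd_sub h1 a
    rw [one_pow] at h2
    refine dvd_trans ?_ h2
    rw [Nat.cast_pow]
    exact pow_dvd_pow _ (Nat.le_succ a)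
  have hmem : t ^ p ^ a ∈ Subgroup.zpowers ζ := by
    apply hcent
    have h1 := hspow (p ^ a)
    have h2 : ζ ^ (s ^ p ^ a) = ζ ^ (1 : ℤ) := by
      rw [zpow_eq_zpow_iff_modEq, hN]
      refine (Int.modEq_iff_dvd.2 ?_).symm
      rw [Nat.cast_mul]
      refine IsCoprime.mul_dvd (Nat.isCoprime_iff_coprime.2 (hNcop.symm.pow_left a)) hpa ?_
      exact hNs.trans (by simpa using sub_dvd_pow_sub_pow s 1 (p ^ a))
    rw [h2, zpow_one, mul_inv_eq_iff_eq_mul] at h1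
    exact h1
  have hdown : ∀ k : ℕ, t ^ p ^ k ∈ Subgroup.zpowers ζ → t ∈ Subgroup.zpowers ζ := by
    intro k
    induction k with
    | zero => intro h; simpa using h
    | succ k ih =>
      intro h
      refine ih (mem_zpowers_of_pow_prime_mem hp hF ζ hcent (fun x hx hxp => ?_) ?_)
      · exact ((show Commute t x from ht x hx hxp).pow_left _).eq
      · rwa [← pow_mul, ← pow_succ]
  exact hdown a hmem

end CyclicNormal

section HyperGroup

/-- A group with a commutative normal subgroup whose quotient is an `ℓ`-group. -/
def IsAbelianByPGroup (ℓ : ℕ) (H : Type*) [Group H] : Prop :=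
  ∃ C : Subgroup H, C.Normal ∧ (∀ x ∈ C, ∀ y ∈ C, x * y = y * x) ∧ ∀ h, ∃ k, h ^ ℓ ^ k ∈ C

theorem IsAbelianByPGroup.subgroup {ℓ : ℕ} {H : Type*} [Group H] (h : IsAbelianByPGroup ℓ H)
    (S : Subgroup H) : IsAbelianByPGroup ℓ S := by
  obtain ⟨C, hC, hab, hpow⟩ := h
  exact ⟨C.subgroupOf S, inferInstance, fun x hx y hy => Subtype.ext (hab _ hx _ hy),
    fun x => hpow x⟩

theorem IsAbelianByPGroup.of_surjective {ℓ : ℕ} {H H' : Type*} [Group H] [Group H']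
    (h : IsAbelianByPGroup ℓ H) (f : H →* H') (hf : Function.Surjective f) :
    IsAbelianByPGroup ℓ H' := by
  obtain ⟨C, hC, hab, hpow⟩ := h
  refine ⟨C.map f, hC.map f hf, ?_, fun y => ?_⟩
  · rintro _ ⟨x, hx, rfl⟩ _ ⟨y, hy, rfl⟩
    rw [← map_mul, ← map_mul, hab x hx y hy]
  · obtain ⟨x, rfl⟩ := hf y
    obtain ⟨k, hk⟩ := hpow x
    exact ⟨k, _, hk, map_pow _ _ _⟩

theorem IsPGroup.exists_mem_center_of_normal {ℓ : ℕ} [Fact ℓ.Prime] {Q : Type*} [Group Q] [Finite Q]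
    (hQ : IsPGroup ℓ Q) (N : Subgroup Q) [N.Normal] (hN : N ≠ ⊥) :
    ∃ x ∈ N, x ≠ 1 ∧ ∀ g, g * x = x * g := by
  have hQ' : IsPGroup ℓ (ConjAct Q) := hQ
  have h1 : ℓ ∣ Nat.card N := by
    rcases (hQ.to_subgroup N).card_eq_or_dvd with h | h
    · exact absurd (Subgroup.card_eq_one.1 h) hN
    · exact h
  obtain ⟨b, hb, hb1⟩ := hQ'.exists_fixed_point_of_prime_dvd_card_of_fixed_point N h1
    (a := (1 : N)) (fun g => smul_one g)
  refine ⟨b, b.2, fun h => hb1 (Subtype.ext h.symm), fun g => ?_⟩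
  have h2 := congrArg Subtype.val (hb (ConjAct.toConjAct g))
  rw [ConjAct.Subgroup.val_conj_smul, ConjAct.toConjAct_smul, mul_inv_eq_iff_eq_mul] at h2
  exact h2

theorem IsAbelianByPGroup.exists_centralizer_le {ℓ : ℕ} (hℓ : ℓ.Prime) {H : Type*} [Group H]
    [Finite H] (h : IsAbelianByPGroup ℓ H) :
    ∃ A : Subgroup H, A.Normal ∧ (∀ x ∈ A, ∀ y ∈ A, x * y = y * x) ∧
      ∀ t, (∀ x ∈ A, t * x = x * t) → t ∈ A := by
  have : Fact ℓ.Prime := ⟨hℓ⟩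
  obtain ⟨C, hC, hab, hpow⟩ := h
  obtain ⟨A, hCA, hA⟩ := Set.Finite.exists_le_maximal
    (Set.toFinite {A : Subgroup H | A.Normal ∧ ∀ x ∈ A, ∀ y ∈ A, x * y = y * x}) (a := C)
    (show C.Normal ∧ _ from ⟨hC, hab⟩)
  obtain ⟨⟨hAn, hAc⟩, hmax⟩ := hA
  refine ⟨A, hAn, hAc, ?_⟩
  by_contra! hcon
  obtain ⟨t, ht, htA⟩ := hcon
  have hQ : IsPGroup ℓ (H ⧸ A) := by
    intro q
    obtain ⟨x, rfl⟩ := QuotientGroup.mk_surjective q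
    obtain ⟨k, hk⟩ := hpow x
    exact ⟨k, by rw [← QuotientGroup.mk_pow, QuotientGroup.eq_one_iff]; exact hCA hk⟩
  let Z := Subgroup.centralizer (A : Set H)
  have hZ : Z.Normal := inferInstance
  have hN : (Z.map (QuotientGroup.mk' A)).Normal := hZ.map _ (QuotientGroup.mk'_surjective A)
  obtain ⟨_, ⟨x, hx, rfl⟩, hx1, hxc⟩ := hQ.exists_mem_center_of_normal (Z.map (QuotientGroup.mk' A))
    (fun hbot => htA (by
      have h1 : QuotientGroup.mk' A t ∈ Z.map (QuotientGroup.mk' A) :=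
        ⟨t, fun y hy => (ht y hy).symm, rfl⟩
      rw [hbot, Subgroup.mem_bot] at h1
      exact (QuotientGroup.eq_one_iff t).1 h1))
  have hxA : x ∉ A := fun h1 => hx1 ((QuotientGroup.eq_one_iff x).2 h1)
  have hx : ∀ y ∈ A, y * x = x * y := hx
  have hconj : ∀ g, ∃ a ∈ A, g * x * g⁻¹ = x * a := by
    intro g
    refine ⟨x⁻¹ * (g * x * g⁻¹), ?_, by group⟩
    rw [← QuotientGroup.eq]
    have h2 := hxc (g : H ⧸ A)
    simp only [QuotientGroup.mk'_apply] at h2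
    rw [QuotientGroup.mk_mul, QuotientGroup.mk_mul, h2]
    simp
  refine hxA (hmax (y := A ⊔ Subgroup.zpowers x) ⟨⟨?_⟩, ?_⟩ le_sup_left
    (Subgroup.mem_sup_right (Subgroup.mem_zpowers x)))
  · have h3 : A ⊔ Subgroup.zpowers x = Subgroup.closure (A ∪ {x}) := by
      rw [Subgroup.closure_union, Subgroup.closure_eq, Subgroup.zpowers_eq_closure]
    intro n hn g
    have h4 : A ⊔ Subgroup.zpowers x ≤
        (A ⊔ Subgroup.zpowers x).comap (MulAut.conj g).toMonoidHom := by
      rw [sup_le_iff]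
      refine ⟨fun y hy => Subgroup.mem_sup_left (hAn.conj_mem y hy g), ?_⟩
      rw [Subgroup.zpowers_le]
      obtain ⟨a, ha, hga⟩ := hconj g
      change g * x * g⁻¹ ∈ A ⊔ Subgroup.zpowers x
      rw [hga]
      exact mul_mem (Subgroup.mem_sup_right (Subgroup.mem_zpowers x)) (Subgroup.mem_sup_left ha)
    exact h4 hn
  · have h3 : IsMulCommutative (Subgroup.closure ((A : Set H) ∪ {x})) := by
      apply Subgroup.isMulCommutative_closure
      rintro y (hy | rfl) z (hz | rfl)
      · exact hAc y hy z hz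
      · exact hx y hy
      · exact (hx z hz).symm
      · rfl
    rw [Subgroup.closure_union, Subgroup.closure_eq, ← Subgroup.zpowers_eq_closure] at h3
    exact fun y hy z hz => congrArg Subtype.val (h3.is_comm.comm ⟨y, hy⟩ ⟨z, hz⟩)

end HyperGroup

section MinimalIdempotent

theorem exists_minimal_idempotent (R : Type*) [CommRing R] [IsSemisimpleRing R] [Nontrivial R] :
    ∃ f : R, f ≠ 0 ∧ f * f = f ∧ ∀ x, x * f = 0 ∨ ∃ y, x * y * f = f := by
  obtain ⟨I⟩ : Nonempty (MaximalSpectrum R) := inferInstance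
  classical
  let e := IsArtinianRing.equivPi R
  have hmul : ∀ x, e (x * e.symm (Pi.single I 1)) = Pi.single I (e x I) := by
    intro x
    rw [map_mul, e.apply_symm_apply]
    ext J
    by_cases h : J = I
    · subst h; simp
    · simp [h]
  have := I.isMaximal
  refine ⟨e.symm (Pi.single I 1), ?_, ?_, fun x => ?_⟩
  · rw [Ne, map_eq_zero_iff _ e.symm.injective, Pi.single_eq_zero_iff]
    exact one_ne_zero
  · apply e.injective
    rw [hmul, e.apply_symm_apply, Pi.single_eq_same]
  · by_cases hx : e x I = 0
    · left
      apply e.injective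
      rw [hmul, hx, Pi.single_zero, map_zero]
    · right
      let _ : Field (R ⧸ I.asIdeal) := Ideal.Quotient.field I.asIdeal
      obtain ⟨b, hb⟩ : ∃ b : R ⧸ I.asIdeal, e x I * b = 1 := ⟨(e x I)⁻¹, mul_inv_cancel₀ hx⟩
      refine ⟨e.symm (Pi.single I b), e.injective ?_⟩
      rw [hmul, map_mul, Pi.mul_apply, e.apply_symm_apply, e.apply_symm_apply, Pi.single_eq_same,
        hb]

end MinimalIdempotent

section PrimitiveCase

theorem IsSchurSplittingField.mem_center_of_pow_eq_one {p : ℕ} {K : Type} [Field K]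
    (hK : IsSchurSplittingField p K) (hp : p.Prime) {E H : Type*} [Ring E] [Algebra K E]
    [Group H] {ρ : H →* E} (hρ : Function.Injective ρ) {L : Type*} [Field L] [Algebra K L]
    (ι : L →ₐ[K] E) {x : H} (hx : ρ x ∈ ι.range) (hxw : x ^ (if p = 2 then 4 else p) = 1)
    [Nontrivial E] : x ∈ Subgroup.center H := by
  obtain ⟨ζ, hζ⟩ := hK.exists_root
  obtain ⟨l, hl⟩ := hx
  have hl : ι l = ρ x := hl
  have hζL : IsPrimitiveRoot (algebraMap K L ζ) (if p = 2 then 4 else p) :=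
    hζ.map_of_injective (algebraMap K L).injective
  have hl1 : l ^ (if p = 2 then 4 else p) = 1 := by
    apply ι.toRingHom.injective
    change ι _ = ι 1
    rw [map_pow, hl, ← map_pow, hxw, map_one, map_one]
  have : NeZero (if p = 2 then 4 else p) := ⟨by split_ifs; exacts [by norm_num, hp.ne_zero]⟩
  obtain ⟨i, -, hi⟩ := hζL.eq_pow_of_pow_eq_one hl1
  rw [Subgroup.mem_center_iff]
  intro g
  apply hρ
  rw [map_mul, map_mul, ← hl, ← hi, ← map_pow, ι.commutes, Algebra.commutes]

theorem exists_algEquiv_conj {K L E : Type*} [Field K] [Field L] [Algebra K L]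
    [FiniteDimensional K L] [Ring E] [Nontrivial E] [Algebra K E] (ι : L →ₐ[K] E) {u v : E}
    (huv : v * u = 1) (hvu : u * v = 1) (h : ∀ x, u * ι x * v ∈ ι.range) :
    ∃ σ : L ≃ₐ[K] L, ∀ x, ι (σ x) * u = u * ι x := by
  choose f hf using h
  have hf : ∀ x, ι (f x) = u * ι x * v := hf
  have hinj : Function.Injective ι := ι.toRingHom.injective
  let φ : L →ₐ[K] L :=
    { toFun := f
      map_one' := hinj (by rw [hf, map_one, mul_one, hvu])
      map_zero' := hinj (by rw [hf, map_zero, mul_zero, zero_mul])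
      map_add' := fun x y => hinj (by simp only [map_add, hf, mul_add, add_mul])
      map_mul' := fun x y => hinj (by
        rw [map_mul, hf, hf, hf, map_mul]
        calc u * (ι x * ι y) * v = u * ι x * 1 * ι y * v := by noncomm_ring
          _ = _ := by rw [← huv]; noncomm_ring)
      commutes' := fun c => hinj (by
        rw [hf, ι.commutes, ← Algebra.commutes, mul_assoc, hvu, mul_one]) }
  refine ⟨AlgEquiv.ofBijective φ (Algebra.IsAlgebraic.algHom_bijective φ), fun x => ?_⟩
  change ι (f x) * u = _
  rw [hf, mul_assoc, huv, mul_one]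

theorem IsSchurSplittingField.exists_ne_zero_forall_mul_mul_eq_smul {p : ℕ} {K : Type} [Field K]
    (hK : IsSchurSplittingField p K) (hp : p.Prime) {E : Type*} {H : Type*} [Ring E] [Algebra K E]
    [Nontrivial E] [FiniteDimensional K E] [Algebra.IsCentral K E]
    [Group H] [Finite H] {ρ : H →* E} (hρ : Function.Injective ρ)
    (hspan : Submodule.span K (Set.range ρ) = ⊤)
    {ℓ : ℕ} (hℓ : ℓ.Prime) (hH : IsAbelianByPGroup ℓ H)
    (hfield : ∀ B : Subgroup H, B.Normal → (∀ x ∈ B, ∀ y ∈ B, x * y = y * x) →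
      ∃ (L : Type) (_ : Field L) (_ : Algebra K L) (ι : L →ₐ[K] E),
        ι.range = Algebra.adjoin K (ρ '' B)) :
    ∃ s : E, s ≠ 0 ∧ ∀ x : E, ∃ k : K, s * x * s = k • s := by
  have hF : ∀ B : Subgroup H, B.Normal → (∀ x ∈ B, ∀ y ∈ B, x * y = y * x) →
      ∀ x ∈ B, x ^ (if p = 2 then 4 else p) = 1 → x ∈ Subgroup.center H := by
    intro B hB hB' x hx hxw
    obtain ⟨L, _, _, ι, hι⟩ := hfield B hB hB'
    exact hK.mem_center_of_pow_eq_one hp hρ ι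
      (hι ▸ Algebra.subset_adjoin ⟨x, hx, rfl⟩) hxw
  have hcenter : ∀ x : E, (∀ h, ρ h * x = x * ρ h) → x ∈ Set.range (algebraMap K E) := by
    intro x hx
    have h1 : x ∈ Subalgebra.center K E := by
      rw [Subalgebra.mem_center_iff]
      intro b
      have hb : b ∈ Submodule.span K (Set.range ρ) := hspan ▸ Submodule.mem_top
      induction hb using Submodule.span_induction with
      | mem b hb => obtain ⟨h, rfl⟩ := hb; exact hx h
      | zero => simp
      | add b c _ _ hb hc => rw [add_mul, mul_add, hb, hc]
      | smul k b _ hb => rw [smul_mul_assoc, mul_smul_comm, hb]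
    rw [Algebra.IsCentral.center_eq_bot] at h1
    exact h1
  obtain ⟨A, hA, hAab, hAc⟩ := hH.exists_centralizer_le hℓ
  obtain ⟨L, _, _, ι, hι⟩ := hfield A hA hAab
  have hinj : Function.Injective ι := ι.toRingHom.injective
  have hfdL : FiniteDimensional K L := Module.Finite.of_injective ι.toLinearMap hinj
  have hmemA : ∀ a : A, ∃ x : L, ι x = ρ a := fun a => by
    have : ρ a ∈ ι.range := hι ▸ Algebra.subset_adjoin ⟨a, a.2, rfl⟩
    exact this
  choose f hf using hmemA
  let f' : A →* L :=
    { toFun := f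
      map_one' := hinj (by rw [hf, map_one, Subgroup.coe_one, map_one])
      map_mul' := fun a b => hinj (by rw [map_mul, hf, hf, hf, Subgroup.coe_mul, map_mul]) }
  have hf' : ∀ a, ι (f' a) = ρ a := hf
  have hf'inj : Function.Injective f' := fun a b hab => by
    apply Subtype.ext; apply hρ; rw [← hf', ← hf', hab]
  have hcyc : IsCyclic A := isCyclic_of_injective_ringHom f' hf'inj
  obtain ⟨⟨ζ, hζA⟩, hζ⟩ := hcyc.exists_generator
  have hAz : A = Subgroup.zpowers ζ := by
    ext x
    constructor
    · intro hx
      obtain ⟨k, hk⟩ := hζ ⟨x, hx⟩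
      exact ⟨k, congrArg Subtype.val hk⟩
    · rintro ⟨k, rfl⟩
      exact A.zpow_mem hζA k
  have hAnorm : (Subgroup.zpowers ζ).Normal := hAz ▸ hA
  have hcent : ∀ t, t * ζ = ζ * t → t ∈ Subgroup.zpowers ζ := by
    intro t ht
    rw [← hAz]
    apply hAc
    rw [hAz]
    rintro _ ⟨k, rfl⟩
    exact (show Commute t ζ from ht).zpow_right k
  set z : L := f' ⟨ζ, hζA⟩ with hz
  have hρinv : ∀ h, ρ h⁻¹ * ρ h = 1 := fun h => by rw [← map_mul, inv_mul_cancel, map_one]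
  have hρinv' : ∀ h, ρ h * ρ h⁻¹ = 1 := fun h => by rw [← map_mul, mul_inv_cancel, map_one]
  have hconj : ∀ h : H, ∃ σ : L ≃ₐ[K] L, ∀ x, ι (σ x) * ρ h = ρ h * ι x := by
    intro h
    refine exists_algEquiv_conj ι (hρinv h) (hρinv' h) fun x => ?_
    have hx : ι x ∈ Algebra.adjoin K (ρ '' A) := hι ▸ ⟨x, rfl⟩
    rw [hι]
    generalize ι x = w at hx
    induction hx using Algebra.adjoin_induction with
    | mem y hy =>
      obtain ⟨a, ha, rfl⟩ := hy
      rw [← map_mul, ← map_mul]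
      exact Algebra.subset_adjoin ⟨_, hA.conj_mem a ha h, rfl⟩
    | algebraMap k =>
      rw [← Algebra.commutes, mul_assoc, hρinv', mul_one]
      exact Subalgebra.algebraMap_mem _ k
    | add y w _ _ hy hw => rw [mul_add, add_mul]; exact add_mem hy hw
    | mul y w _ _ hy hw =>
      have := mul_mem hy hw
      rwa [show ρ h * y * ρ h⁻¹ * (ρ h * w * ρ h⁻¹) = ρ h * y * (ρ h⁻¹ * ρ h) * w * ρ h⁻¹ by
        noncomm_ring, hρinv, mul_one, mul_assoc (ρ h)] at this
  choose c hc using hconj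
  have hcuniq : ∀ h (σ : L ≃ₐ[K] L), (∀ x, ι (σ x) * ρ h = ρ h * ι x) → σ = c h := by
    intro h σ hσ
    ext x
    apply hinj
    have h1 := (hσ x).trans (hc h x).symm
    have h2 := congrArg (· * ρ h⁻¹) h1
    simpa only [mul_assoc, hρinv', mul_one] using h2
  let c' : H →* (L ≃ₐ[K] L) := MonoidHom.mk' c (fun g h => (hcuniq (g * h) (c g * c h) (fun x => by
    rw [AlgEquiv.mul_apply, map_mul, ← mul_assoc, hc, mul_assoc, hc, mul_assoc])).symm)
  have hc' : ∀ h x, ι (c' h x) * ρ h = ρ h * ι x := hc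
  have hcA : ∀ h, c' h = 1 → h ∈ A := by
    intro h hh
    rw [hAz]
    apply hcent
    apply hρ
    have := hc' h z
    rw [hh, AlgEquiv.one_apply, hf'] at this
    rw [map_mul, map_mul]
    exact this.symm
  have hfixed : ∀ x : L, (∀ h, c' h x = x) → x ∈ Set.range (algebraMap K L) := by
    intro x hx
    obtain ⟨k, hk⟩ := hcenter (ι x) (fun h => by rw [← hc', hx])
    exact ⟨k, hinj (by rw [ι.commutes, hk])⟩
  have hch := hK.charZero
  have hzord : IsPrimitiveRoot z (orderOf ζ) := by
    rw [IsPrimitiveRoot.iff_orderOf, hz, orderOf_injective f' hf'inj, Subgroup.orderOf_mk]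
  have hζ0 : 0 < orderOf ζ := orderOf_pos ζ
  have hgal : IsGalois K L := by
    apply IsGalois.of_fixedField_eq_bot
    rw [eq_bot_iff]
    intro x hx
    rw [IntermediateField.mem_bot]
    exact hfixed x (fun h => hx ⟨c' h, trivial⟩)
  have hcsurj : Function.Surjective c' := by
    rw [← MonoidHom.range_eq_top, ← IntermediateField.fixingSubgroup_fixedField c'.range,
      show IntermediateField.fixedField c'.range = ⊥ from ?_, IntermediateField.fixingSubgroup_bot]
    rw [eq_bot_iff]
    intro x hx
    rw [IntermediateField.mem_bot]
    exact hfixed x (fun h => hx ⟨c' h, ⟨h, rfl⟩⟩)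
  obtain ⟨a, N, hNp, hN⟩ := Nat.exists_eq_pow_mul_and_not_dvd hζ0.ne' p hp.ne_one
  have hNcop : N.Coprime p := ((Nat.Prime.coprime_iff_not_dvd hp).2 hNp).symm
  have hN0 : 0 < N := Nat.pos_of_ne_zero (by rintro rfl; exact hNp (dvd_zero p))
  have : NeZero N := ⟨hN0.ne'⟩
  have hzN : IsPrimitiveRoot (z ^ p ^ a) N := hzord.pow hζ0 hN
  have htop : IntermediateField.adjoin K {z ^ p ^ a} = ⊤ := by
    rw [← IsGalois.fixedField_fixingSubgroup (IntermediateField.adjoin K {z ^ p ^ a}),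
      show (IntermediateField.adjoin K {z ^ p ^ a}).fixingSubgroup = ⊥ from ?_,
      IntermediateField.fixedField_bot]
    rw [eq_bot_iff]
    intro τ hτ
    obtain ⟨h, rfl⟩ := hcsurj τ
    have h1 : c' h (z ^ p ^ a) = z ^ p ^ a :=
      hτ ⟨_, IntermediateField.mem_adjoin_simple_self K _⟩
    have h2 : Commute h (ζ ^ p ^ a) := by
      apply hρ
      have h3 := hc' h (z ^ p ^ a)
      rw [h1, map_pow, hf', ← map_pow] at h3
      rw [map_mul, map_mul]
      exact h3.symm
    have h4 : h ∈ Subgroup.zpowers ζ := by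
      refine mem_zpowers_of_commute_primeCompl hp hF ζ hcent fun x hx hxp => ?_
      obtain ⟨i, rfl⟩ := hx
      simp only at hxp ⊢
      have h5 : (ζ ^ i) ^ N = 1 := by
        apply orderOf_dvd_iff_pow_eq_one.1
        refine (hxp.pow_right a).dvd_of_dvd_mul_left ?_
        rw [← hN]
        apply orderOf_dvd_of_pow_eq_one
        rw [← zpow_natCast, ← zpow_mul, mul_comm, zpow_mul, zpow_natCast, pow_orderOf_eq_one,
          one_zpow]
      obtain ⟨u, v, huv⟩ := Nat.isCoprime_iff_coprime.2 (hNcop.pow_right a)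
      have h6 : ζ ^ i = ((ζ ^ p ^ a) ^ i) ^ v := by
        calc ζ ^ i = (ζ ^ i) ^ (u * N + v * ((p ^ a : ℕ) : ℤ)) := by rw [huv, zpow_one]
          _ = (((ζ ^ i) ^ N) ^ u) * ((ζ ^ p ^ a) ^ i) ^ v := by
            rw [zpow_add, ← zpow_natCast (ζ ^ i) N, ← zpow_natCast ζ (p ^ a)]
            simp only [← zpow_mul]
            congr 2 <;> ring
          _ = _ := by rw [h5, one_zpow, one_mul]
      rw [h6]
      exact ((h2.zpow_right i).zpow_right v).eq
    rw [Subgroup.mem_bot]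
    ext x
    apply hinj
    have h7 : ρ h ∈ ι.range := hι ▸ Algebra.subset_adjoin ⟨h, hAz ▸ h4, rfl⟩
    obtain ⟨y, hy⟩ := h7
    have hy : ι y = ρ h := hy
    have h8 := hc' h x
    rw [← hy, ← map_mul, ← map_mul] at h8
    have h9 := hinj h8
    have hy0 : y ≠ 0 := by
      rintro rfl
      rw [map_zero] at hy
      have := hρinv h
      rw [← hy, mul_zero] at this
      exact zero_ne_one this
    rw [mul_comm] at h9
    rw [mul_left_cancel₀ hy0 h9, AlgEquiv.one_apply]
  have hcyclo : IsCyclotomicExtension {N} K L := by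
    have h1 := isCyclotomicExtension_adjoin (K := K) hzN
    rw [htop] at h1
    exact IsCyclotomicExtension.equiv {N} K _ IntermediateField.topEquiv
  obtain ⟨σ, hσ, hnorm⟩ := hK.exists_prod_eq hp hNcop (L := L) (r := Nat.card H) Nat.card_pos
  obtain ⟨h, hh⟩ := hcsurj σ
  set n := Module.finrank K L with hn
  have hoσ : orderOf σ = n := by
    rw [orderOf_eq_card_of_forall_mem_zpowers hσ, IsGalois.card_aut_eq_finrank]
  have hhA : h ^ n ∈ A := hcA _ (by rw [map_pow, hh, ← hoσ, pow_orderOf_eq_one])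
  obtain ⟨k, hk⟩ : f' ⟨h ^ n, hhA⟩ ∈ Set.range (algebraMap K L) := by
    have hσx : σ (f' ⟨h ^ n, hhA⟩) = f' ⟨h ^ n, hhA⟩ := by
      apply hinj
      have h1 := hc' h (f' ⟨h ^ n, hhA⟩)
      rw [hh, hf', ← map_mul] at h1
      simp only at h1
      rw [← pow_succ', pow_succ, map_mul] at h1
      have h2 := congrArg (· * ρ h⁻¹) h1
      simp only [mul_assoc, hρinv', mul_one] at h2
      rw [h2, hf']
    rw [IsGalois.mem_range_algebraMap_iff_fixed]
    intro τ
    obtain ⟨i, rfl⟩ := (isOfFinOrder_of_finite σ).mem_powers_iff_mem_zpowers.2 (hσ τ)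
    simp only
    induction i with
    | zero => simp
    | succ i ih => rw [pow_succ, AlgEquiv.mul_apply, hσx, ih]
  have hk1 : k ^ Nat.card H = 1 := by
    apply (algebraMap K L).injective
    rw [map_pow, hk, ← map_pow, map_one]
    have : (⟨h ^ n, hhA⟩ : A) ^ Nat.card H = 1 := Subtype.ext pow_card_eq_one'
    rw [this, map_one]
  obtain ⟨y, hy⟩ := hnorm k hk1
  have hk0 : k ≠ 0 := by
    rintro rfl
    rw [zero_pow Nat.card_pos.ne'] at hk1
    exact zero_ne_one hk1
  have hy0 : ∀ i : ℕ, (σ ^ i) y ≠ 0 := by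
    intro i hi
    rw [map_eq_zero_iff _ (σ ^ i).injective] at hi
    rw [hi] at hy
    have hn0 : n ≠ 0 := Module.finrank_pos.ne'
    simp only [map_zero, Finset.prod_const, Finset.card_range, zero_pow hn0] at hy
    exact hk0 ((map_eq_zero_iff _ (algebraMap K L).injective).1 hy.symm)
  set u := ι y⁻¹ * ρ h with hu
  have hcommu : ∀ x, u * ι x = ι (σ x) * u := by
    intro x
    rw [hu, mul_assoc, ← hc', hh, ← mul_assoc, ← mul_assoc, ← map_mul, ← map_mul, mul_comm]
  have hupow : ∀ i : ℕ, ρ h ^ i = ι (∏ j ∈ Finset.range i, (σ ^ j) y) * u ^ i := by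
    intro i
    induction i with
    | zero => simp
    | succ i ih =>
      have h3 : ρ h = ι y * u := by
        rw [hu, ← mul_assoc, ← map_mul, mul_inv_cancel₀ (by simpa using hy0 0), map_one, one_mul]
      have h4 : ∀ (i : ℕ) x, u ^ i * ι x = ι ((σ ^ i) x) * u ^ i := by
        intro i
        induction i with
        | zero => intro x; simp
        | succ i ih' =>
          intro x
          rw [pow_succ', mul_assoc, ih', ← mul_assoc, hcommu, mul_assoc, pow_succ' σ,
            AlgEquiv.mul_apply]
      rw [pow_succ, ih, Finset.prod_range_succ, map_mul]
      conv_lhs => rw [h3]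
      rw [mul_assoc, ← mul_assoc (u ^ i), h4, pow_succ]
      simp only [mul_assoc]
  refine _root_.exists_ne_zero_forall_mul_mul_eq_smul ι σ hσ u ?_ hcommu ?_
  · have h5 := hupow n
    rw [hy, ← map_pow] at h5
    have h6 := hf' ⟨h ^ n, hhA⟩
    simp only at h6
    rw [← h6, ← hk] at h5
    have h7 := congrArg (ι (algebraMap K L k)⁻¹ * ·) h5
    simp only [← mul_assoc, ← map_mul] at h7
    rw [inv_mul_cancel₀ (by simpa using hk0), map_one, one_mul] at h7
    exact h7.symm
  · rw [eq_top_iff, ← hspan, Submodule.span_le]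
    rintro _ ⟨g, rfl⟩
    obtain ⟨i, hi⟩ := (isOfFinOrder_of_finite σ).mem_powers_iff_mem_zpowers.2 (hσ (c' g))
    simp only at hi
    have hgA : g * (h ^ i)⁻¹ ∈ A := hcA _ (by
      rw [map_mul, map_inv, map_pow, hh, hi, mul_inv_cancel])
    apply Submodule.subset_span
    refine ⟨f' ⟨_, hgA⟩ * ∏ j ∈ Finset.range i, (σ ^ j) y, i, ?_⟩
    rw [map_mul, mul_assoc, ← hupow, hf', ← map_pow, ← map_mul, inv_mul_cancel_right]

end PrimitiveCase

section Reduction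

theorem Subalgebra.exists_field_algHom_range_eq {K E : Type} [Field K] [Ring E] [Nontrivial E]
    [Algebra K E] (S : Subalgebra K E) (hcomm : ∀ x ∈ S, ∀ y ∈ S, x * y = y * x)
    (hinv : ∀ x ∈ S, x ≠ 0 → ∃ y ∈ S, x * y = 1) :
    ∃ (L : Type) (_ : Field L) (_ : Algebra K L) (ι : L →ₐ[K] E), ι.range = S := by
  have hf : IsField S :=
    { exists_pair_ne := ⟨0, 1, zero_ne_one⟩
      mul_comm := fun x y => Subtype.ext (hcomm x x.2 y y.2)
      mul_inv_cancel := fun {x} hx => by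
        obtain ⟨y, hy, hxy⟩ := hinv x x.2 (fun h => hx (Subtype.ext h))
        exact ⟨⟨y, hy⟩, Subtype.ext hxy⟩ }
  let _ : Field S := hf.toField
  exact ⟨S, hf.toField, S.algebra, S.val, S.range_val⟩

theorem exists_compression {K Δ V H : Type*} [Field K] [DivisionRing Δ]
    [Algebra K Δ] [AddCommGroup V] [Module K V] [Module Δ V] [IsScalarTower K Δ V] [Group H]
    (ρ : H →* Module.End Δ V) (hspan : Submodule.span K (Set.range ρ) = ⊤)
    (f : Module.End Δ V) (hff : f * f = f) (S : Subgroup H) (hS : ∀ s ∈ S, ρ s * f = f * ρ s)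
    (hS' : ∀ h, h ∉ S → f * ρ h * f = 0) :
    ∃ ρ' : S →* Module.End Δ (LinearMap.range f), Submodule.span K (Set.range ρ') = ⊤ := by
  let π : V →ₗ[Δ] LinearMap.range f := f.rangeRestrict
  let ι : LinearMap.range f →ₗ[Δ] V := (LinearMap.range f).subtype
  have hf : ∀ v, f (f v) = f v := fun v => LinearMap.congr_fun hff v
  have hπι : ∀ w, π (ι w) = w := by
    rintro ⟨_, v, rfl⟩
    exact Subtype.ext (hf v)
  have hιπ : ∀ v, ι (π v) = f v := fun v => rfl
  have hfι : ∀ w, f (ι w) = ι w := by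
    rintro ⟨_, v, rfl⟩
    exact hf v
  have hπf : ∀ v, π (f v) = π v := fun v => Subtype.ext (hf v)
  let κ : Module.End Δ V →ₗ[K] Module.End Δ (LinearMap.range f) :=
    { toFun := fun x => π ∘ₗ x ∘ₗ ι
      map_add' := fun x y => by
        ext w; simp
      map_smul' := fun c x => by
        apply LinearMap.ext
        intro w
        simp only [LinearMap.comp_apply, LinearMap.smul_apply, RingHom.id_apply]
        rw [LinearMap.map_smul_of_tower] }
  have hκ : ∀ x w, κ x w = π (x (ι w)) := fun _ _ => rfl
  let ρ' : S →* Module.End Δ (LinearMap.range f) :=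
    { toFun := fun s => κ (ρ s)
      map_one' := by
        apply LinearMap.ext; intro w
        rw [hκ, Subgroup.coe_one, map_one, Module.End.one_apply, hπι, Module.End.one_apply]
      map_mul' := fun s t => by
        apply LinearMap.ext; intro w
        rw [Module.End.mul_apply, hκ, hκ, hκ, hιπ, Subgroup.coe_mul, map_mul, Module.End.mul_apply]
        have h1 := LinearMap.congr_fun (hS s s.2) ((ρ t) (ι w))
        rw [Module.End.mul_apply, Module.End.mul_apply] at h1
        rw [h1, hπf] }
  have hρ' : ∀ s : S, ρ' s = κ (ρ s) := fun _ => rfl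
  refine ⟨ρ', ?_⟩
  rw [eq_top_iff]
  intro y _
  have h1 : κ (ι ∘ₗ y ∘ₗ π) = y := by
    apply LinearMap.ext; intro w
    rw [hκ, LinearMap.comp_apply, LinearMap.comp_apply, hπι, hπι]
  have h2 : (ι ∘ₗ y ∘ₗ π : Module.End Δ V) ∈ Submodule.span K (Set.range ρ) :=
    hspan ▸ Submodule.mem_top
  have h3 := Submodule.mem_map_of_mem (f := κ) h2
  rw [h1, Submodule.map_span] at h3
  refine Submodule.span_le.2 ?_ h3
  rintro _ ⟨_, ⟨h, rfl⟩, rfl⟩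
  by_cases hh : h ∈ S
  · exact Submodule.subset_span ⟨⟨h, hh⟩, rfl⟩
  · have h4 : κ (ρ h) = 0 := by
      apply LinearMap.ext; intro w
      have h5 := LinearMap.congr_fun (hS' h hh) (ι w)
      rw [Module.End.mul_apply, Module.End.mul_apply, hfι, LinearMap.zero_apply] at h5
      rw [hκ, ← hπf, h5, map_zero, LinearMap.zero_apply]
    rw [h4]
    exact zero_mem _

theorem exists_minimal_idempotent_adjoin {K E H : Type*} [Field K] [CharZero K] [Ring E]
    [Nontrivial E] [Algebra K E] [Group H] [Finite H] (ρ : H →* E) (B : Subgroup H)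
    (hB : ∀ x ∈ B, ∀ y ∈ B, x * y = y * x) :
    (∀ x ∈ Algebra.adjoin K (ρ '' B), ∀ y ∈ Algebra.adjoin K (ρ '' B), x * y = y * x) ∧
    ∃ f ∈ Algebra.adjoin K (ρ '' B), f ≠ 0 ∧ f * f = f ∧ ∀ x ∈ Algebra.adjoin K (ρ '' B),
      x * f = 0 ∨ ∃ y ∈ Algebra.adjoin K (ρ '' B), x * y * f = f := by
  have hmul : IsMulCommutative (Algebra.adjoin K (ρ '' B)) :=
    Algebra.isMulCommutative_adjoin K (by
      rintro _ ⟨x, hx, rfl⟩ _ ⟨y, hy, rfl⟩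
      rw [← map_mul, ← map_mul, hB x hx y hy])
  have hcomm : ∀ x ∈ Algebra.adjoin K (ρ '' B), ∀ y ∈ Algebra.adjoin K (ρ '' B),
      x * y = y * x := fun x hx y hy =>
    congrArg Subtype.val (hmul.is_comm.comm (⟨x, hx⟩ : Algebra.adjoin K (ρ '' B)) ⟨y, hy⟩)
  refine ⟨hcomm, ?_⟩
  let _ : CommRing (Algebra.adjoin K (ρ '' B)) :=
    { (inferInstance : Ring (Algebra.adjoin K (ρ '' B))) with mul_comm := hmul.is_comm.comm }
  let θ : B →* Algebra.adjoin K (ρ '' B) :=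
    { toFun := fun b => ⟨ρ b, Algebra.subset_adjoin ⟨b, b.2, rfl⟩⟩
      map_one' := Subtype.ext (by simp)
      map_mul' := fun x y => Subtype.ext (by simp) }
  let Θ := MonoidAlgebra.lift K (Algebra.adjoin K (ρ '' B)) B θ
  have hΘ : Function.Surjective Θ := by
    rw [← AlgHom.range_eq_top]
    rw [eq_top_iff]
    rintro ⟨x, hx⟩ -
    induction hx using Algebra.adjoin_induction with
    | mem x hx =>
      obtain ⟨b, hb, rfl⟩ := hx
      exact ⟨MonoidAlgebra.single ⟨b, hb⟩ 1, by simp [Θ, θ, MonoidAlgebra.lift_single]⟩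
    | algebraMap k => exact ⟨algebraMap K _ k, Θ.commutes k⟩
    | add x y hx hy h1 h2 => exact add_mem h1 h2
    | mul x y hx hy h1 h2 => exact mul_mem h1 h2
  have hss : IsSemisimpleRing (Algebra.adjoin K (ρ '' B)) := by
    have : NeZero (Nat.card B : K) := ⟨by exact_mod_cast Nat.card_pos.ne'⟩
    have : IsSemisimpleRing (MonoidAlgebra K B) := inferInstance
    exact RingHom.isSemisimpleRing_of_surjective Θ.toRingHom hΘ
  obtain ⟨f, hf0, hff, hf⟩ := exists_minimal_idempotent (Algebra.adjoin K (ρ '' B))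
  refine ⟨f, f.2, fun h => hf0 (Subtype.ext h), congrArg Subtype.val hff, fun x hx => ?_⟩
  rcases hf ⟨x, hx⟩ with h | ⟨y, hy⟩
  · exact Or.inl (congrArg Subtype.val h)
  · exact Or.inr ⟨y, y.2, congrArg Subtype.val hy⟩

end Reduction

section Hyper

theorem exists_field_or_proper_subgroup {K E H : Type} [Field K] [CharZero K] [Ring E]
    [Nontrivial E] [Algebra K E] [Algebra.IsCentral K E] [Group H] [Finite H] (ρ : H →* E)
    (hspan : Submodule.span K (Set.range ρ) = ⊤) (B : Subgroup H) [hBn : B.Normal]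
    (hB : ∀ x ∈ B, ∀ y ∈ B, x * y = y * x) :
    (∃ (L : Type) (_ : Field L) (_ : Algebra K L) (ι : L →ₐ[K] E),
      ι.range = Algebra.adjoin K (ρ '' B)) ∨
    ∃ (f : E) (S : Subgroup H), f ≠ 0 ∧ f * f = f ∧ S ≠ ⊤ ∧ (∀ s ∈ S, ρ s * f = f * ρ s) ∧
      ∀ h, h ∉ S → f * ρ h * f = 0 := by
  obtain ⟨hcomm, f, hfA, hf0, hff, hmin⟩ := exists_minimal_idempotent_adjoin (K := K) ρ B hB
  have hinv : ∀ h, ρ h⁻¹ * ρ h = 1 := fun h => by rw [← map_mul, inv_mul_cancel, map_one]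
  have hinv' : ∀ h, ρ h * ρ h⁻¹ = 1 := fun h => by rw [← map_mul, mul_inv_cancel, map_one]
  let S : Subgroup H :=
    { carrier := {h | ρ h * f = f * ρ h}
      one_mem' := by simp
      mul_mem' := fun {a b} (ha : _ = _) (hb : _ = _) => by
        change ρ (a * b) * f = f * ρ (a * b)
        rw [map_mul, mul_assoc, hb, ← mul_assoc, ha, mul_assoc]
      inv_mem' := fun {a} (ha : _ = _) => by
        change ρ a⁻¹ * f = f * ρ a⁻¹
        calc ρ a⁻¹ * f = ρ a⁻¹ * (f * ρ a) * ρ a⁻¹ := by rw [mul_assoc, mul_assoc, hinv', mul_one]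
          _ = f * ρ a⁻¹ := by rw [← ha, ← mul_assoc, hinv, one_mul] }
  have hSmem : ∀ h, h ∈ S ↔ ρ h * f = f * ρ h := fun _ => Iff.rfl
  have hconj : ∀ (h : H), ∀ x ∈ Algebra.adjoin K (ρ '' B),
      ρ h * x * ρ h⁻¹ ∈ Algebra.adjoin K (ρ '' B) := by
    intro h x hx
    induction hx using Algebra.adjoin_induction with
    | mem x hx =>
      obtain ⟨b, hb, rfl⟩ := hx
      exact Algebra.subset_adjoin ⟨h * b * h⁻¹, hBn.conj_mem b hb h, by rw [map_mul, map_mul]⟩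
    | algebraMap k =>
      rw [← Algebra.commutes, mul_assoc, hinv', mul_one]
      exact Subalgebra.algebraMap_mem _ k
    | add x y hx hy h1 h2 =>
      rw [mul_add, add_mul]
      exact add_mem h1 h2
    | mul x y hx hy h1 h2 =>
      have : ρ h * (x * y) * ρ h⁻¹ = (ρ h * x * ρ h⁻¹) * (ρ h * y * ρ h⁻¹) := by
        calc ρ h * (x * y) * ρ h⁻¹ = ρ h * x * 1 * y * ρ h⁻¹ := by simp only [mul_assoc, one_mul]
          _ = _ := by rw [← hinv h]; simp only [mul_assoc]
      rw [this]
      exact mul_mem h1 h2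
  by_cases hS : S = ⊤
  · left
    have hfc : f ∈ Subalgebra.center K E := by
      rw [Subalgebra.mem_center_iff]
      intro x
      have hx : x ∈ Submodule.span K (Set.range ρ) := hspan ▸ Submodule.mem_top
      induction hx using Submodule.span_induction with
      | mem x hx =>
        obtain ⟨h, rfl⟩ := hx
        exact (hSmem h).1 (hS ▸ Subgroup.mem_top h)
      | zero => simp
      | add x y _ _ hx hy => rw [add_mul, mul_add, hx, hy]
      | smul k x _ hx => rw [smul_mul_assoc, mul_smul_comm, hx]
    rw [Algebra.IsCentral.center_eq_bot] at hfc
    obtain ⟨k, hk⟩ := Algebra.mem_bot.1 hfc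
    have hk1 : f = 1 := by
      have hk2 : k * k = k := (algebraMap K E).injective (by rw [map_mul, hk, hff])
      rcases eq_or_ne k 0 with rfl | hk0
      · exact absurd (by rw [← hk, map_zero]) hf0
      · rw [← hk, mul_left_cancel₀ hk0 (hk2.trans (mul_one k).symm), map_one]
    refine Subalgebra.exists_field_algHom_range_eq _ hcomm fun x hx hx0 => ?_
    rcases hmin x hx with h | ⟨y, hy, hxy⟩
    · rw [hk1, mul_one] at h
      exact absurd h hx0
    · exact ⟨y, hy, by rw [hk1, mul_one] at hxy; exact hxy⟩
  · right
    refine ⟨f, S, hf0, hff, hS, fun s hs => hs, fun h hh => ?_⟩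
    have hdich : ∀ x ∈ Algebra.adjoin K (ρ '' B), x * x = x → x * f = 0 ∨ x * f = f := by
      intro x hx hxx
      rcases hmin x hx with h | ⟨y, hy, hxy⟩
      · exact Or.inl h
      · right
        calc x * f = x * (x * y * f) := by rw [hxy]
          _ = x * x * y * f := by simp only [mul_assoc]
          _ = f := by rw [hxx, hxy]
    have hidem : ∀ a : H, (ρ a * f * ρ a⁻¹) * (ρ a * f * ρ a⁻¹) = ρ a * f * ρ a⁻¹ := fun a => by
      calc (ρ a * f * ρ a⁻¹) * (ρ a * f * ρ a⁻¹) = ρ a * f * (ρ a⁻¹ * ρ a) * f * ρ a⁻¹ := by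
            simp only [mul_assoc]
        _ = ρ a * (f * f) * ρ a⁻¹ := by rw [hinv, mul_one, mul_assoc (ρ a)]
        _ = _ := by rw [hff]
    rcases hdich _ (hconj h f hfA) (hidem h) with h1 | h1
    · rw [hcomm _ (hconj h f hfA) f hfA] at h1
      calc f * ρ h * f = f * (ρ h * f * ρ h⁻¹) * ρ h := by
            simp only [mul_assoc, hinv, mul_one]
        _ = 0 := by rw [h1, zero_mul]
    · rw [hcomm _ (hconj h f hfA) f hfA] at h1
      rcases hdich _ (hconj h⁻¹ f hfA) (hidem h⁻¹) with h2 | h2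
      · rw [inv_inv] at h2
        calc f * ρ h * f = ρ h * (ρ h⁻¹ * f * ρ h * f) := by
              simp only [← mul_assoc, hinv', one_mul]
          _ = 0 := by rw [h2, mul_zero]
      · rw [inv_inv] at h2
        refine absurd ((hSmem h).2 ?_) hh
        calc ρ h * f = ρ h * (ρ h⁻¹ * f * ρ h * f) := by rw [h2]
          _ = f * ρ h * f := by simp only [← mul_assoc, hinv', one_mul]
          _ = f * (ρ h * f * ρ h⁻¹) * ρ h := by simp only [mul_assoc, hinv, mul_one]
          _ = f * ρ h := by rw [h1]

theorem IsSchurSplittingField.mem_range_algebraMap_of_isAbelianByPGroup {p : ℕ} {K : Type}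
    [Field K] (hK : IsSchurSplittingField p K) (hp : p.Prime) {ℓ : ℕ} (hℓ : ℓ.Prime) {Δ : Type}
    [DivisionRing Δ] [Algebra K Δ] [FiniteDimensional K Δ] [Algebra.IsCentral K Δ]
    (V : Type) [AddCommGroup V] [Module K V] [Module Δ V] [IsScalarTower K Δ V]
    [Nontrivial V] [Module.Finite Δ V] (H : Type) [Group H] [Finite H]
    (hH : IsAbelianByPGroup ℓ H) (ρ : H →* Module.End Δ V)
    (hspan : Submodule.span K (Set.range ρ) = ⊤) (d : Δ) :
    d ∈ Set.range (algebraMap K Δ) := by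
  have hchar := hK.charZero
  generalize hn : Nat.card H = n
  induction n using Nat.strong_induction_on generalizing V H with
  | _ n ih =>
  subst hn
  by_cases hρ : Function.Injective ρ
  · by_cases hall : ∀ B : Subgroup H, B.Normal → (∀ x ∈ B, ∀ y ∈ B, x * y = y * x) →
        ∃ (L : Type) (_ : Field L) (_ : Algebra K L) (ι : L →ₐ[K] Module.End Δ V),
          ι.range = Algebra.adjoin K (ρ '' B)
    · have : Module.Finite K V := Module.Finite.trans Δ V
      have : Module.Finite K (Module.End Δ V) :=
        Module.Finite.of_injective (LinearMap.restrictScalarsₗ K Δ V V K)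
          (LinearMap.restrictScalars_injective K)
      obtain ⟨s, hs, h⟩ := hK.exists_ne_zero_forall_mul_mul_eq_smul hp hρ hspan hℓ hH hall
      exact mem_range_algebraMap_of_forall_mul_mul_eq_smul hs h d
    · push Not at hall
      obtain ⟨B, hBn, hB, hBL⟩ := hall
      rcases exists_field_or_proper_subgroup (K := K) ρ hspan B hB with ⟨L, i1, i2, ι, hι⟩ | h
      · exact absurd hι (hBL L i1 i2 ι)
      · obtain ⟨f, S, hf0, hff, hS, hSf, hS'⟩ := h
        obtain ⟨ρ', hρ'⟩ := exists_compression ρ hspan f hff S hSf hS'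
        have hnt : Nontrivial (LinearMap.range f) := by
          obtain ⟨v, hv⟩ : ∃ v, f v ≠ 0 := by
            by_contra! h0
            exact hf0 (LinearMap.ext h0)
          exact ⟨⟨⟨f v, v, rfl⟩, 0, fun h => hv (congrArg Subtype.val h)⟩⟩
        exact ih (Nat.card S) (by
          refine lt_of_le_of_ne (Subgroup.card_le_card_group S) fun h => hS ?_
          exact Subgroup.eq_top_of_card_eq S h) (LinearMap.range f) S (hH.subgroup S) ρ' hρ' rfl
  · have hker : ρ.ker ≠ ⊥ := fun h => hρ ((MonoidHom.ker_eq_bot_iff ρ).1 h)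
    let ρ' : H ⧸ ρ.ker →* Module.End Δ V := QuotientGroup.lift ρ.ker ρ le_rfl
    refine ih (Nat.card (H ⧸ ρ.ker)) ?_ V (H ⧸ ρ.ker)
      (hH.of_surjective (QuotientGroup.mk' ρ.ker) (QuotientGroup.mk'_surjective _)) ρ' ?_ rfl
    · rw [Subgroup.card_eq_card_quotient_mul_card_subgroup ρ.ker]
      refine lt_mul_of_one_lt_right Nat.card_pos ?_
      exact Subgroup.one_lt_card_iff_ne_bot _ |>.2 hker
    · rw [eq_top_iff, ← hspan]
      refine Submodule.span_mono ?_
      rintro _ ⟨h, rfl⟩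
      exact ⟨(h : H ⧸ ρ.ker), rfl⟩

end Hyper

section CharacterCount

theorem exists_isAbelianByPGroup_not_dvd_card {ℓ : ℕ} (hℓ : ℓ.Prime) {G : Type*} [Group G]
    [Finite G] (g : G) :
    ∃ H : Subgroup G, IsAbelianByPGroup ℓ H ∧ ¬ ℓ ∣ Nat.card {q : G ⧸ H // g • q = q} := by
  have : Fact ℓ.Prime := ⟨hℓ⟩
  obtain ⟨a, m, hm, ham⟩ := Nat.exists_eq_pow_mul_and_not_dvd (orderOf_pos g).ne' ℓ hℓ.ne_one
  set c := g ^ ℓ ^ a with hc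
  have hco : orderOf c = m := by
    rw [hc, orderOf_pow_of_dvd (pow_ne_zero _ hℓ.ne_zero) (ham ▸ dvd_mul_right _ _), ham,
      Nat.mul_div_cancel_left _ (pow_pos hℓ.pos _)]
  let C := Subgroup.zpowers c
  let N := Subgroup.normalizer (C : Set G)
  have hCN : C ≤ N := Subgroup.le_normalizer
  let P : Sylow ℓ (N ⧸ C.subgroupOf N) := default
  let H₀ : Subgroup N := P.toSubgroup.comap (QuotientGroup.mk' (C.subgroupOf N))
  let H : Subgroup G := H₀.map N.subtype
  have hHN : H ≤ N := by
    rintro _ ⟨x, -, rfl⟩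
    exact x.2
  have hH₀ : ∀ n : N, (n : G) ∈ H ↔ n ∈ H₀ := fun n =>
    ⟨fun ⟨x, hx, hxn⟩ => Subtype.ext hxn ▸ hx, fun h => ⟨n, h, rfl⟩⟩
  have hpow : ∀ h ∈ H, ∃ k, h ^ ℓ ^ k ∈ C := by
    rintro _ ⟨x, hx, rfl⟩
    obtain ⟨k, hk⟩ := P.isPGroup' ⟨_, hx⟩
    refine ⟨k, ?_⟩
    have h1 := congrArg Subtype.val hk
    have h2 : ((x ^ ℓ ^ k : N) : N ⧸ C.subgroupOf N) = 1 := h1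
    exact (QuotientGroup.eq_one_iff (N := C.subgroupOf N) (x ^ ℓ ^ k)).1 h2
  have hCH : C ≤ H := fun x hx => (hH₀ ⟨x, hCN hx⟩).2 (by
    have h2 : ((⟨x, hCN hx⟩ : N) : N ⧸ C.subgroupOf N) = 1 := (QuotientGroup.eq_one_iff _).2 hx
    change ((⟨x, hCN hx⟩ : N) : N ⧸ C.subgroupOf N) ∈ P.toSubgroup
    rw [h2]
    exact one_mem _)
  have hcomm : ∀ x ∈ C, ∀ y ∈ C, x * y = y * x := by
    rintro _ ⟨i, rfl⟩ _ ⟨j, rfl⟩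
    exact ((Commute.refl c).zpow_zpow i j)
  refine ⟨H, ⟨C.subgroupOf H, Subgroup.normal_subgroupOf_of_le_normalizer hHN,
    fun x hx y hy => Subtype.ext (hcomm _ hx _ hy), fun h => hpow h h.2⟩, ?_⟩
  have hfix : ∀ x : G, c • (x : G ⧸ H) = x ↔ x ∈ N := by
    intro x
    rw [eq_comm, MulAction.Quotient.smul_coe, QuotientGroup.eq, smul_eq_mul]
    constructor
    · intro hx
      have hconj : ∀ n : ℕ, (x⁻¹ * (c * x)) ^ n = x⁻¹ * c ^ n * x := fun n => by
        have h := conj_pow (i := n) (a := x⁻¹) (b := c)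
        rwa [inv_inv, mul_assoc x⁻¹ c x] at h
      obtain ⟨k, hk⟩ := hpow _ hx
      obtain ⟨u, hu⟩ := exists_pow_eq_self_of_coprime (x := c) (n := ℓ ^ k)
        (by rw [hco]; exact Nat.Coprime.pow_left _ ((Nat.Prime.coprime_iff_not_dvd hℓ).2 hm))
      have hxc : x⁻¹ * c * x ∈ C := by
        have := C.pow_mem hk u
        rwa [← pow_mul, hconj, pow_mul, hu] at this
      rw [← inv_mem_iff]
      refine Subgroup.mem_normalizer_fintype ?_
      rintro _ ⟨i, rfl⟩
      change x⁻¹ * c ^ i * x⁻¹⁻¹ ∈ C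
      rw [← conj_zpow, inv_inv]
      exact C.zpow_mem hxc i
    · intro hx
      exact hCH (by simpa [mul_assoc] using
        (Subgroup.mem_normalizer_iff''.1 hx c).1 (Subgroup.mem_zpowers c))
  have hset : {q : G ⧸ H | c • q = q} = MulAction.orbit N ((1 : G) : G ⧸ H) := by
    ext q
    obtain ⟨x, rfl⟩ := QuotientGroup.mk_surjective q
    rw [Set.mem_ofPred_eq, hfix]
    constructor
    · intro hx
      exact ⟨⟨x, hx⟩, by change ((x * 1 : G) : G ⧸ H) = _; rw [mul_one]⟩
    · rintro ⟨n, hn⟩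
      have hn : ((n * 1 : G) : G ⧸ H) = x := hn
      rw [mul_one, QuotientGroup.eq] at hn
      have := N.mul_mem n.2 (hHN hn)
      rwa [mul_inv_cancel_left] at this
  have hstab : MulAction.stabilizer N ((1 : G) : G ⧸ H) = H₀ := by
    ext n
    rw [MulAction.mem_stabilizer_iff, ← hH₀]
    change ((n * 1 : G) : G ⧸ H) = ((1 : G) : G ⧸ H) ↔ _
    rw [mul_one, eq_comm, QuotientGroup.eq, inv_one, one_mul]
  have hcard : ¬ ℓ ∣ Nat.card {q : G ⧸ H // c • q = q} := by
    have h1 : Nat.card {q : G ⧸ H // c • q = q} = H₀.index := by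
      rw [← hstab, MulAction.index_stabilizer, ← hset]
      rfl
    rw [h1, Subgroup.index_comap_of_surjective _ (QuotientGroup.mk'_surjective _)]
    exact P.not_dvd_index
  have hgc : g * c = c * g := ((Commute.refl g).pow_right _).eq
  let f : Function.End {q : G ⧸ H // c • q = q} :=
    fun q => ⟨g • q.1, by rw [← mul_smul, ← hgc, mul_smul, q.2]⟩
  have hf : ∀ n (q : {q : G ⧸ H // c • q = q}), ((f ^ n : Function.End _) q).1 = g ^ n • q.1 := by
    intro n
    induction n with
    | zero => intro q; rw [pow_zero, pow_zero, one_smul]; rfl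
    | succ n ih =>
      intro q
      rw [pow_succ, pow_succ, mul_smul]
      exact ih (f q)
  classical
  have := Fintype.ofFinite {q : G ⧸ H // c • q = q}
  have hmod := Equiv.Perm.card_fixedPoints_modEq (f := f) (p := ℓ) (n := a)
    (funext fun q => Subtype.ext (by rw [hf]; exact q.2))
  let e : Function.fixedPoints f ≃ {q : G ⧸ H // g • q = q} :=
    { toFun := fun q => ⟨q.1.1, congrArg Subtype.val q.2⟩
      invFun := fun q => ⟨⟨q.1, by
        have : ∀ n, g ^ n • q.1 = q.1 := fun n => by
          induction n with
          | zero => simp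
          | succ n ih => rw [pow_succ, mul_smul, q.2, ih]
        exact this _⟩, Subtype.ext q.2⟩
      left_inv := fun q => rfl
      right_inv := fun q => rfl }
  rw [← Nat.card_eq_fintype_card, ← Nat.card_eq_fintype_card, Nat.card_congr e] at hmod
  exact fun h => hcard (((hmod.dvd_iff dvd_rfl)).2 h)

end CharacterCount

section CharacterCount

theorem Representation.sum_character_eq {K G W : Type*} [Field K] [CharZero K] [Group G]
    [Fintype G] [AddCommGroup W] [Module K W] [FiniteDimensional K W] (σ : Representation K G W) :
    ∑ x, σ.character x = (Nat.card G : K) * Module.finrank K σ.invariants := by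
  have hG : (Nat.card G : K) ≠ 0 := by exact_mod_cast Nat.card_pos.ne'
  have := invertibleOfNonzero hG
  rw [← σ.card_inv_mul_sum_char_eq_finrank, mul_inv_cancel_left₀ hG]

theorem Representation.sum_card_fixed_mul_character {K G W : Type*} [Field K] [CharZero K]
    [Group G] [Fintype G] [AddCommGroup W] [Module K W] [FiniteDimensional K W]
    (σ : Representation K G W) (X : Type*) [Finite X] [MulAction G X] (ℓ : ℕ)
    (h : ∀ ξ : X, ℓ ∣ Module.finrank K
      (Representation.invariants (σ.comp (MulAction.stabilizer G ξ).subtype))) :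
    ∃ n : ℤ, ∑ x : G, ((Nat.card {ξ : X // x • ξ = ξ} : ℤ) : K) * σ.character x =
      (Nat.card G : K) * (ℓ * n) := by
  classical
  have := Fintype.ofFinite X
  let T : X → K := fun ξ => ∑ x : G, if x • ξ = ξ then σ.character x else 0
  have hT : ∀ ξ, T ξ = (Nat.card (MulAction.stabilizer G ξ) : K) * Module.finrank K
      (Representation.invariants (σ.comp (MulAction.stabilizer G ξ).subtype)) := by
    intro ξ
    rw [← Representation.sum_character_eq]
    simp only [T]
    rw [← Finset.sum_filter]
    refine Finset.sum_subtype _ (fun x => ?_) _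
    simp
  have hTg : ∀ (g : G) ξ, T (g • ξ) = T ξ := by
    intro g ξ
    refine (Fintype.sum_equiv (MulAut.conj g).toEquiv _ _ fun x => ?_).symm
    have : (MulAut.conj g) x • g • ξ = g • ξ ↔ x • ξ = ξ := by
      rw [MulAut.conj_apply, smul_smul, inv_mul_cancel_right, mul_smul, smul_left_cancel_iff]
    change _ = if (MulAut.conj g) x • g • ξ = g • ξ then σ.character (g * x * g⁻¹) else 0
    simp only [this, Representation.char_conj]
  have hsum : ∑ x : G, ((Nat.card {ξ : X // x • ξ = ξ} : ℤ) : K) * σ.character x = ∑ ξ, T ξ := by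
    rw [Finset.sum_comm]
    refine Finset.sum_congr rfl fun x _ => ?_
    rw [← Finset.sum_filter, Finset.sum_const, nsmul_eq_mul, Nat.card_eq_fintype_card,
      Fintype.card_subtype]
    norm_cast
  choose d hd using h
  have horb : ∀ ω : MulAction.orbitRel.Quotient G X, ∃ n : ℤ, ∑ ξ : ω.orbit, T ξ =
      (Nat.card G : K) * (ℓ * n) := by
    intro ω
    obtain ⟨ξ, rfl⟩ := Quotient.exists_rep ω
    refine ⟨d ξ, ?_⟩
    have h1 : ∀ η : MulAction.orbitRel.Quotient.orbit
        (Quotient.mk _ ξ : MulAction.orbitRel.Quotient G X), T η = T ξ := by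
      rintro ⟨η, hη⟩
      obtain ⟨g, rfl⟩ : η ∈ MulAction.orbit G ξ := hη
      exact hTg g ξ
    rw [Finset.sum_congr rfl fun η _ => h1 η, Finset.sum_const, hT, hd, nsmul_eq_mul,
      Finset.card_univ, ← Nat.card_eq_fintype_card]
    have h2 : Nat.card (MulAction.orbitRel.Quotient.orbit
        (Quotient.mk _ ξ : MulAction.orbitRel.Quotient G X)) *
          Nat.card (MulAction.stabilizer G ξ) = Nat.card G := by
      simp only [Nat.card_eq_fintype_card]
      exact MulAction.card_orbit_mul_card_stabilizer_eq_card_group G ξ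
    rw [← mul_assoc, ← h2]
    push_cast
    ring
  choose n hn using horb
  have := Fintype.ofFinite (MulAction.orbitRel.Quotient G X)
  refine ⟨∑ ω, n ω, ?_⟩
  rw [hsum, ← (MulAction.selfEquivSigmaOrbits' G X).symm.sum_comp, Fintype.sum_sigma]
  push_cast
  rw [Finset.mul_sum, Finset.mul_sum]
  exact Finset.sum_congr rfl fun ω _ => hn ω

theorem Representation.exists_isAbelianByPGroup_not_dvd_finrank_invariants {ℓ : ℕ} (hℓ : ℓ.Prime)
    {G : Type} {K W : Type*} [Field K] [CharZero K] [Group G] [Finite G] [AddCommGroup W] [Module K W]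
    [FiniteDimensional K W] (σ : Representation K G W) (h : ¬ ℓ ∣ Module.finrank K σ.invariants) :
    ∃ H : Subgroup G, IsAbelianByPGroup ℓ H ∧
      ¬ ℓ ∣ Module.finrank K (Representation.invariants (σ.comp H.subtype)) := by
  have := Fintype.ofFinite G
  by_contra! hcon
  let J : AddSubgroup (G → ℤ) := AddSubgroup.closure
    {f | ∃ (X : Type) (_ : Finite X) (_ : MulAction G X),
      (∀ ξ : X, IsAbelianByPGroup ℓ (MulAction.stabilizer G ξ)) ∧
        f = fun x => (Nat.card {ξ : X // x • ξ = ξ} : ℤ)}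
  have hJ : ∀ j ∈ J, ∃ n : ℤ, ∑ x : G, (j x : K) * σ.character x =
      (Nat.card G : K) * (ℓ * n) := by
    intro j hj
    induction hj using AddSubgroup.closure_induction with
    | mem j hj =>
      obtain ⟨X, _, _, hX, rfl⟩ := hj
      exact σ.sum_card_fixed_mul_character X ℓ fun ξ => hcon _ (hX ξ)
    | zero => exact ⟨0, by simp⟩
    | add i j _ _ hi hj =>
      obtain ⟨m, hm⟩ := hi
      obtain ⟨n, hn⟩ := hj
      refine ⟨m + n, ?_⟩
      push_cast [Pi.add_apply]
      simp only [add_mul, mul_add, Finset.sum_add_distrib, hm, hn]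
    | neg i _ hi =>
      obtain ⟨m, hm⟩ := hi
      refine ⟨-m, ?_⟩
      push_cast [Pi.neg_apply]
      simp only [neg_mul, mul_neg, Finset.sum_neg_distrib, hm]
  have hmul : ∀ (X : Type) [Finite X] [MulAction G X],
      (∀ ξ : X, IsAbelianByPGroup ℓ (MulAction.stabilizer G ξ)) →
        ∀ j ∈ J, (j * fun x => (Nat.card {ξ : X // x • ξ = ξ} : ℤ)) ∈ J := by
    intro X _ _ hX j hj
    induction hj using AddSubgroup.closure_induction with
    | mem j hj =>
      obtain ⟨Y, _, _, hY, rfl⟩ := hj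
      refine AddSubgroup.subset_closure ⟨Y × X, inferInstance, inferInstance, fun ξ => ?_, ?_⟩
      · have hle : MulAction.stabilizer G ξ ≤ MulAction.stabilizer G ξ.1 :=
          fun x hx => congrArg Prod.fst hx
        exact ((hY ξ.1).subgroup ((MulAction.stabilizer G ξ).subgroupOf _)).of_surjective
          (Subgroup.subgroupOfEquivOfLe hle).toMonoidHom (Subgroup.subgroupOfEquivOfLe hle).surjective
      · funext x
        rw [Pi.mul_apply, ← Nat.cast_mul, ← Nat.card_prod]
        congr 1
        refine Nat.card_congr
          { toFun := fun q => ⟨(q.1.1, q.2.1), Prod.ext q.1.2 q.2.2⟩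
            invFun := fun q => (⟨q.1.1, congrArg Prod.fst q.2⟩, ⟨q.1.2, congrArg Prod.snd q.2⟩)
            left_inv := fun q => rfl
            right_inv := fun q => rfl }
    | zero => rw [zero_mul]; exact zero_mem _
    | add i j _ _ hi hj => rw [add_mul]; exact add_mem hi hj
    | neg i _ hi => rw [neg_mul]; exact neg_mem hi
  have hT : ∀ T : Finset G, ∃ n : ℤ, ¬ (ℓ : ℤ) ∣ n ∧ ∃ j ∈ J, ∀ x ∈ T, j x = n := by
    intro T
    classical
    induction T using Finset.induction_on with
    | empty =>
      exact ⟨1, fun h1 => hℓ.ne_one (by exact_mod_cast Int.eq_one_of_dvd_one (by positivity) h1), 0,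
        zero_mem _, by simp⟩
    | insert g T _ ih =>
      obtain ⟨n, hn, j, hj, hjn⟩ := ih
      obtain ⟨H, hH, hHg⟩ := exists_isAbelianByPGroup_not_dvd_card hℓ g
      have hstab : ∀ ξ : G ⧸ H, IsAbelianByPGroup ℓ (MulAction.stabilizer G ξ) := by
        intro ξ
        obtain ⟨x, rfl⟩ := QuotientGroup.mk_surjective ξ
        have hmem : ∀ h ∈ H, x * h * x⁻¹ ∈ MulAction.stabilizer G (x : G ⧸ H) := by
          intro h hh
          rw [MulAction.mem_stabilizer_iff, MulAction.Quotient.smul_coe, QuotientGroup.eq]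
          simpa using hh
        refine hH.of_surjective
          (((MulAut.conj x).toMonoidHom.comp H.subtype).codRestrict _ fun h => hmem h h.2) ?_
        rintro ⟨s, hs⟩
        rw [MulAction.mem_stabilizer_iff, MulAction.Quotient.smul_coe, eq_comm,
          QuotientGroup.eq] at hs
        exact ⟨⟨_, hs⟩, Subtype.ext (by simp [mul_assoc])⟩
      set π : G → ℤ := fun x => (Nat.card {ξ : G ⧸ H // x • ξ = ξ} : ℤ) with hπ
      have hπJ : π ∈ J := AddSubgroup.subset_closure ⟨G ⧸ H, inferInstance, inferInstance, hstab, rfl⟩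
      refine ⟨n * π g, ?_, π g • j + n • π - j * π, ?_, ?_⟩
      · intro hdvd
        rcases (Nat.prime_iff_prime_int.1 hℓ).dvd_or_dvd hdvd with h1 | h1
        · exact hn h1
        · exact hHg (Int.natCast_dvd_natCast.1 h1)
      · exact sub_mem (add_mem (J.zsmul_mem hj _) (J.zsmul_mem hπJ _)) (hmul _ hstab j hj)
      · intro x hx
        simp only [Pi.sub_apply, Pi.add_apply, Pi.smul_apply, Pi.mul_apply, smul_eq_mul]
        rcases Finset.mem_insert.1 hx with rfl | hx
        · ring
        · rw [hjn x hx]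
          ring
  obtain ⟨n, hn, j, hj, hjn⟩ := hT Finset.univ
  obtain ⟨k, hk⟩ := hJ j hj
  have hG : (Nat.card G : K) ≠ 0 := by exact_mod_cast Nat.card_pos.ne'
  have h1 : (Nat.card G : K) * (n * Module.finrank K σ.invariants) =
      (Nat.card G : K) * (ℓ * k) := by
    rw [← hk, Finset.sum_congr rfl fun x _ => by rw [hjn x (Finset.mem_univ x)],
      ← Finset.mul_sum, σ.sum_character_eq]
    ring
  have h2 : n * (Module.finrank K σ.invariants : ℤ) = ℓ * k := by
    exact_mod_cast mul_left_cancel₀ hG h1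
  rcases (Nat.prime_iff_prime_int.1 hℓ).dvd_or_dvd (Dvd.intro k h2.symm) with h3 | h3
  · exact hn h3
  · exact h (by exact_mod_cast h3)

end CharacterCount

section BaseChange

open Algebra.TensorProduct in
theorem basis_repr_mul_tmul_one {K D L ι : Type*} [Field K] [Field L] [Algebra K L]
    [DivisionRing D] [Algebra K D] (b : Module.Basis ι K L) (x : D ⊗[K] L) (d : D) (i : ι) :
    (basis D b).repr (x * (d ⊗ₜ 1)) i = (basis D b).repr x i * d := by
  induction x using TensorProduct.induction_on with
  | zero => simp
  | tmul a l =>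
    simp only [tmul_mul_tmul, mul_one, basis_repr_tmul, Finsupp.smul_apply,
      Finsupp.mapRange_apply, smul_eq_mul]
    rw [mul_assoc, mul_assoc, Algebra.commutes]
  | add x y hx hy => rw [add_mul, map_add, map_add, Finsupp.add_apply, Finsupp.add_apply, hx, hy,
      add_mul]

open Algebra.TensorProduct in
theorem basis_repr_tmul_one_mul {K D L ι : Type*} [Field K] [Field L] [Algebra K L]
    [DivisionRing D] [Algebra K D] (b : Module.Basis ι K L) (x : D ⊗[K] L) (d : D) (i : ι) :
    (basis D b).repr ((d ⊗ₜ 1) * x) i = d * (basis D b).repr x i := by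
  have : (d ⊗ₜ[K] (1 : L)) * x = d • x := by
    induction x using TensorProduct.induction_on with
    | zero => simp
    | tmul a l => rw [tmul_mul_tmul, one_mul, TensorProduct.smul_tmul', smul_eq_mul]
    | add x y hx hy => rw [mul_add, smul_add, hx, hy]
  rw [this, map_smul, Finsupp.smul_apply, smul_eq_mul]

open Algebra.TensorProduct in
theorem exists_eq_one_tmul_of_forall_commute {K D L : Type*} [Field K] [Field L] [Algebra K L]
    [DivisionRing D] [Algebra K D] [Algebra.IsCentral K D] (x : D ⊗[K] L)
    (hx : ∀ d : D, (d ⊗ₜ[K] (1 : L)) * x = x * (d ⊗ₜ 1)) : ∃ l : L, x = 1 ⊗ₜ l := by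
  let b := Module.Basis.ofVectorSpace K L
  have h : ∀ i, ∃ k : K, algebraMap K D k = (basis D b).repr x i := by
    intro i
    have : (basis D b).repr x i ∈ Subalgebra.center K D := by
      rw [Subalgebra.mem_center_iff]
      intro d
      rw [← basis_repr_tmul_one_mul, hx, basis_repr_mul_tmul_one]
    rw [Algebra.IsCentral.center_eq_bot] at this
    exact Algebra.mem_bot.1 this
  choose k hk using h
  refine ⟨∑ i ∈ ((basis D b).repr x).support, k i • b i, ?_⟩
  conv_lhs => rw [← (basis D b).linearCombination_repr x, Finsupp.linearCombination_apply,
    Finsupp.sum]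
  rw [TensorProduct.tmul_sum]
  refine Finset.sum_congr rfl fun i _ => ?_
  rw [← hk, basis_apply, TensorProduct.smul_tmul', smul_eq_mul, mul_one, TensorProduct.tmul_smul,
    TensorProduct.smul_tmul', Algebra.algebraMap_eq_smul_one]

open Algebra.TensorProduct in
theorem isSimpleRing_tensorProduct_field (K D L : Type*) [Field K] [Field L] [Algebra K L]
    [DivisionRing D] [Algebra K D] [Algebra.IsCentral K D] : IsSimpleRing (D ⊗[K] L) := by
  refine IsSimpleRing.of_eq_bot_or_eq_top fun I => ?_
  let b := Module.Basis.ofVectorSpace K L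
  by_cases hI : ∃ x ∈ I, x ≠ 0
  · right
    have hex : ∃ n, ∃ x ∈ I, x ≠ 0 ∧ ((basis D b).repr x).support.card = n := by
      obtain ⟨x, hx, hx0⟩ := hI
      exact ⟨_, x, hx, hx0, rfl⟩
    classical
    obtain ⟨x, hx, hx0, hxn⟩ := Nat.find_spec hex
    have hmin : ∀ y ∈ I, ((basis D b).repr y).support ⊂ ((basis D b).repr x).support → y = 0 := by
      intro y hy hlt
      by_contra hy0
      exact Nat.find_min hex (hxn ▸ Finset.card_lt_card hlt) ⟨y, hy, hy0, rfl⟩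
    obtain ⟨i, hi⟩ : ∃ i, (basis D b).repr x i ≠ 0 := by
      by_contra! h
      exact hx0 ((basis D b).repr.injective (Finsupp.ext fun i => by simp [h i]))
    set a := (basis D b).repr x i
    let y := (a⁻¹ ⊗ₜ[K] (1 : L)) * x
    have hyi : ∀ j, (basis D b).repr y j = a⁻¹ * (basis D b).repr x j :=
      fun j => basis_repr_tmul_one_mul b x _ j
    have hyI : y ∈ I := I.mul_mem_left _ _ hx
    have hcomm : ∀ d : D, (d ⊗ₜ[K] (1 : L)) * y = y * (d ⊗ₜ 1) := by
      intro d
      rw [← sub_eq_zero]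
      refine hmin _ (I.sub_mem (I.mul_mem_left _ _ hyI) (I.mul_mem_right _ _ hyI)) ?_
      have hval : ∀ j, (basis D b).repr ((d ⊗ₜ[K] (1 : L)) * y - y * (d ⊗ₜ 1)) j =
          d * (a⁻¹ * (basis D b).repr x j) - a⁻¹ * (basis D b).repr x j * d := fun j => by
        rw [map_sub, Finsupp.sub_apply, basis_repr_tmul_one_mul, basis_repr_mul_tmul_one, hyi]
      refine (Finset.ssubset_iff_of_subset fun j hj => ?_).2 ⟨i, ?_, ?_⟩
      · rw [Finsupp.mem_support_iff] at hj ⊢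
        intro h0
        exact hj (by rw [hval, h0]; simp)
      · exact Finsupp.mem_support_iff.2 hi
      · rw [Finsupp.notMem_support_iff, hval, inv_mul_cancel₀ hi, mul_one, one_mul, sub_self]
    obtain ⟨l, hl⟩ := exists_eq_one_tmul_of_forall_commute y hcomm
    have hl0 : l ≠ 0 := by
      rintro rfl
      have h1 := hyi i
      rw [hl, TensorProduct.tmul_zero, map_zero, Finsupp.zero_apply, inv_mul_cancel₀ hi] at h1
      exact zero_ne_one h1
    refine I.eq_top ?_
    have h1 : (1 : D ⊗[K] L) = (1 ⊗ₜ l⁻¹) * y := by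
      rw [hl, tmul_mul_tmul, inv_mul_cancel₀ hl0, mul_one, one_def]
    rw [h1]
    exact I.mul_mem_left _ _ hyI
  · left
    push Not at hI
    refine le_antisymm (fun x hx => ?_) bot_le
    rw [hI x hx]
    exact zero_mem _

theorem isSimpleRing_field_tensorProduct (K L D : Type*) [Field K] [Field L] [Algebra K L]
    [DivisionRing D] [Algebra K D] [Algebra.IsCentral K D] : IsSimpleRing (L ⊗[K] D) :=
  IsSimpleRing.of_ringEquiv (Algebra.TensorProduct.comm K D L).toRingEquiv
    (isSimpleRing_tensorProduct_field K D L)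

theorem isCentral_field_tensorProduct (K L D : Type*) [Field K] [Field L] [Algebra K L]
    [DivisionRing D] [Algebra K D] [Algebra.IsCentral K D] : Algebra.IsCentral L (L ⊗[K] D) where
  out := by
    intro x hx
    rw [Subalgebra.mem_center_iff] at hx
    obtain ⟨l, hl⟩ := exists_eq_one_tmul_of_forall_commute (Algebra.TensorProduct.comm K L D x)
      fun d => by
        have := congrArg (Algebra.TensorProduct.comm K L D) (hx (1 ⊗ₜ d))
        rwa [map_mul, map_mul, Algebra.TensorProduct.comm_tmul] at this
    refine Algebra.mem_bot.2 ⟨l, ?_⟩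
    have h1 := congrArg (Algebra.TensorProduct.comm K L D).symm hl
    rw [AlgEquiv.symm_apply_apply, Algebra.TensorProduct.comm_symm_tmul] at h1
    rw [h1]
    rfl

end BaseChange

section Count

theorem IsSimpleRing.exists_linearEquiv_pi {R M : Type*} [Ring R] [IsSimpleRing R]
    [IsArtinianRing R] [AddCommGroup M] [Module R M] [Module.Finite R M] :
    ∃ (n k : ℕ), n ≠ 0 ∧ Nonempty ((Fin n → M) ≃ₗ[R] (Fin k → R)) := by
  obtain ⟨n, hn, S, hS, ⟨e⟩⟩ := (IsSimpleRing.isIsotypic R R).linearEquiv_fun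
  have hiso := IsSimpleRing.isIsotypic R (R × M)
  let eS := S.equivMapOfInjective (LinearMap.inl R R M) LinearMap.inl_injective
  have hS' : IsSimpleModule R (S.map (LinearMap.inl R R M)) := IsSimpleModule.congr eS.symm
  have hM : IsIsotypicOfType R M S := by
    intro m hm
    let em := m.equivMapOfInjective (LinearMap.inr R R M) LinearMap.inr_injective
    have hm' : IsSimpleModule R (m.map (LinearMap.inr R R M)) := IsSimpleModule.congr em.symm
    obtain ⟨f⟩ := hiso (S.map (LinearMap.inl R R M)) (m.map (LinearMap.inr R R M))
    exact ⟨em.trans (f.trans eS.symm)⟩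
  obtain ⟨k, ⟨e'⟩⟩ := hM.linearEquiv_fun
  refine ⟨n, k, hn.out, ⟨?_⟩⟩
  exact (LinearEquiv.piCongrRight fun _ => e').trans <|
    (LinearEquiv.curry R S (Fin n) (Fin k)).symm.trans <|
    (LinearEquiv.funCongrLeft R S (Equiv.prodComm _ _)).trans <|
    (LinearEquiv.curry R S (Fin k) (Fin n)).trans <|
    LinearEquiv.piCongrRight fun _ => e.symm

theorem IsSimpleRing.finrank_sq_eq {K R M : Type*} [Field K] [Ring R] [Algebra K R]
    [FiniteDimensional K R] [IsSimpleRing R] [AddCommGroup M] [Module R M] [Module K M]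
    [IsScalarTower K R M] [Module.Finite R M] :
    Module.finrank K M ^ 2 = Module.finrank K R * Module.finrank K (Module.End R M) := by
  have : IsArtinianRing R := IsArtinianRing.of_finite K R
  obtain ⟨n, k, hn, ⟨e⟩⟩ := IsSimpleRing.exists_linearEquiv_pi (R := R) (M := M)
  have : Module.Finite K M := Module.Finite.trans R M
  have h1 : n * Module.finrank K M = k * Module.finrank K R := by
    have := (e.restrictScalars K).finrank_eq
    rwa [Module.finrank_pi_fintype, Module.finrank_pi_fintype, Finset.sum_const, Finset.sum_const,
      Finset.card_univ, Finset.card_univ, Fintype.card_fin, Fintype.card_fin, smul_eq_mul,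
      smul_eq_mul] at this
  have hself : Module.finrank K (Module.End R R) = Module.finrank K R := by
    rw [← (AlgEquiv.moduleEndSelf K (A := R)).toLinearEquiv.finrank_eq]
    exact (MulOpposite.opLinearEquiv K (M := R)).symm.finrank_eq
  have h2 : n * n * Module.finrank K (Module.End R M) = k * k * Module.finrank K R := by
    have h3 := (endVecAlgEquivMatrixEnd (Fin n) K R M).toLinearEquiv.finrank_eq
    have h4 := (endVecAlgEquivMatrixEnd (Fin k) K R R).toLinearEquiv.finrank_eq
    rw [Module.finrank_matrix, Fintype.card_fin] at h3 h4
    rw [← hself, ← h3, ← h4]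
    exact (e.conjAlgEquiv K).toLinearEquiv.finrank_eq
  have hn2 : 0 < n ^ 2 := by positivity
  refine Nat.eq_of_mul_eq_mul_left hn2 ?_
  calc n ^ 2 * Module.finrank K M ^ 2 = (n * Module.finrank K M) ^ 2 := by ring
    _ = Module.finrank K R * (k * k * Module.finrank K R) := by rw [h1]; ring
    _ = _ := by rw [← h2]; ring

end Count

section Centralizer

theorem dvd_finrank_centralizer_of_field {ℓ : ℕ} (hℓ : ℓ.Prime) {K Δ M Z : Type*} [Field K]
    [DivisionRing Δ] [Algebra K Δ] [FiniteDimensional K Δ] [Algebra.IsCentral K Δ]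
    [AddCommGroup M] [Module K M] [Module Δ M] [IsScalarTower K Δ M] [Module.Finite Δ M]
    [Field Z] [Algebra K Z] [FiniteDimensional K Z] (ρ : Z →ₐ[K] Module.End Δ M)
    (hdvd : ℓ ∣ Module.finrank K Δ) :
    ℓ ∣ Module.finrank K (Subalgebra.centralizer K (Set.range ρ)) := by
  let _ : Module Z M := Module.compHom M (ρ : Z →+* Module.End Δ M)
  have hsmul : ∀ (z : Z) (m : M), z • m = ρ z m := fun _ _ => rfl
  have : SMulCommClass Z Δ M := ⟨fun z d m => by rw [hsmul, hsmul, map_smul]⟩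
  have : IsScalarTower K Z M := ⟨fun k z m => by
    rw [hsmul, hsmul, map_smul, LinearMap.smul_apply]⟩
  let _ : Module (Z ⊗[K] Δ) M := TensorProduct.Algebra.module
  have htmul : ∀ (z : Z) (d : Δ) (m : M), (z ⊗ₜ[K] d) • m = z • d • m := fun _ _ _ => rfl
  have : IsScalarTower K (Z ⊗[K] Δ) M := ⟨fun k t m => by
    induction t using TensorProduct.induction_on with
    | zero => simp
    | tmul z d => rw [TensorProduct.smul_tmul', htmul, htmul, smul_assoc]
    | add s t hs ht => rw [smul_add, add_smul, add_smul, hs, ht, smul_add]⟩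
  have : IsSimpleRing (Z ⊗[K] Δ) := isSimpleRing_field_tensorProduct K Z Δ
  have hMK : Module.Finite K M := Module.Finite.trans Δ M
  have : Module.Finite (Z ⊗[K] Δ) M := Module.Finite.of_restrictScalars_finite K _ M
  have hsq := IsSimpleRing.finrank_sq_eq (K := K) (R := Z ⊗[K] Δ) (M := M)
  rw [Module.finrank_tensorProduct] at hsq
  let C := Subalgebra.centralizer K (Set.range ρ)
  have hC : ∀ f : Module.End Δ M, f ∈ C ↔ ∀ z, ρ z * f = f * ρ z := fun f => by
    rw [Subalgebra.mem_centralizer_iff, Set.forall_mem_range]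
  let E : C ≃ₗ[K] Module.End (Z ⊗[K] Δ) M :=
    { toFun := fun f =>
        { toFun := f.1
          map_add' := map_add f.1
          map_smul' := fun t m => by
            induction t using TensorProduct.induction_on with
            | zero => simp
            | tmul z d =>
              have h := LinearMap.congr_fun ((hC f.1).1 f.2 z) (d • m)
              rw [Module.End.mul_apply, Module.End.mul_apply] at h
              rw [htmul, hsmul, ← h, map_smul, RingHom.id_apply, htmul, hsmul]
            | add s t hs ht => rw [add_smul, map_add, hs, ht, RingHom.id_apply, RingHom.id_apply,
                RingHom.id_apply, add_smul] }
      map_add' := fun f g => rfl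
      map_smul' := fun k f => rfl
      invFun := fun f => ⟨
        { toFun := f
          map_add' := map_add f
          map_smul' := fun d m => by
            have h := map_smul f ((1 : Z) ⊗ₜ[K] d) m
            rwa [htmul, htmul, one_smul, one_smul] at h }, (hC _).2 fun z => by
          ext m
          have h := map_smul f (z ⊗ₜ[K] (1 : Δ)) m
          rw [htmul, htmul, one_smul, one_smul] at h
          exact h.symm⟩
      left_inv := fun f => rfl
      right_inv := fun f => rfl }
  rw [← E.finrank_eq] at hsq
  let ρ' : Z →ₐ[K] C := ρ.codRestrict C fun z => (hC _).2 fun w => by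
    rw [← map_mul, ← map_mul, mul_comm]
  have hzC : Module.finrank K Z ∣ Module.finrank K C := by
    let _ : Module Z C := Module.compHom C (ρ' : Z →+* C)
    have : IsScalarTower K Z C := ⟨fun k z c => by
      change ρ' (k • z) * c = k • (ρ' z * c)
      rw [map_smul, smul_mul_assoc]⟩
    exact ⟨_, (Module.finrank_mul_finrank K Z C).symm⟩
  rw [← Module.finrank_mul_finrank K Δ M] at hsq
  have hδ : 0 < Module.finrank K Δ := Module.finrank_pos
  have hdiv : ℓ ∣ Module.finrank K Z * Module.finrank K C := by
    have h : Module.finrank K Δ * (Module.finrank K Δ * Module.finrank Δ M ^ 2) =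
        Module.finrank K Δ * (Module.finrank K Z * Module.finrank K C) := by
      calc _ = (Module.finrank K Δ * Module.finrank Δ M) ^ 2 := by ring
        _ = _ := by rw [hsq]; ring
    rw [← Nat.eq_of_mul_eq_mul_left hδ h]
    exact hdvd.mul_right _
  rcases hℓ.dvd_mul.1 hdiv with h | h
  · exact h.trans hzC
  · exact h

/-- The elements of the corner ring `eBe` commuting with `u z` for all `z`. -/
def cornerCentralizer {K B Z : Type*} [Field K] [Ring B] [Algebra K B] (e : B) (u : Z → B) :
    Submodule K B where
  carrier := {y | e * y = y ∧ y * e = y ∧ ∀ z, u z * y = y * u z}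
  zero_mem' := by simp
  add_mem' := fun {x y} ⟨hx, hx', hx''⟩ ⟨hy, hy', hy''⟩ =>
    ⟨by rw [mul_add, hx, hy], by rw [add_mul, hx', hy'], fun z => by
      rw [mul_add, add_mul, hx'', hy'']⟩
  smul_mem' := fun k x ⟨hx, hx', hx''⟩ =>
    ⟨by rw [mul_smul_comm, hx], by rw [smul_mul_assoc, hx'], fun z => by
      rw [mul_smul_comm, smul_mul_assoc, hx'']⟩

theorem dvd_finrank_cornerCentralizer {ℓ : ℕ} (hℓ : ℓ.Prime) {K Δ V Z : Type*} [Field K]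
    [DivisionRing Δ] [Algebra K Δ] [FiniteDimensional K Δ] [Algebra.IsCentral K Δ]
    [AddCommGroup V] [Module K V] [Module Δ V] [IsScalarTower K Δ V] [Module.Finite Δ V]
    [DivisionRing Z] [Algebra K Z] [FiniteDimensional K Z] (hZ : ∀ x y : Z, x * y = y * x)
    (u : Z →ₙₐ[K] Module.End Δ V) (hdvd : ℓ ∣ Module.finrank K Δ) :
    ℓ ∣ Module.finrank K (cornerCentralizer (K := K) (u 1) u) := by
  let f := u 1
  have hff : f * f = f := by rw [← map_mul, one_mul]
  have huf : ∀ z, u z * f = u z := fun z => by rw [← map_mul, mul_one]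
  have hfu : ∀ z, f * u z = u z := fun z => by rw [← map_mul, one_mul]
  let π : V →ₗ[Δ] LinearMap.range f := f.rangeRestrict
  let ι : LinearMap.range f →ₗ[Δ] V := (LinearMap.range f).subtype
  have hf : ∀ v, f (f v) = f v := fun v => LinearMap.congr_fun hff v
  have hιπ : ∀ v, ι (π v) = f v := fun v => rfl
  have hfι : ∀ w, f (ι w) = ι w := by
    rintro ⟨_, v, rfl⟩
    exact hf v
  have hπι : ∀ w, π (ι w) = w := fun w => Subtype.ext (hfι w)
  have hπf : ∀ v, π (f v) = π v := fun v => Subtype.ext (hf v)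
  let κ : Module.End Δ V →ₗ[K] Module.End Δ (LinearMap.range f) :=
    { toFun := fun x => π ∘ₗ x ∘ₗ ι
      map_add' := fun x y => by
        ext w; simp
      map_smul' := fun c x => by
        apply LinearMap.ext
        intro w
        simp only [LinearMap.comp_apply, LinearMap.smul_apply, RingHom.id_apply]
        rw [LinearMap.map_smul_of_tower] }
  have hκ : ∀ x w, κ x w = π (x (ι w)) := fun _ _ => rfl
  have hκmul : ∀ x y, f * y = y → κ (x * y) = κ x * κ y := fun x y hy => by
    apply LinearMap.ext; intro w
    have h1 := LinearMap.congr_fun hy (ι w)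
    rw [Module.End.mul_apply] at h1
    rw [Module.End.mul_apply, hκ, hκ, hκ, hιπ, h1, Module.End.mul_apply]
  let ρ : Z →ₐ[K] Module.End Δ (LinearMap.range f) := AlgHom.ofLinearMap
    (κ ∘ₗ (u : Z →ₗ[K] Module.End Δ V))
    (LinearMap.ext fun w => by
      change π (f (ι w)) = w
      rw [hfι, hπι])
    (fun x y => by
      change κ (u (x * y)) = κ (u x) * κ (u y)
      rw [map_mul, hκmul _ _ (hfu y)])
  have hρ : ∀ z, ρ z = κ (u z) := fun _ => rfl
  have hcomm : ∀ g ∈ Subalgebra.centralizer K (Set.range ρ), ∀ z, ρ z * g = g * ρ z :=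
    fun g hg z => (Subalgebra.mem_centralizer_iff K).1 hg _ ⟨z, rfl⟩
  let E : cornerCentralizer (K := K) f u ≃ₗ[K] Subalgebra.centralizer K (Set.range ρ) :=
    { toFun := fun y => ⟨κ y, (Subalgebra.mem_centralizer_iff K).2 (by
        rintro _ ⟨z, rfl⟩
        rw [hρ, ← hκmul _ _ y.2.1, ← hκmul _ _ (hfu z), y.2.2.2])⟩
      map_add' := fun x y => Subtype.ext (map_add κ x.1 y.1)
      map_smul' := fun k x => Subtype.ext (map_smul κ k x.1)
      invFun := fun g => ⟨ι ∘ₗ g.1 ∘ₗ π, by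
        apply LinearMap.ext; intro w
        exact hfι _, by
        apply LinearMap.ext; intro w
        change ι (g.1 (π (f w))) = ι (g.1 (π w))
        rw [hπf], fun z => by
        apply LinearMap.ext; intro w
        change u z (ι (g.1 (π w))) = ι (g.1 (π (u z w)))
        have h1 := congrArg ι (LinearMap.congr_fun (hcomm g.1 g.2 z) (π w))
        rw [Module.End.mul_apply, Module.End.mul_apply, hρ, hκ, hκ, hιπ, hιπ] at h1
        have h2 := LinearMap.congr_fun (hfu z) (ι (g.1 (π w)))
        have h3 := LinearMap.congr_fun (huf z) w
        rw [Module.End.mul_apply] at h2 h3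
        rwa [h2, h3] at h1⟩
      left_inv := fun y => Subtype.ext (by
        apply LinearMap.ext; intro w
        change f (y.1 (f w)) = y.1 w
        have h1 := LinearMap.congr_fun y.2.1 (f w)
        have h2 := LinearMap.congr_fun y.2.2.1 w
        rw [Module.End.mul_apply] at h1 h2
        rw [h1, h2])
      right_inv := fun g => Subtype.ext (by
        apply LinearMap.ext; intro w
        change π (ι (g.1 (π (ι w)))) = g.1 w
        rw [hπι, hπι]) }
  rw [E.finrank_eq]
  let F : Field Z := { ‹DivisionRing Z› with mul_comm := hZ }
  exact dvd_finrank_centralizer_of_field (Z := Z) hℓ ρ hdvd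

end Centralizer

section MatrixGroup

/-- A matrix algebra as the algebra of endomorphisms of a free module over the opposite ring. -/
noncomputable def matrixAlgEquivEndVec (K D ι : Type*) [Field K] [Ring D] [Algebra K D]
    [Fintype ι] [DecidableEq ι] :
    Matrix ι ι D ≃ₐ[K] Module.End Dᵐᵒᵖ (ι → Dᵐᵒᵖ) :=
  (((AlgEquiv.opOp K D).trans (AlgEquiv.moduleEndSelf K (A := Dᵐᵒᵖ))).mapMatrix).trans
    (endVecAlgEquivMatrixEnd ι K Dᵐᵒᵖ Dᵐᵒᵖ).symm

theorem span_range_comp_eq_top {K A B G : Type*} [Field K] [Ring A] [Ring B] [Algebra K A]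
    [Algebra K B] [Monoid G] (ρ : G →* A) (h : Submodule.span K (Set.range ρ) = ⊤)
    (f : A →ₐ[K] B) (hf : Function.Surjective f) :
    Submodule.span K (Set.range ((f : A →* B).comp ρ)) = ⊤ := by
  have h1 : Set.range ((f : A →* B).comp ρ) = f.toLinearMap '' Set.range ρ := by
    rw [← Set.range_comp]; rfl
  rw [h1, Submodule.span_image, h, Submodule.map_top, LinearMap.range_eq_top]
  exact hf

theorem IsSchurSplittingField.mem_range_algebraMap_of_matrix {p : ℕ} {Z : Type} [Field Z]
    (hZ : IsSchurSplittingField p Z) (hp : p.Prime) {ℓ : ℕ} (hℓ : ℓ.Prime)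
    {D : Type} [DivisionRing D] [Algebra Z D] [FiniteDimensional Z D] [Algebra.IsCentral Z D]
    {H : Type} [Group H] [Finite H] (hH : IsAbelianByPGroup ℓ H) {n : ℕ} [NeZero n]
    (θ : H →* Matrix (Fin n) (Fin n) D) (hθ : Submodule.span Z (Set.range θ) = ⊤) (x : D) :
    x ∈ Set.range (algebraMap Z D) := by
  have : FiniteDimensional Z Dᵐᵒᵖ := Module.Finite.equiv (MulOpposite.opLinearEquiv Z)
  obtain ⟨E⟩ : Nonempty (Matrix (Fin n) (Fin n) D ≃ₐ[Z] Module.End Dᵐᵒᵖ (Fin n → Dᵐᵒᵖ)) :=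
    ⟨matrixAlgEquivEndVec Z D (Fin n)⟩
  have h1 := span_range_comp_eq_top θ hθ E.toAlgHom E.surjective
  let ρ : H →* Module.End Dᵐᵒᵖ (Fin n → Dᵐᵒᵖ) := (E.toAlgHom : _ →* _).comp θ
  have key := @IsSchurSplittingField.mem_range_algebraMap_of_isAbelianByPGroup p Z _ hZ hp ℓ hℓ
    Dᵐᵒᵖ _ _ _ _ (Fin n → Dᵐᵒᵖ) _ _ _ _ _ _ H _ _ hH
  obtain ⟨z, hz⟩ := key ρ h1 (MulOpposite.op x)
  exact ⟨z, congrArg MulOpposite.unop hz⟩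

theorem IsSchurSplittingField.mul_comm_of_isAbelianByPGroup {p : ℕ} {K : Type} [Field K]
    (hK : IsSchurSplittingField p K) (hp : p.Prime) {ℓ : ℕ} (hℓ : ℓ.Prime)
    {D : Type} [DivisionRing D] [Algebra K D] [FiniteDimensional K D]
    {H : Type} [Group H] [Finite H] (hH : IsAbelianByPGroup ℓ H) {n : ℕ} [NeZero n]
    (θ : H →* Matrix (Fin n) (Fin n) D) (hθ : Submodule.span K (Set.range θ) = ⊤) (x y : D) :
    x * y = y * x := by
  let _ : Algebra K (Subring.center D) := ((algebraMap K D).codRestrict _ fun k =>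
    Subring.mem_center_iff.2 fun d => (Algebra.commutes k d).symm).toAlgebra
  have : IsScalarTower K (Subring.center D) D := IsScalarTower.of_algebraMap_eq fun _ => rfl
  have : FiniteDimensional K (Subring.center D) := FiniteDimensional.left K _ D
  have : FiniteDimensional (Subring.center D) D := FiniteDimensional.right K _ D
  have hKZ : IsSchurSplittingField p (Subring.center D) := hK.of_finiteDimensional hp
  have : Algebra.IsCentral (Subring.center D) D := ⟨fun d hd =>
    Algebra.mem_bot.2 ⟨⟨d, Subring.mem_center_iff.2 (Subalgebra.mem_center_iff.1 hd)⟩, rfl⟩⟩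
  have hspan : Submodule.span (Subring.center D) (Set.range θ) = ⊤ := by
    rw [eq_top_iff]
    intro t _
    exact Submodule.span_le_restrictScalars K (Subring.center D) _
      (hθ ▸ Submodule.mem_top : t ∈ Submodule.span K (Set.range θ))
  obtain ⟨z, hz⟩ := hKZ.mem_range_algebraMap_of_matrix hp hℓ hH θ hspan x
  rw [← hz]
  exact (Subring.mem_center_iff.1 z.2 y).symm

end MatrixGroup

section MatrixUnits

theorem finrank_eq_sum_cornerCentralizer {K B ι : Type*} [Field K] [Ring B] [Algebra K B]
    [FiniteDimensional K B] [Fintype ι] [DecidableEq ι] {n : ι → ℕ} [∀ i, NeZero (n i)]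
    {D : ι → Type*} [∀ i, DivisionRing (D i)] (u : ∀ i, Fin (n i) → Fin (n i) → D i → B)
    (hmul : ∀ i j k l x y, u i j k x * u i k l y = u i j l (x * y))
    (hne : ∀ i j k k' l x y, k ≠ k' → u i j k x * u i k' l y = 0)
    (hne' : ∀ i i' j k k' l x y, i ≠ i' → u i j k x * u i' k' l y = 0)
    (hone : ∑ i, ∑ j, u i j j 1 = 1) (C : Submodule K B)
    (hC : ∀ c, c ∈ C ↔ ∀ i j k x, u i j k x * c = c * u i j k x) :
    Module.finrank K C =
      ∑ i, Module.finrank K (cornerCentralizer (K := K) (u i 0 0 1) (u i 0 0)) := by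
  have hl : ∀ i j k x (y : ∀ i, cornerCentralizer (K := K) (u i 0 0 1) (u i 0 0)),
      u i j k x * (∑ i, ∑ j, u i j 0 1 * (y i).1 * u i 0 j 1) =
        u i j 0 x * (y i).1 * u i 0 k 1 := by
    intro i j k x y
    simp only [Finset.mul_sum, ← mul_assoc]
    rw [Finset.sum_eq_single i, Finset.sum_eq_single k]
    · rw [hmul, mul_one]
    · intro b _ hb
      rw [hne _ _ _ _ _ _ _ hb.symm, zero_mul, zero_mul]
    · simp
    · intro b _ hb
      exact Finset.sum_eq_zero fun j' _ => by
        rw [hne' _ _ _ _ _ _ _ _ hb.symm, zero_mul, zero_mul]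
    · simp
  have hr : ∀ i j k x (y : ∀ i, cornerCentralizer (K := K) (u i 0 0 1) (u i 0 0)),
      (∑ i, ∑ j, u i j 0 1 * (y i).1 * u i 0 j 1) * u i j k x =
        u i j 0 1 * (y i).1 * u i 0 k x := by
    intro i j k x y
    simp only [Finset.sum_mul, mul_assoc]
    rw [Finset.sum_eq_single i, Finset.sum_eq_single j]
    · rw [hmul, one_mul]
    · intro b _ hb
      rw [hne _ _ _ _ _ _ _ hb, mul_zero, mul_zero]
    · simp
    · intro b _ hb
      exact Finset.sum_eq_zero fun j' _ => by
        rw [hne' _ _ _ _ _ _ _ _ hb, mul_zero, mul_zero]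
    · simp
  let E : C ≃ₗ[K] ∀ i, cornerCentralizer (K := K) (u i 0 0 1) (u i 0 0) :=
    { toFun := fun c i => ⟨c.1 * u i 0 0 1, by
        rw [← mul_assoc, (hC _).1 c.2, mul_assoc, hmul, mul_one], by
        rw [mul_assoc, hmul, mul_one], fun z => by
        rw [← mul_assoc, (hC _).1 c.2, mul_assoc, mul_assoc, hmul, hmul, mul_one, one_mul]⟩
      map_add' := fun c c' => funext fun i => Subtype.ext (add_mul _ _ _)
      map_smul' := fun k c => funext fun i => Subtype.ext (smul_mul_assoc _ _ _)
      invFun := fun y => ⟨∑ i, ∑ j, u i j 0 1 * (y i).1 * u i 0 j 1, (hC _).2 fun i j k x => by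
        rw [hl, hr]
        calc u i j 0 x * (y i).1 * u i 0 k 1
            = u i j 0 1 * (u i 0 0 x * (y i).1) * u i 0 k 1 := by
              rw [← mul_assoc, hmul, one_mul]
          _ = u i j 0 1 * (y i).1 * (u i 0 0 x * u i 0 k 1) := by
              rw [(y i).2.2.2 x]; simp only [mul_assoc]
          _ = _ := by rw [hmul, mul_one]⟩
      left_inv := fun c => Subtype.ext (by
        calc ∑ i, ∑ j, u i j 0 1 * (c.1 * u i 0 0 1) * u i 0 j 1
            = ∑ i, ∑ j, c.1 * u i j j 1 := by
              refine Finset.sum_congr rfl fun i _ => Finset.sum_congr rfl fun j _ => ?_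
              rw [← mul_assoc, (hC _).1 c.2, mul_assoc, mul_assoc, hmul, hmul, mul_one, mul_one]
          _ = c.1 := by
              simp only [← Finset.mul_sum]; rw [hone, mul_one])
      right_inv := fun y => funext fun i => Subtype.ext (by
        change (∑ i, ∑ j, u i j 0 1 * (y i).1 * u i 0 j 1) * u i 0 0 1 = (y i).1
        rw [hr, (y i).2.1, (y i).2.2.1]) }
  rw [E.finrank_eq, Module.finrank_pi_fintype]

theorem finrank_centralizer_eq_sum {K B : Type*} [Field K] [Ring B] [Algebra K B]
    [FiniteDimensional K B] {ι : Type*} [Fintype ι] [DecidableEq ι] {n : ι → ℕ}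
    [∀ i, NeZero (n i)] {D : ι → Type*} [∀ i, DivisionRing (D i)] [∀ i, Algebra K (D i)]
    (Φ : (∀ i, Matrix (Fin (n i)) (Fin (n i)) (D i)) →ₐ[K] B) :
    ∃ u : ∀ i, D i →ₙₐ[K] B, Module.finrank K (Subalgebra.centralizer K (Set.range Φ)) =
      ∑ i, Module.finrank K (cornerCentralizer (K := K) (u i 1) (u i)) := by
  let u : ∀ i, Fin (n i) → Fin (n i) → D i → B := fun i j k x =>
    Φ (Pi.single i (Matrix.single j k x))
  have hmul : ∀ i j k l x y, u i j k x * u i k l y = u i j l (x * y) := fun i j k l x y => by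
    simp only [u]
    rw [← map_mul, ← Pi.single_mul, Matrix.single_mul_single_same]
  let v : ∀ i, D i →ₙₐ[K] B := fun i =>
    { toFun := u i 0 0
      map_smul' := fun k x => by
        simp only [u]
        rw [← Matrix.smul_single, Pi.single_smul, map_smul]; rfl
      map_zero' := by simp [u]
      map_add' := fun x y => by
        simp only [u]
        rw [Matrix.single_add, Pi.single_add, map_add]
      map_mul' := fun x y => (hmul i 0 0 0 x y).symm }
  refine ⟨v, finrank_eq_sum_cornerCentralizer u hmul ?_ ?_ ?_
    (Subalgebra.toSubmodule (Subalgebra.centralizer K (Set.range Φ))) ?_⟩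
  · intro i j k k' l x y h
    simp only [u]
    rw [← map_mul, ← Pi.single_mul, Matrix.single_mul_single_of_ne _ _ _ _ h, Pi.single_zero,
      map_zero]
  · intro i i' j k k' l x y h
    simp only [u]
    rw [← map_mul, ← map_zero Φ]
    congr 1
    ext a : 1
    rw [Pi.mul_apply, Pi.zero_apply]
    rcases eq_or_ne a i with rfl | ha
    · rw [Pi.single_eq_of_ne h (M := fun i => Matrix (Fin (n i)) (Fin (n i)) (D i)), mul_zero]
    · rw [Pi.single_eq_of_ne ha (M := fun i => Matrix (Fin (n i)) (Fin (n i)) (D i)), zero_mul]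
  · simp only [u, ← map_sum]
    convert map_one Φ using 2
    ext i : 1
    rw [Finset.sum_apply, Finset.sum_eq_single i]
    · rw [Finset.sum_apply]
      simp [Matrix.sum_single_one]
    · intro b _ hb
      simp [Pi.single_eq_of_ne hb.symm]
    · simp
  · intro c
    rw [Subalgebra.mem_toSubmodule, Subalgebra.mem_centralizer_iff, Set.forall_mem_range]
    refine ⟨fun h i j k x => h _, fun h X => ?_⟩
    have hX : X = ∑ i, ∑ j, ∑ k, Pi.single i (Matrix.single j k (X i j k)) := by
      ext i : 1
      rw [Finset.sum_apply, Finset.sum_eq_single i]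
      · conv_lhs => rw [Matrix.matrix_eq_sum_single (X i)]
        simp
      · intro b _ hb
        simp [Pi.single_eq_of_ne hb.symm]
      · simp
    rw [hX]
    simp only [map_sum, Finset.sum_mul, Finset.mul_sum]
    exact Finset.sum_congr rfl fun i _ => Finset.sum_congr rfl fun j _ =>
      Finset.sum_congr rfl fun k _ => h i j k _

end MatrixUnits

section Main

/-- The conjugation representation attached to a group homomorphism into an algebra. -/
def conjRepresentation {K G B : Type*} [Field K] [Group G] [Ring B] [Algebra K B] (ρ : G →* B) :
    Representation K G B where
  toFun g := LinearMap.mulLeftRight K (ρ g, ρ g⁻¹)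
  map_one' := by ext x; simp
  map_mul' g h := by ext x; simp [mul_assoc]

theorem mem_invariants_conjRepresentation {K G B : Type*} [Field K] [Group G] [Ring B]
    [Algebra K B] (ρ : G →* B) (b : B) :
    b ∈ (conjRepresentation (K := K) ρ).invariants ↔ ∀ g, ρ g * b = b * ρ g := by
  rw [Representation.mem_invariants]
  refine forall_congr' fun g => ?_
  change ρ g * b * ρ g⁻¹ = b ↔ _
  constructor
  · intro h
    conv_rhs => rw [← h]
    rw [mul_assoc, mul_assoc, ← map_mul, inv_mul_cancel, map_one, mul_one]
  · intro h
    rw [h, mul_assoc, ← map_mul, mul_inv_cancel, map_one, mul_one]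

theorem MonoidAlgebra.span_range_of {K G : Type*} [Field K] [Monoid G] :
    Submodule.span K (Set.range (MonoidAlgebra.of K G)) = ⊤ := by
  rw [eq_top_iff]
  intro x _
  induction x using MonoidAlgebra.induction_on with
  | of g => exact Submodule.subset_span ⟨g, rfl⟩
  | add a b ha hb => exact Submodule.add_mem _ (ha trivial) (hb trivial)
  | smul r a ha => exact Submodule.smul_mem _ r (ha trivial)

theorem IsSchurSplittingField.finrank_eq_one {p : ℕ} {K : Type} [Field K]
    (hK : IsSchurSplittingField p K) (hp : p.Prime) {Δ : Type} [DivisionRing Δ] [Algebra K Δ]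
    [FiniteDimensional K Δ] [Algebra.IsCentral K Δ] (V : Type) [AddCommGroup V] [Module K V]
    [Module Δ V] [IsScalarTower K Δ V] [Nontrivial V] [Module.Finite Δ V] (G : Type) [Group G]
    [Finite G] (ρ : G →* Module.End Δ V) (hspan : Submodule.span K (Set.range ρ) = ⊤) :
    Module.finrank K Δ = 1 := by
  by_contra hne
  obtain ⟨ℓ, hℓ, hdvd⟩ := Nat.exists_prime_and_dvd hne
  have := hK.charZero
  have hVK : Module.Finite K V := Module.Finite.trans Δ V
  have hB : FiniteDimensional K (Module.End Δ V) :=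
    .of_injective (LinearMap.restrictScalarsₗ K Δ V V K) (LinearMap.restrictScalars_injective K)
  have hinv : (conjRepresentation (K := K) ρ).invariants =
      Subalgebra.toSubmodule (⊥ : Subalgebra K (Module.End Δ V)) := by
    rw [← Algebra.IsCentral.center_eq_bot K (Module.End Δ V)]
    ext b
    rw [mem_invariants_conjRepresentation, Subalgebra.mem_toSubmodule, Subalgebra.mem_center_iff]
    refine ⟨fun h x => ?_, fun h g => h _⟩
    have hx : x ∈ Submodule.span K (Set.range ρ) := hspan ▸ Submodule.mem_top
    induction hx using Submodule.span_induction with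
    | mem x hx => obtain ⟨g, rfl⟩ := hx; exact h g
    | zero => simp
    | add x y _ _ hx hy => rw [add_mul, mul_add, hx, hy]
    | smul k x _ hx => rw [smul_mul_assoc, mul_smul_comm, hx]
  obtain ⟨H, hH, hHdvd⟩ := Representation.exists_isAbelianByPGroup_not_dvd_finrank_invariants hℓ
    (conjRepresentation (K := K) ρ) (by
      rw [hinv, Subalgebra.finrank_toSubmodule, Subalgebra.finrank_bot]
      exact hℓ.one_lt.ne' ∘ Nat.dvd_one.1)
  apply hHdvd
  let φ : MonoidAlgebra K H →ₐ[K] Module.End Δ V :=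
    MonoidAlgebra.lift K (Module.End Δ V) H (ρ.comp H.subtype)
  have hφ : ∀ h : H, φ (MonoidAlgebra.of K H h) = ρ h := fun h => MonoidAlgebra.lift_of _ _
  have : NeZero (Nat.card H : K) := ⟨Nat.cast_ne_zero.2 Nat.card_pos.ne'⟩
  have hss : IsSemisimpleRing φ.range := RingHom.isSemisimpleRing_of_surjective
    (φ.rangeRestrict : MonoidAlgebra K H →+* φ.range) φ.rangeRestrict_surjective
  obtain ⟨m, D, n, _, _, _, _, ⟨e⟩⟩ :=
    IsSemisimpleRing.exists_algEquiv_pi_matrix_divisionRing_finite K φ.range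
  let Φ : (∀ i, Matrix (Fin (n i)) (Fin (n i)) (D i)) →ₐ[K] Module.End Δ V :=
    φ.range.val.comp e.symm.toAlgHom
  obtain ⟨u, hu⟩ := finrank_centralizer_eq_sum Φ
  have hC : Representation.invariants ((conjRepresentation (K := K) ρ).comp H.subtype) =
      Subalgebra.toSubmodule (Subalgebra.centralizer K (Set.range Φ)) := by
    ext b
    have h1 := mem_invariants_conjRepresentation (K := K) (ρ.comp H.subtype) b
    have h2 : conjRepresentation (K := K) (ρ.comp H.subtype) =
      (conjRepresentation (K := K) ρ).comp H.subtype := rfl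
    rw [← h2, h1, Subalgebra.mem_toSubmodule, Subalgebra.mem_centralizer_iff]
    constructor
    · rintro h _ ⟨x, rfl⟩
      obtain ⟨y, hy⟩ := (e.symm x).2
      replace hy : φ y = Φ x := hy
      rw [← hy]
      clear hy
      induction y using MonoidAlgebra.induction_on with
      | of g => rw [hφ]; exact h g
      | add a a' ha ha' => rw [map_add, add_mul, mul_add, ha, ha']
      | smul r a ha => rw [map_smul, smul_mul_assoc, mul_smul_comm, ha]
    · intro h g
      refine h _ ⟨e ⟨φ (MonoidAlgebra.of K H g), _, rfl⟩, ?_⟩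
      exact (congrArg Subtype.val (e.symm_apply_apply _)).trans (hφ g)
  rw [hC, Subalgebra.finrank_toSubmodule, hu]
  refine Finset.dvd_sum fun i _ => dvd_finrank_cornerCentralizer hℓ (fun x y => ?_) (u i) hdvd
  let f : MonoidAlgebra K H →ₐ[K] Matrix (Fin (n i)) (Fin (n i)) (D i) :=
    (Pi.evalAlgHom K (fun i => Matrix (Fin (n i)) (Fin (n i)) (D i)) i).comp
      (e.toAlgHom.comp φ.rangeRestrict)
  have hf : Function.Surjective f := (Function.surjective_eval i).comp
    (e.surjective.comp φ.rangeRestrict_surjective)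
  exact hK.mul_comm_of_isAbelianByPGroup hp hℓ hH _
    (span_range_comp_eq_top _ MonoidAlgebra.span_range_of f hf) x y

end Main

section GroupSpanned

/-- Some matrix algebra over `A` is spanned over `K` by the image of a finite group. -/
def IsGroupSpanned (K A : Type) [Field K] [Ring A] [Algebra K A] : Prop :=
  ∃ (G : Type) (_ : Group G) (_ : Finite G) (ι : Type) (_ : Fintype ι) (_ : DecidableEq ι)
    (_ : Nonempty ι) (θ : G →* Matrix ι ι A), Submodule.span K (Set.range θ) = ⊤

theorem IsGroupSpanned.of_algEquiv_matrix {K A B : Type} [Field K] [Ring A] [Algebra K A] [Ring B]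
    [Algebra K B] (h : IsGroupSpanned K A) {n : ℕ} [NeZero n]
    (e : A ≃ₐ[K] Matrix (Fin n) (Fin n) B) : IsGroupSpanned K B := by
  obtain ⟨G, _, _, ι, _, _, _, θ, hθ⟩ := h
  let E : Matrix ι ι A ≃ₐ[K] Matrix (ι × Fin n) (ι × Fin n) B :=
    e.mapMatrix.trans (Matrix.compAlgEquiv ι (Fin n) B K)
  exact ⟨G, inferInstance, inferInstance, ι × Fin n, inferInstance, inferInstance, inferInstance, _,
    span_range_comp_eq_top θ hθ E.toAlgHom E.surjective⟩

theorem IsGroupSpanned.baseChange {K A : Type} [Field K] [Ring A] [Algebra K A]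
    (h : IsGroupSpanned K A) (L : Type) [Field L] [Algebra K L] : IsGroupSpanned L (L ⊗[K] A) := by
  obtain ⟨G, _, _, ι, _, _, _, θ, hθ⟩ := h
  let f : Matrix ι ι A →ₐ[K] Matrix ι ι (L ⊗[K] A) :=
    (Algebra.TensorProduct.includeRight : A →ₐ[K] L ⊗[K] A).mapMatrix
  refine ⟨G, inferInstance, inferInstance, ι, inferInstance, inferInstance, inferInstance,
    (f : _ →* _).comp θ, ?_⟩
  set S := Submodule.span L (Set.range ((f : Matrix ι ι A →* Matrix ι ι (L ⊗[K] A)).comp θ))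
  have h1 : ∀ x : Matrix ι ι A, f x ∈ S := by
    intro x
    have hx : x ∈ Submodule.span K (Set.range θ) := hθ ▸ Submodule.mem_top
    induction hx using Submodule.span_induction with
    | mem x hx => obtain ⟨g, rfl⟩ := hx; exact Submodule.subset_span ⟨g, rfl⟩
    | zero => rw [map_zero]; exact S.zero_mem
    | add x y _ _ hx hy => rw [map_add]; exact S.add_mem hx hy
    | smul k x _ hx =>
      rw [map_smul, ← algebraMap_smul L k (f x)]
      exact S.smul_mem _ hx
  rw [eq_top_iff]
  intro X _
  rw [Matrix.matrix_eq_sum_single X]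
  refine S.sum_mem fun i _ => S.sum_mem fun j _ => ?_
  induction X i j using TensorProduct.induction_on with
  | zero => rw [Matrix.single_zero]; exact S.zero_mem
  | add x y hx hy => rw [Matrix.single_add]; exact S.add_mem hx hy
  | tmul l a =>
    have h2 : Matrix.single i j (l ⊗ₜ[K] a) = l • f (Matrix.single i j a) := by
      change _ = l • (Matrix.single i j a).map _
      rw [Matrix.map_single, Matrix.smul_single]
      simp [TensorProduct.smul_tmul']
    rw [h2]
    exact S.smul_mem _ (h1 _)

theorem IsGroupSpanned.finrank_eq_one {p : ℕ} {K : Type} [Field K]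
    (hK : IsSchurSplittingField p K) (hp : p.Prime) {D : Type} [DivisionRing D] [Algebra K D]
    [FiniteDimensional K D] [Algebra.IsCentral K D] (h : IsGroupSpanned K D) :
    Module.finrank K D = 1 := by
  obtain ⟨G, _, _, ι, _, _, _, θ, hθ⟩ := h
  have : FiniteDimensional K Dᵐᵒᵖ := Module.Finite.equiv (MulOpposite.opLinearEquiv K)
  obtain ⟨E⟩ : Nonempty (Matrix ι ι D ≃ₐ[K] Module.End Dᵐᵒᵖ (ι → Dᵐᵒᵖ)) :=
    ⟨matrixAlgEquivEndVec K D ι⟩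
  have h1 := span_range_comp_eq_top θ hθ E.toAlgHom E.surjective
  let ρ : G →* Module.End Dᵐᵒᵖ (ι → Dᵐᵒᵖ) := (E.toAlgHom : _ →* _).comp θ
  have key := @IsSchurSplittingField.finrank_eq_one p K _ hK hp Dᵐᵒᵖ _ _ _ _ (ι → Dᵐᵒᵖ)
    _ _ _ _ _ _ G _ _ ρ h1
  rwa [(MulOpposite.opLinearEquiv K : D ≃ₗ[K] Dᵐᵒᵖ).finrank_eq]

end GroupSpanned

section SchurIndex

theorem exists_mul_self_eq_finrank (K D : Type) [Field K] [DivisionRing D] [Algebra K D]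
    [FiniteDimensional K D] [Algebra.IsCentral K D] : ∃ m : ℕ, m * m = Module.finrank K D := by
  let L := AlgebraicClosure K
  have := isSimpleRing_field_tensorProduct K L D
  obtain ⟨n, _, ⟨e⟩⟩ := IsSimpleRing.exists_algEquiv_matrix_of_isAlgClosed L (L ⊗[K] D)
  refine ⟨n, ?_⟩
  have h := e.toLinearEquiv.finrank_eq
  rw [Module.finrank_baseChange, Module.finrank_matrix, Module.finrank_self] at h
  simpa using h.symm

theorem Algebra.IsCentral.of_algEquiv_matrix {K A D : Type} [Field K] [Ring A] [Algebra K A]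
    [Algebra.IsCentral K A] [DivisionRing D] [Algebra K D] {n : ℕ} [NeZero n]
    (e : A ≃ₐ[K] Matrix (Fin n) (Fin n) D) : Algebra.IsCentral K D where
  out := by
    have : Algebra.IsCentral K (Matrix (Fin n) (Fin n) D) := Algebra.IsCentral.of_algEquiv K _ _ e
    intro x hx
    rw [Subalgebra.mem_center_iff] at hx
    have h1 : Matrix.scalar (Fin n) x ∈ Subalgebra.center K (Matrix (Fin n) (Fin n) D) :=
      Subalgebra.mem_center_iff.2 fun M => (Matrix.scalar_commute x (fun y => (hx y).symm) M).symm
    rw [Algebra.IsCentral.center_eq_bot, Algebra.mem_bot] at h1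
    obtain ⟨k, hk⟩ := h1
    refine Algebra.mem_bot.2 ⟨k, ?_⟩
    have := congrFun (congrFun hk 0) 0
    simpa [Matrix.algebraMap_matrix_apply] using this

theorem schurIndex_dvd_finrank {p : ℕ} (hp : p.Prime) {K₀ A : Type} [Field K₀] [Ring A]
    [Algebra K₀ A] [FiniteDimensional K₀ A] [IsSimpleRing A] [Algebra.IsCentral K₀ A]
    (hA : IsGroupSpanned K₀ A) {K : Type} [Field K] [Algebra K₀ K] [FiniteDimensional K₀ K]
    (hK : IsSchurSplittingField p K) : schurIndex K₀ A ∣ Module.finrank K₀ K := by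
  have hmem : schurIndex K₀ A ∈ {m | ∃ (D : Type) (_ : DivisionRing D) (_ : Algebra K₀ D) (r : ℕ),
      Nonempty (A ≃ₐ[K₀] Matrix (Fin r) (Fin r) D) ∧ m * m = Module.finrank K₀ D} := by
    refine Nat.sInf_mem ?_
    have := IsArtinianRing.of_finite K₀ A
    obtain ⟨n, _, D, _, _, _, ⟨e⟩⟩ := IsSimpleRing.exists_algEquiv_matrix_divisionRing_finite K₀ A
    have : Algebra.IsCentral K₀ D := .of_algEquiv_matrix e
    obtain ⟨m, hm⟩ := exists_mul_self_eq_finrank K₀ D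
    exact ⟨m, D, _, _, n, ⟨e⟩, hm⟩
  obtain ⟨D, _, _, r, ⟨e⟩, hm⟩ := hmem
  set m := schurIndex K₀ A
  have : NeZero r := ⟨by
    rintro rfl
    exact one_ne_zero (e.injective (Subsingleton.elim (e 1) (e 0)))⟩
  have : Algebra.IsCentral K₀ D := .of_algEquiv_matrix e
  have : FiniteDimensional K₀ D :=
    .of_surjective ((Matrix.entryLinearMap K₀ D (0 : Fin r) (0 : Fin r)) ∘ₗ e.toLinearMap)
      (fun d => ⟨e.symm (Matrix.single 0 0 d), by simp⟩)
  have hD := (hA.of_algEquiv_matrix e).baseChange K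
  have := isSimpleRing_field_tensorProduct K₀ K D
  have := isCentral_field_tensorProduct K₀ K D
  have := IsArtinianRing.of_finite K (K ⊗[K₀] D)
  obtain ⟨u, _, Δ, _, _, _, ⟨f⟩⟩ :=
    IsSimpleRing.exists_algEquiv_matrix_divisionRing_finite K (K ⊗[K₀] D)
  have : Algebra.IsCentral K Δ := .of_algEquiv_matrix f
  have h1 := (hD.of_algEquiv_matrix f).finrank_eq_one hK hp
  let g : K ≃ₐ[K] Δ := AlgEquiv.ofBijective (Algebra.ofId K Δ)
    ⟨(algebraMap K Δ).injective, fun d => by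
      obtain ⟨k, hk⟩ := (finrank_eq_one_iff_of_nonzero' (1 : Δ) one_ne_zero).1 h1 d
      exact ⟨k, by rw [← hk, Algebra.ofId_apply, Algebra.algebraMap_eq_smul_one]⟩⟩
  let F : K ⊗[K₀] D ≃ₐ[K] Matrix (Fin u) (Fin u) K := f.trans g.symm.mapMatrix
  have hu : m = u := by
    have h := F.toLinearEquiv.finrank_eq
    rw [Module.finrank_baseChange, Module.finrank_matrix, Module.finrank_self, ← hm] at h
    exact Nat.mul_self_inj.1 (by simpa using h)
  let φ : D →ₐ[K₀] Matrix (Fin u) (Fin u) K :=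
    (F.toAlgHom.restrictScalars K₀).comp Algebra.TensorProduct.includeRight
  let _ : Module D (Fin u → K) :=
    { smul := fun d v => (φ d).mulVec v
      one_smul := fun v => by
        change (φ 1).mulVec v = v
        rw [map_one, Matrix.one_mulVec]
      mul_smul := fun c d v => by
        change (φ (c * d)).mulVec v = (φ c).mulVec ((φ d).mulVec v)
        rw [map_mul, Matrix.mulVec_mulVec]
      smul_zero := fun d => Matrix.mulVec_zero _
      smul_add := fun d v w => Matrix.mulVec_add _ _ _
      add_smul := fun c d v => by
        change (φ (c + d)).mulVec v = (φ c).mulVec v + (φ d).mulVec v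
        rw [map_add, Matrix.add_mulVec]
      zero_smul := fun v => by
        change (φ 0).mulVec v = 0
        rw [map_zero, Matrix.zero_mulVec] }
  have : IsScalarTower K₀ D (Fin u → K) := ⟨fun k d v => by
    change (φ (k • d)).mulVec v = k • (φ d).mulVec v
    rw [map_smul, Matrix.smul_mulVec]⟩
  have h2 := Module.finrank_mul_finrank K₀ D (Fin u → K)
  rw [Module.finrank_pi_fintype, Finset.sum_const, Finset.card_univ, Fintype.card_fin,
    smul_eq_mul, ← hm, hu, mul_assoc] at h2
  rw [hu]
  exact ⟨_, (Nat.eq_of_mul_eq_mul_left (Nat.pos_of_ne_zero (NeZero.ne u)) h2).symm⟩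

end SchurIndex

section SimpleComponent

theorem nontrivial_simpleComponent {R : Type*} [Ring R] {e : R}
    (he : IsCentrallyPrimitiveIdempotent R e) : Nontrivial (simpleComponent R e) := by
  obtain ⟨hc, hee, hne, -⟩ := he
  rw [Subring.mem_center_iff] at hc
  let I : TwoSidedIdeal R := .mk' {x | e * x = 0} (mul_zero e)
    (fun {x y} hx hy => by rw [Set.mem_ofPred_eq, mul_add, hx, hy, add_zero])
    (fun {x} hx => by rw [Set.mem_ofPred_eq, mul_neg, hx, neg_zero])
    (fun {x y} hy => by rw [Set.mem_ofPred_eq, ← mul_assoc, ← hc, mul_assoc, hy, mul_zero])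
    (fun {x y} hx => by rw [Set.mem_ofPred_eq, ← mul_assoc, hx, zero_mul])
  have hI : TwoSidedIdeal.span {1 - e} ≤ I := by
    rw [TwoSidedIdeal.span_le, Set.singleton_subset_iff, SetLike.mem_coe, TwoSidedIdeal.mem_mk']
    rw [Set.mem_ofPred_eq, mul_sub, mul_one, hee, sub_self]
  refine ⟨⟨1, 0, fun h => hne ?_⟩⟩
  have h1 : (TwoSidedIdeal.span {1 - e}).ringCon 1 0 := (RingCon.eq _).1 h
  have h2 : (1 : R) ∈ I := hI ((TwoSidedIdeal.mem_iff _ _).2 h1)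
  rw [TwoSidedIdeal.mem_mk', Set.mem_ofPred_eq, mul_one] at h2
  exact h2

theorem isGroupSpanned_of_simpleComponent {F : Type} [Field F] {G : Type} [Group G] [Finite G]
    {e : MonoidAlgebra F G} (he : IsCentrallyPrimitiveIdempotent (MonoidAlgebra F G) e)
    {D : Type} [DivisionRing D] {Z : Type} [Field Z] [Algebra Z D]
    (hZ : Set.range (algebraMap Z D) = (Subring.center D : Set D)) {r : ℕ}
    (hD : simpleComponent (MonoidAlgebra F G) e ≃+* Matrix (Fin r) (Fin r) D) :
    IsGroupSpanned Z D := by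
  have := nontrivial_simpleComponent he
  have : NeZero r := ⟨by
    rintro rfl
    exact one_ne_zero (hD.injective (Subsingleton.elim (hD 1) (hD 0)))⟩
  let q : MonoidAlgebra F G →+* Matrix (Fin r) (Fin r) D :=
    (hD : _ →+* _).comp (TwoSidedIdeal.span {1 - e}).ringCon.mk'
  have hq : Function.Surjective q :=
    hD.surjective.comp (RingCon.mk'_surjective _)
  have hF : ∀ a : F, ∃ z : Z, q (algebraMap F _ a) = algebraMap Z _ z := by
    intro a
    have h1 : ∀ M, q (algebraMap F _ a) * M = M * q (algebraMap F _ a) := by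
      intro M
      obtain ⟨x, rfl⟩ := hq M
      rw [← map_mul, ← map_mul, Algebra.commutes]
    have h2 : q (algebraMap F _ a) ∈ Set.center (Matrix (Fin r) (Fin r) D) :=
      Semigroup.mem_center_iff.2 fun M => (h1 M).symm
    rw [Matrix.center_eq_scalar_image] at h2
    obtain ⟨d, hd, hda⟩ := h2
    obtain ⟨z, hz⟩ : d ∈ Set.range (algebraMap Z D) := hZ ▸ hd
    exact ⟨z, by rw [← hda, ← hz]; rfl⟩
  refine ⟨G, inferInstance, inferInstance, Fin r, inferInstance, inferInstance, inferInstance,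
    (q : _ →* _).comp (MonoidAlgebra.of F G), ?_⟩
  rw [eq_top_iff]
  intro X _
  obtain ⟨x, rfl⟩ := hq X
  induction x using MonoidAlgebra.induction_on with
  | of g => exact Submodule.subset_span ⟨g, rfl⟩
  | add x y hx hy => rw [map_add]; exact Submodule.add_mem _ (hx trivial) (hy trivial)
  | smul a x hx =>
    obtain ⟨z, hz⟩ := hF a
    rw [Algebra.smul_def, map_mul, hz, ← Algebra.smul_def]
    exact Submodule.smul_mem _ z (hx trivial)

end SimpleComponent

theorem schurIndex_adicCompletion_dvd {D Z : Type} [DivisionRing D] [Field Z] [NumberField Z]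
    [Algebra Z D] [FiniteDimensional Z D]
    (hZ : Set.range (algebraMap Z D) = (Subring.center D : Set D)) (h : IsGroupSpanned Z D)
    (v : IsDedekindDomain.HeightOneSpectrum (NumberField.RingOfIntegers Z)) (p : ℕ) (hp : p.Prime)
    (hv : (p : NumberField.RingOfIntegers Z) ∈ v.asIdeal) :
    schurIndex (v.adicCompletion Z) ((v.adicCompletion Z) ⊗[Z] D) ∣
      (if p = 2 then 2 else p - 1) := by
  have : Algebra.IsCentral Z D := ⟨fun d hd => by
    have : d ∈ Set.range (algebraMap Z D) :=
      hZ ▸ Subring.mem_center_iff.2 (Subalgebra.mem_center_iff.1 hd)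
    exact Algebra.mem_bot.2 this⟩
  have := isSimpleRing_field_tensorProduct Z (v.adicCompletion Z) D
  have := isCentral_field_tensorProduct Z (v.adicCompletion Z) D
  obtain ⟨K, _, _, _, hK, hdvd⟩ := exists_isSchurSplittingField v p hp hv
  exact (schurIndex_dvd_finrank hp (h.baseChange (v.adicCompletion Z)) hK).trans hdvd

theorem schur_stmt10
    (F : Type) [Field F] [NumberField F] [IsGalois ℚ F]
    (hab : ∀ g h : F ≃ₐ[ℚ] F, g * h = h * g)
    (G : Type) [Group G] [Fintype G]
    (e : MonoidAlgebra F G) (he : IsCentrallyPrimitiveIdempotent (MonoidAlgebra F G) e)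
    (D : Type) [DivisionRing D]
    (Z : Type) [Field Z] [NumberField Z] [Algebra Z D] [FiniteDimensional Z D]
    (hZ : Set.range (algebraMap Z D) = (Subring.center D : Set D))
    (r : ℕ)
    (hD : Nonempty (simpleComponent (MonoidAlgebra F G) e ≃+* Matrix (Fin r) (Fin r) D)) :
    (∀ v : IsDedekindDomain.HeightOneSpectrum (NumberField.RingOfIntegers Z),
      (2 : NumberField.RingOfIntegers Z) ∈ v.asIdeal →
        schurIndex (v.adicCompletion Z) ((v.adicCompletion Z) ⊗[Z] D) ≤ 2) ∧
    ∀ p : ℕ, p.Prime → Odd p →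
      ∀ v : IsDedekindDomain.HeightOneSpectrum (NumberField.RingOfIntegers Z),
        (p : NumberField.RingOfIntegers Z) ∈ v.asIdeal →
          schurIndex (v.adicCompletion Z) ((v.adicCompletion Z) ⊗[Z] D) ∣ (p - 1) := by
  obtain ⟨E⟩ := hD
  have h := isGroupSpanned_of_simpleComponent he hZ E
  refine ⟨fun v hv => ?_, fun p hp hodd v hv => ?_⟩
  · have h2 := schurIndex_adicCompletion_dvd hZ h v 2 Nat.prime_two (by exact_mod_cast hv)
    rw [if_pos rfl] at h2
    exact Nat.le_of_dvd two_pos h2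
  · have h2 := schurIndex_adicCompletion_dvd hZ h v p hp hv
    rwa [if_neg (by rintro rfl; exact absurd hodd (by decide))] at h2
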